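/- arXiv:1101.4102 — 4 statements merged into one kernel-verified Lean document; each statement's English description precedes it below -/
import Mathlib

section
/- The intersection of two uniformly prox-regular sets need not be uniformly prox-regular with a constant depending only on the two prox-regularity constants: for every ε > 0 there exist two sets in ℝ², each uniformly prox-regular with constant 1 (complements of open unit disks), whose intersection is uniformly prox-regular with constant at most ε (and with no larger constant). -/
noncomputable section
open Metric

/-- Proximal normal cone. -/
def proxNormalCone {E : Type*} [NormedAddCommGroup E] [NormedSpace ℝ E]
    (K : Set E) (q : E) : Set E :=
  {v | ∃ α : ℝ, 0 < α ∧ ∀ y ∈ K, dist q (q + α • v) ≤ dist y (q + α • v)}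

/-- `η`-prox-regularity at a point. -/
def ProxRegularAt {E : Type*} [NormedAddCommGroup E] [NormedSpace ℝ E]
    (K : Set E) (η : ℝ) (q : E) : Prop :=
  ∀ v ∈ proxNormalCone K q, ‖v‖ = 1 → ball (q + η • v) η ∩ K = ∅

/-- Uniform `η`-prox-regularity. -/
def UniformProxRegular {E : Type*} [NormedAddCommGroup E] [NormedSpace ℝ E]
    (K : Set E) (η : ℝ) : Prop :=
  ∀ q ∈ frontier K, ProxRegularAt K η q

section aux
variable {E : Type*} [NormedAddCommGroup E] [InnerProductSpace ℝ E]

lemma aux_inner_nonpos {K : Set E} {q v w : E} (hv : v ∈ proxNormalCone K q)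
    {δ : ℝ} (hδ : 0 < δ) (hw : ∀ t : ℝ, 0 < t → t < δ → q + t • w ∈ K) :
    inner ℝ v w ≤ 0 := by
  obtain ⟨α, hα, h⟩ := hv
  by_contra! hc
  have hN : 0 ≤ ‖w‖ ^ 2 := by positivity
  obtain ⟨t, ht0, htδ, ht⟩ : ∃ t : ℝ, 0 < t ∧ t < δ ∧ t * ‖w‖ ^ 2 < 2 * α * inner ℝ v w := by
    have hp : 0 < 2 * α * inner ℝ v w := by positivity
    refine ⟨min (δ / 2) (2 * α * inner ℝ v w / (‖w‖ ^ 2 + 1)), by positivity, ?_, ?_⟩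
    · exact lt_of_le_of_lt (min_le_left _ _) (by linarith)
    · have h1 := min_le_right (δ / 2) (2 * α * inner ℝ v w / (‖w‖ ^ 2 + 1))
      have h0 : 0 < min (δ / 2) (2 * α * inner ℝ v w / (‖w‖ ^ 2 + 1)) := by positivity
      rw [le_div_iff₀ (by positivity)] at h1
      nlinarith
  have h2 := h _ (hw t ht0 htδ)
  rw [dist_eq_norm, dist_eq_norm] at h2
  have e1 : q - (q + α • v) = -(α • v) := by abel
  have e2 : q + t • w - (q + α • v) = t • w - α • v := by abel
  rw [e1, e2, norm_neg] at h2
  have h3 : ‖α • v‖ ^ 2 ≤ ‖t • w - α • v‖ ^ 2 := by gcongr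
  rw [norm_sub_sq_real, norm_smul, norm_smul, real_inner_smul_left, real_inner_smul_right,
    real_inner_comm, Real.norm_of_nonneg ht0.le, Real.norm_of_nonneg hα.le] at h3
  have : t * (2 * α * inner ℝ v w - t * ‖w‖ ^ 2) ≤ 0 := by nlinarith
  have : 0 < t * (2 * α * inner ℝ v w - t * ‖w‖ ^ 2) := mul_pos ht0 (by linarith)
  linarith

lemma aux_notMem {c q w : E} (hq : dist q c = 1) (hw : inner ℝ (c - q) w ≤ 0) :
    q + w ∉ ball c 1 := by
  rw [mem_ball, not_lt, dist_eq_norm]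
  rw [dist_eq_norm] at hq
  have h : ‖q + w - c‖ ^ 2 = ‖q - c‖ ^ 2 - 2 * inner ℝ (c - q) w + ‖w‖ ^ 2 := by
    have e : q + w - c = w - (c - q) := by abel
    rw [e, norm_sub_sq_real, real_inner_comm, norm_sub_rev c q]; ring
  rw [hq] at h
  nlinarith [norm_nonneg (q + w - c), sq_nonneg ‖w‖]

lemma aux_normal {K : Set E} {c q v : E} (hq : dist q c = 1) (hv : v ∈ proxNormalCone K q)
    (hv1 : ‖v‖ = 1) {δ : ℝ} (hδ : 0 < δ)
    (hK : ∀ y, dist y q < δ → y ∉ ball c 1 → y ∈ K) : v = c - q := by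
  have hu : ‖c - q‖ = 1 := by rw [← dist_eq_norm, dist_comm]; exact hq
  have hcs : inner ℝ (c - q) v ≤ 1 := by
    have := real_inner_le_norm (c - q) v
    rwa [hu, hv1, one_mul] at this
  have key : inner ℝ v (v - (c - q)) ≤ 0 := by
    refine aux_inner_nonpos hv (δ := δ / (‖v - (c - q)‖ + 1)) (by positivity) ?_
    intro t ht htδ
    rw [lt_div_iff₀ (by positivity)] at htδ
    apply hK
    · rw [dist_eq_norm, add_sub_cancel_left, norm_smul, Real.norm_of_nonneg ht.le]
      nlinarith
    · apply aux_notMem hq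
      rw [real_inner_smul_right, inner_sub_right, real_inner_self_eq_norm_sq, hu]
      nlinarith
  rw [inner_sub_right, real_inner_self_eq_norm_sq, hv1, real_inner_comm] at key
  have h : ‖v - (c - q)‖ ^ 2 ≤ 0 := by
    rw [norm_sub_sq_real, hv1, hu, real_inner_comm]; nlinarith
  have : ‖v - (c - q)‖ = 0 := by nlinarith [norm_nonneg (v - (c - q))]
  exact sub_eq_zero.mp (norm_eq_zero.mp this)

lemma aux_ball {c q : E} (hq : dist q c = 1) {η : ℝ} (h1 : η ≤ 1) :
    ball (q + η • (c - q)) η ⊆ ball c 1 := by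
  apply ball_subset_ball'
  have e : q + η • (c - q) - c = (1 - η) • (q - c) := by module
  rw [dist_eq_norm, e, norm_smul, ← dist_eq_norm q c, hq, Real.norm_of_nonneg (by linarith)]
  linarith

lemma aux_single [Nontrivial E] (c : E) : UniformProxRegular (ball c 1)ᶜ 1 := by
  intro q hq v hv hv1
  rw [frontier_compl, frontier_ball c one_ne_zero, mem_sphere] at hq
  have := aux_normal hq hv hv1 one_pos (fun y _ h => h)
  subst this
  rw [← Set.disjoint_iff_inter_eq_empty, Set.disjoint_compl_right_iff_subset]
  exact aux_ball hq le_rfl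

/-- A boundary point lying on just one of the two circles. -/
lemma aux_smooth {c₁ c₂ q : E} (h1 : dist q c₁ = 1) (h2 : 1 < dist q c₂) {η : ℝ} (hη : η ≤ 1) :
    ProxRegularAt ((ball c₁ 1)ᶜ ∩ (ball c₂ 1)ᶜ) η q := by
  intro v hv hv1
  have := aux_normal h1 hv hv1 (δ := dist q c₂ - 1) (by linarith) (fun y hy h => ⟨h, by
    rw [Set.mem_compl_iff, mem_ball, not_lt]
    have := dist_triangle q y c₂
    rw [dist_comm q y] at this
    linarith⟩)
  subst this
  rw [← Set.disjoint_iff_inter_eq_empty]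
  exact (Set.disjoint_compl_right_iff_subset.2 (aux_ball h1 hη)).mono_right Set.inter_subset_left

end aux

lemma aux_dist (x y : EuclideanSpace ℝ (Fin 2)) :
    dist x y ^ 2 = (x 0 - y 0) ^ 2 + (x 1 - y 1) ^ 2 := by
  rw [EuclideanSpace.dist_eq, Real.sq_sqrt (by positivity), Fin.sum_univ_two,
    Real.dist_eq, Real.dist_eq, sq_abs, sq_abs]

lemma aux_corner {a h : ℝ} (ha : 0 < a) (hh : 0 < h) (hah : a ^ 2 + h ^ 2 = 1)
    {q : EuclideanSpace ℝ (Fin 2)}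
    (h1 : dist q !₂[-a, 0] = 1) (h2 : dist q !₂[a, 0] = 1) :
    ProxRegularAt ((ball !₂[-a, 0] 1)ᶜ ∩ (ball !₂[a, 0] 1)ᶜ) h q := by
  intro v hv hv1
  have d1 := aux_dist q !₂[-a, 0]
  have d2 := aux_dist q !₂[a, 0]
  rw [h1] at d1
  rw [h2] at d2
  simp at d1 d2
  have q0 : q 0 = 0 := by
    have : a * q 0 = 0 := by nlinarith
    exact (mul_eq_zero.mp this).resolve_left ha.ne'
  rw [q0] at d1 d2
  have q1 : (q 1) ^ 2 = h ^ 2 := by nlinarith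
  have vn : v 0 ^ 2 + v 1 ^ 2 = 1 := by
    have := aux_dist v 0
    rw [dist_zero_right, hv1] at this
    simpa using this.symm
  have A : h ^ 2 * v 0 + a * q 1 * v 1 ≤ 0 := by
    have := aux_inner_nonpos (w := !₂[h ^ 2, a * q 1]) hv one_pos (fun t ht _ => ⟨?_, ?_⟩)
    · simp [PiLp.inner_apply, Fin.sum_univ_two] at this
      linarith
    · apply aux_notMem h1
      simp [PiLp.inner_apply, Fin.sum_univ_two, q0]
      have e : t * (a * q 1) * q 1 = t * a * h ^ 2 := by rw [← q1]; ring
      linarith [mul_pos (mul_pos ht ha) (pow_pos hh 2)]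
    · apply aux_notMem h2
      simp [PiLp.inner_apply, Fin.sum_univ_two, q0]
      have e : t * (a * q 1) * q 1 = t * a * h ^ 2 := by rw [← q1]; ring
      linarith [mul_pos (mul_pos ht ha) (pow_pos hh 2)]
  have B : -h ^ 2 * v 0 + a * q 1 * v 1 ≤ 0 := by
    have := aux_inner_nonpos (w := !₂[-h ^ 2, a * q 1]) hv one_pos (fun t ht _ => ⟨?_, ?_⟩)
    · simp [PiLp.inner_apply, Fin.sum_univ_two] at this
      linarith
    · apply aux_notMem h1
      simp [PiLp.inner_apply, Fin.sum_univ_two, q0]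
      have e : t * (a * q 1) * q 1 = t * a * h ^ 2 := by rw [← q1]; ring
      linarith [mul_pos (mul_pos ht ha) (pow_pos hh 2)]
    · apply aux_notMem h2
      simp [PiLp.inner_apply, Fin.sum_univ_two, q0]
      have e : t * (a * q 1) * q 1 = t * a * h ^ 2 := by rw [← q1]; ring
      linarith [mul_pos (mul_pos ht ha) (pow_pos hh 2)]
  rw [Set.eq_empty_iff_forall_notMem]
  rintro y ⟨hy, hy1, hy2⟩
  rw [Set.mem_compl_iff, mem_ball, not_lt] at hy1 hy2
  rw [mem_ball] at hy
  have e0 : dist y (q + h • v) ^ 2 < h ^ 2 := by gcongr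
  have e1 : 1 ^ 2 ≤ dist y !₂[-a, 0] ^ 2 := by gcongr
  have e2 : 1 ^ 2 ≤ dist y !₂[a, 0] ^ 2 := by gcongr
  rw [aux_dist] at e0 e1 e2
  simp [q0] at e0 e1 e2
  generalize hz : y 1 - q 1 = z at *
  have hy1' : y 1 = q 1 + z := by linarith
  rw [hy1'] at e0 e1 e2
  generalize q 1 = r at *
  generalize y 0 = x at *
  generalize v 0 = m at *
  generalize v 1 = n at *
  -- the three quadratic inequalities
  have f0 : x ^ 2 + z ^ 2 < 2 * h * (m * x + n * z) := by
    have : h ^ 2 * (m ^ 2 + n ^ 2) = h ^ 2 := by rw [vn, mul_one]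
    nlinarith
  have f1 : 2 * (-a * x - r * z) ≤ x ^ 2 + z ^ 2 := by nlinarith
  have f2 : 2 * (a * x - r * z) ≤ x ^ 2 + z ^ 2 := by nlinarith
  -- combine with the nonnegative cone coefficients
  have g1 := mul_le_mul_of_nonneg_left f1 (by linarith : 0 ≤ -(h ^ 2 * m + a * r * n))
  have g2 := mul_le_mul_of_nonneg_left f2 (by linarith : 0 ≤ -(-h ^ 2 * m + a * r * n))
  have g3 : 2 * a * h ^ 2 * (m * x + n * z) ≤ -(a * r * n) * (x ^ 2 + z ^ 2) := by
    have : 2 * a * h ^ 2 * (n * z) = 2 * a * r ^ 2 * (n * z) := by rw [q1]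
    linarith
  have g4 : 2 * h * h * (m * x + n * z) ≤ -(r * n) * (x ^ 2 + z ^ 2) := by
    refine le_of_mul_le_mul_left ?_ ha
    linarith
  have g5 : -(r * n) ≤ h := by
    apply le_of_abs_le; refine abs_le_of_sq_le_sq ?_ hh.le
    have : (-(r * n)) ^ 2 = h ^ 2 * n ^ 2 := by rw [← q1]; ring
    rw [this]
    nlinarith [mul_nonneg (sq_nonneg h) (sq_nonneg m)]
  have g6 := mul_le_mul_of_nonneg_right g5 (by positivity : 0 ≤ x ^ 2 + z ^ 2)
  have g7 := mul_lt_mul_of_pos_left f0 hh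
  linarith

/-- The prox-regularity constant of the intersection of two complements of open
unit disks can be arbitrarily small, while each factor is `1`-prox-regular. -/
theorem intersection_prox_regularity_degenerates :
    ∀ ε : ℝ, 0 < ε → ∃ c₁ c₂ : EuclideanSpace ℝ (Fin 2),
      UniformProxRegular (ball c₁ 1)ᶜ 1 ∧
      UniformProxRegular (ball c₂ 1)ᶜ 1 ∧
      ∃ η : ℝ, 0 < η ∧ η ≤ ε ∧
        UniformProxRegular ((ball c₁ 1)ᶜ ∩ (ball c₂ 1)ᶜ) η ∧
        ∀ η' : ℝ, η < η' → ¬ UniformProxRegular ((ball c₁ 1)ᶜ ∩ (ball c₂ 1)ᶜ) η' := by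
  intro ε hε
  obtain ⟨h, hh, hle, hh1⟩ : ∃ h : ℝ, 0 < h ∧ h ≤ ε ∧ h < 1 :=
    ⟨min ε (1 / 2), by positivity, min_le_left _ _, lt_of_le_of_lt (min_le_right _ _) (by norm_num)⟩
  obtain ⟨a, ha, hah⟩ : ∃ a : ℝ, 0 < a ∧ a ^ 2 + h ^ 2 = 1 := by
    have : 0 < 1 - h ^ 2 := by nlinarith
    exact ⟨√(1 - h ^ 2), Real.sqrt_pos.2 this, by rw [Real.sq_sqrt this.le]; ring⟩
  refine ⟨!₂[-a, 0], !₂[a, 0], aux_single _, aux_single _, h, hh, hle, ?_, ?_⟩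
  · intro q hq
    have hc : ∀ c : EuclideanSpace ℝ (Fin 2), closure (ball c 1)ᶜ = (ball c 1)ᶜ :=
      fun c => isOpen_ball.isClosed_compl.closure_eq
    have hq' := frontier_inter_subset _ _ hq
    simp only [frontier_compl, frontier_ball _ one_ne_zero, hc, Set.mem_union, Set.mem_inter_iff,
      mem_sphere, Set.mem_compl_iff, mem_ball, not_lt] at hq'
    rcases hq' with ⟨h1, h2⟩ | ⟨h1, h2⟩
    · rcases h2.eq_or_lt with h2 | h2
      · exact aux_corner ha hh hah h1 h2.symm
      · exact aux_smooth h1 h2 hh1.le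
    · rcases h1.eq_or_lt with h1 | h1
      · exact aux_corner ha hh hah h1.symm h2
      · rw [Set.inter_comm]
        exact aux_smooth h2 h1 hh1.le
  · intro η hη hreg
    have hd : ∀ b : ℝ, b ^ 2 = a ^ 2 → ∀ r : ℝ, r ^ 2 = h ^ 2 →
        dist (!₂[0, r] : EuclideanSpace ℝ (Fin 2)) !₂[b, 0] = 1 := by
      intro b hb r hr
      have := aux_dist !₂[0, r] !₂[b, 0]
      simp only [Matrix.cons_val_zero, Matrix.cons_val_one] at this
      have h3 : dist (!₂[0, r] : EuclideanSpace ℝ (Fin 2)) !₂[b, 0] ^ 2 = 1 := by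
        rw [this]; nlinarith
      exact (pow_eq_one_iff_of_nonneg dist_nonneg two_ne_zero).1 h3
    have hmem : ∀ r : ℝ, r ^ 2 = h ^ 2 → (!₂[0, r] : EuclideanSpace ℝ (Fin 2)) ∈
        (ball !₂[-a, 0] 1)ᶜ ∩ (ball !₂[a, 0] 1)ᶜ := by
      intro r hr
      simp only [Set.mem_inter_iff, Set.mem_compl_iff, mem_ball, not_lt]
      exact ⟨(hd _ (by ring) r hr).ge, (hd _ rfl r hr).ge⟩
    have hfr : (!₂[0, h] : EuclideanSpace ℝ (Fin 2)) ∈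
        frontier ((ball !₂[-a, 0] 1)ᶜ ∩ (ball !₂[a, 0] 1)ᶜ) := by
      rw [frontier_eq_closure_inter_closure]
      refine ⟨subset_closure (hmem h rfl), ?_⟩
      have hs : ball (!₂[a, 0] : EuclideanSpace ℝ (Fin 2)) 1 ⊆
          ((ball !₂[-a, 0] 1)ᶜ ∩ (ball !₂[a, 0] 1)ᶜ)ᶜ := fun y hy hy' => hy'.2 hy
      apply closure_mono hs
      rw [closure_ball _ one_ne_zero, mem_closedBall]
      exact (hd _ rfl h rfl).le
    have hcone : (!₂[0, -1] : EuclideanSpace ℝ (Fin 2)) ∈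
        proxNormalCone ((ball !₂[-a, 0] 1)ᶜ ∩ (ball !₂[a, 0] 1)ᶜ) !₂[0, h] := by
      refine ⟨h, hh, ?_⟩
      rintro y ⟨hy1, hy2⟩
      rw [Set.mem_compl_iff, mem_ball, not_lt] at hy1 hy2
      have e1 : 1 ^ 2 ≤ dist y !₂[-a, 0] ^ 2 := by gcongr
      have e2 : 1 ^ 2 ≤ dist y !₂[a, 0] ^ 2 := by gcongr
      refine le_of_abs_le (abs_le_of_sq_le_sq ?_ dist_nonneg)
      rw [aux_dist] at e1 e2 ⊢
      rw [aux_dist]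
      simp at e1 e2 ⊢
      nlinarith
    have hnorm : ‖(!₂[0, -1] : EuclideanSpace ℝ (Fin 2))‖ = 1 := by
      simp [EuclideanSpace.norm_eq, Fin.sum_univ_two]
    have hemp := hreg _ hfr _ hcone hnorm
    have : (!₂[0, -h] : EuclideanSpace ℝ (Fin 2)) ∈ (∅ : Set (EuclideanSpace ℝ (Fin 2))) := by
      rw [← hemp]
      refine ⟨?_, hmem (-h) (by ring)⟩
      rw [mem_ball]
      apply lt_of_pow_lt_pow_left₀ 2 (by linarith)
      rw [aux_dist]
      simp
      nlinarith
    exact this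
end
end

section
/- Let Ω ⊆ ℝ^d be convex and compact. The set K = {ρ ∈ 𝒫(Ω) : ρ ≪ Leb, dρ/dLeb ≤ 1 a.e.} is geodesically convex in the Wasserstein space (𝒫(Ω), W₂): if μ₀, μ₁ ∈ K and μ_t is the W₂-geodesic joining them, then μ_t ∈ K for all t ∈ [0,1]. -/
noncomputable section
open MeasureTheory

/-- The squared quadratic Wasserstein distance, as an infimum over couplings. -/
def W2sq {E : Type*} [MeasurableSpace E] [PseudoMetricSpace E]
    (μ ν : Measure E) : ENNReal :=
  sInf { c | ∃ γ : Measure (E × E), γ.map Prod.fst = μ ∧ γ.map Prod.snd = ν ∧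
    c = ∫⁻ p, ENNReal.ofReal (dist p.1 p.2 ^ 2) ∂γ }

/-- Probability measures supported in `Ω` with density (w.r.t. Lebesgue) at most `1`. -/
def densK {d : ℕ} (Ω : Set (EuclideanSpace ℝ (Fin d))) :
    Set (Measure (EuclideanSpace ℝ (Fin d))) :=
  {μ | IsProbabilityMeasure μ ∧ μ ≤ volume ∧ μ Ωᶜ = 0}

open scoped ENNReal Topology NNReal

/-- cyclical monotonicity of the support of an optimal plan -/
theorem cyc_mon {E : Type*} [MeasurableSpace E] [PseudoMetricSpace E] [BorelSpace E]
    [SecondCountableTopology E]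
    (γ : Measure (E × E)) [IsProbabilityMeasure γ]
    (hfin : ∫⁻ p, ENNReal.ofReal (dist p.1 p.2 ^ 2) ∂γ ≠ ∞)
    (hopt : ∀ γ' : Measure (E × E), γ'.map Prod.fst = γ.map Prod.fst →
      γ'.map Prod.snd = γ.map Prod.snd →
      ∫⁻ p, ENNReal.ofReal (dist p.1 p.2 ^ 2) ∂γ ≤ ∫⁻ p, ENNReal.ofReal (dist p.1 p.2 ^ 2) ∂γ')
    {ι : Type*} [Fintype ι] (p : ι → E × E) (hp : ∀ i, p i ∈ γ.support) (σ : Equiv.Perm ι) :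
    ∑ i, dist (p i).1 (p i).2 ^ 2 ≤ ∑ i, dist (p i).1 (p (σ i)).2 ^ 2 := by
  classical
  rcases isEmpty_or_nonempty ι with hι | hι
  · simp
  by_contra! hlt
  set c : E × E → ℝ := fun q => dist q.1 q.2 ^ 2 with hc
  have hcont : Continuous c := by fun_prop
  set N : ℝ := (Fintype.card ι : ℝ) with hN
  have hNpos : 0 < N := by rw [hN]; exact_mod_cast Fintype.card_pos
  set Δ := ∑ i, dist (p i).1 (p i).2 ^ 2 - ∑ i, dist (p i).1 (p (σ i)).2 ^ 2 with hΔ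
  have hΔpos : 0 < Δ := by linarith
  set δ := Δ / (4 * N) with hδ
  have hδpos : 0 < δ := by positivity
  -- radius
  have key : ∀ z : E × E, ∀ᶠ r in 𝓝[>] (0:ℝ), ∀ q ∈ Metric.ball z r, |c q - c z| < δ := by
    intro z
    obtain ⟨r, hr, h⟩ := Metric.continuous_iff.1 hcont z δ hδpos
    have : Set.Iio r ∈ 𝓝[>] (0:ℝ) := mem_nhdsWithin_of_mem_nhds (Iio_mem_nhds hr)
    filter_upwards [this] with s hs q hq
    have := h q (lt_trans hq hs)
    rwa [Real.dist_eq] at this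
  obtain ⟨r, ⟨h1, h2⟩, hr⟩ :=
    (((Filter.eventually_all.2 fun i => key (p i)).and
      (Filter.eventually_all.2 fun i => key ((p i).1, (p (σ i)).2))).and
        self_mem_nhdsWithin).exists
  replace hr : 0 < r := hr
  set W : ι → Set (E × E) := fun i => Metric.ball (p i) r with hW
  have hWm : ∀ i, MeasurableSet (W i) := fun i => Metric.isOpen_ball.measurableSet
  have hWpos : ∀ i, γ (W i) ≠ 0 := fun i =>
    ((Measure.mem_support_iff_forall _).1 (hp i) _ (Metric.ball_mem_nhds _ hr)).ne'
  obtain ⟨i₀, hi₀⟩ := Finite.exists_min (fun i => γ (W i))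
  set ε : ℝ≥0∞ := γ (W i₀) / Fintype.card ι with hε
  have hcard0 : (Fintype.card ι : ℝ≥0∞) ≠ 0 := by
    exact_mod_cast Fintype.card_ne_zero
  have hε0 : ε ≠ 0 := ENNReal.div_ne_zero.2 ⟨hWpos _, ENNReal.natCast_ne_top _⟩
  have hεt : ε ≠ ∞ := ENNReal.div_ne_top (measure_ne_top _ _) hcard0
  set g : ι → Measure (E × E) := fun i => ProbabilityTheory.cond γ (W i) with hg
  have hgp : ∀ i, IsProbabilityMeasure (g i) := fun i =>
    ProbabilityTheory.cond_isProbabilityMeasure (hWpos i)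
  set ν : Measure (E × E) := ∑ i, ε • g i with hν
  have hνle : ν ≤ γ := by
    intro s
    rw [hν, Measure.finsetSum_apply]
    calc ∑ i, (ε • g i) s ≤ ∑ i : ι, γ s / Fintype.card ι := by
          refine Finset.sum_le_sum fun i _ => ?_
          simp only [Measure.smul_apply, smul_eq_mul, hg]
          rw [ProbabilityTheory.cond_apply (hWm i)]
          calc ε * ((γ (W i))⁻¹ * γ (W i ∩ s)) 
              ≤ (γ (W i) / Fintype.card ι) * ((γ (W i))⁻¹ * γ s) := by
                gcongr
                · exact ENNReal.div_le_div_right (hi₀ i) _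
                · exact Set.inter_subset_right
            _ = (γ (W i) * (γ (W i))⁻¹) * γ s / Fintype.card ι := by
                simp only [div_eq_mul_inv]; ring
            _ = γ s / Fintype.card ι := by
                rw [ENNReal.mul_inv_cancel (hWpos i) (measure_ne_top _ _), one_mul]
      _ = γ s := by
          rw [Finset.sum_const, Finset.card_univ, nsmul_eq_mul]
          exact ENNReal.mul_div_cancel hcard0 (ENNReal.natCast_ne_top _)
  have hνfin : IsFiniteMeasure ν := ⟨(hνle _).trans_lt (measure_lt_top _ _)⟩
  have hsub : γ - ν + ν = γ := Measure.sub_add_cancel_of_le hνle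
  have hpf : ∀ i, IsProbabilityMeasure ((g i).map Prod.fst) := fun i =>
    Measure.isProbabilityMeasure_map measurable_fst.aemeasurable
  have hps : ∀ i, IsProbabilityMeasure ((g i).map Prod.snd) := fun i =>
    Measure.isProbabilityMeasure_map measurable_snd.aemeasurable
  set ν' : Measure (E × E) :=
    ∑ i, ε • ((g i).map Prod.fst).prod ((g (σ i)).map Prod.snd) with hν'
  have m1 : ν'.map Prod.fst = ν.map Prod.fst := by
    rw [hν, hν', Measure.map_finset_sum (by fun_prop), Measure.map_finset_sum (by fun_prop)]
    refine Finset.sum_congr rfl fun i _ => ?_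
    rw [Measure.map_smul, Measure.map_smul, Measure.map_fst_prod, measure_univ, one_smul]
  have m2 : ν'.map Prod.snd = ν.map Prod.snd := by
    rw [hν, hν', Measure.map_finset_sum (by fun_prop), Measure.map_finset_sum (by fun_prop)]
    rw [← Equiv.sum_comp σ (fun i => Measure.map Prod.snd (ε • g i))]
    refine Finset.sum_congr rfl fun i _ => ?_
    rw [Measure.map_smul, Measure.map_smul, Measure.map_snd_prod, measure_univ, one_smul]
  have hle := hopt (γ - ν + ν')
    (by conv_rhs => rw [← hsub]
        rw [Measure.map_add _ _ measurable_fst, Measure.map_add _ _ measurable_fst, m1])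
    (by conv_rhs => rw [← hsub]
        rw [Measure.map_add _ _ measurable_snd, Measure.map_add _ _ measurable_snd, m2])
  rw [lintegral_add_measure] at hle
  conv_lhs at hle => rw [← hsub]
  rw [lintegral_add_measure] at hle
  have hfin2 : ∫⁻ p, ENNReal.ofReal (dist p.1 p.2 ^ 2) ∂(γ - ν) ≠ ∞ :=
    ne_top_of_le_ne_top hfin (lintegral_mono' Measure.sub_le le_rfl)
  have hle2 := (ENNReal.add_le_add_iff_left hfin2).1 hle
  rw [hν, hν', lintegral_finsetSum_measure, lintegral_finsetSum_measure] at hle2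
  simp only [lintegral_smul_measure, smul_eq_mul, ← Finset.mul_sum] at hle2
  rw [ENNReal.mul_le_mul_iff_right hε0 hεt] at hle2
  have low : ∀ i, ENNReal.ofReal (c (p i) - δ) ≤ ∫⁻ p, ENNReal.ofReal (dist p.1 p.2 ^ 2) ∂(g i) := by
    intro i
    calc ENNReal.ofReal (c (p i) - δ) = ∫⁻ _, ENNReal.ofReal (c (p i) - δ) ∂(g i) := by simp
      _ ≤ _ := by
        refine lintegral_mono_ae ?_
        filter_upwards [ProbabilityTheory.ae_cond_mem (μ := γ) (hWm i)] with q hq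
        apply ENNReal.ofReal_le_ofReal
        have := abs_lt.1 (h1 i q hq)
        simp only [hc] at this ⊢
        linarith
  have up : ∀ i, ∫⁻ p, ENNReal.ofReal (dist p.1 p.2 ^ 2)
      ∂(((g i).map Prod.fst).prod ((g (σ i)).map Prod.snd)) ≤
      ENNReal.ofReal (c ((p i).1, (p (σ i)).2) + δ) := by
    intro i
    have hae : ∀ᵐ q ∂(((g i).map Prod.fst).prod ((g (σ i)).map Prod.snd)),
        q ∈ Metric.ball ((p i).1, (p (σ i)).2) r := by
      rw [← ball_prod_same]
      have a1 : ∀ᵐ x ∂((g i).map Prod.fst), x ∈ Metric.ball (p i).1 r := by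
        refine (ae_map_iff measurable_fst.aemeasurable Metric.isOpen_ball.measurableSet).2 ?_
        filter_upwards [ProbabilityTheory.ae_cond_mem (μ := γ) (hWm i)] with q hq
        replace hq : _ ∈ Metric.ball (_, _) r := hq
        rw [← ball_prod_same] at hq
        exact hq.1
      have a2 : ∀ᵐ x ∂((g (σ i)).map Prod.snd), x ∈ Metric.ball (p (σ i)).2 r := by
        refine (ae_map_iff measurable_snd.aemeasurable Metric.isOpen_ball.measurableSet).2 ?_
        filter_upwards [ProbabilityTheory.ae_cond_mem (μ := γ) (hWm (σ i))] with q hq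
        replace hq : _ ∈ Metric.ball (_, _) r := hq
        rw [← ball_prod_same] at hq
        exact hq.2
      filter_upwards [Measure.quasiMeasurePreserving_fst.ae a1,
        Measure.quasiMeasurePreserving_snd.ae a2] with q u v
      exact ⟨u, v⟩
    calc _ ≤ ∫⁻ _, ENNReal.ofReal (c ((p i).1, (p (σ i)).2) + δ)
          ∂(((g i).map Prod.fst).prod ((g (σ i)).map Prod.snd)) := by
          refine lintegral_mono_ae ?_
          filter_upwards [hae] with q hq
          apply ENNReal.ofReal_le_ofReal
          have := abs_lt.1 (h2 i q hq)
          simp only [hc] at this ⊢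
          linarith
      _ = _ := by simp
  have h3 := ((Finset.sum_le_sum fun i _ => low i).trans hle2).trans
    (Finset.sum_le_sum fun i _ => up i)
  have hnn : ∀ i, 0 ≤ c ((p i).1, (p (σ i)).2) + δ := fun i => by
    simp only [hc]; positivity
  rw [← ENNReal.ofReal_sum_of_nonneg (fun i _ => hnn i)] at h3
  have h4 : ENNReal.ofReal (∑ i, (c (p i) - δ)) ≤ ∑ i, ENNReal.ofReal (c (p i) - δ) := by
    calc ENNReal.ofReal (∑ i, (c (p i) - δ)) ≤ ENNReal.ofReal (∑ i, max (c (p i) - δ) 0) :=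
          ENNReal.ofReal_le_ofReal (Finset.sum_le_sum fun i _ => le_max_left _ _)
      _ = _ := by
          rw [ENNReal.ofReal_sum_of_nonneg (fun i _ => le_max_right _ _)]
          refine Finset.sum_congr rfl fun i _ => ?_
          rw [ENNReal.ofReal_max]; simp
  have h5 := (ENNReal.ofReal_le_ofReal_iff (Finset.sum_nonneg fun i _ => hnn i)).1 (h4.trans h3)
  rw [Finset.sum_sub_distrib, Finset.sum_add_distrib, Finset.sum_const, Finset.card_univ,
    nsmul_eq_mul, ← hN] at h5
  have h6 : N * δ = Δ / 4 := by rw [hδ]; field_simp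
  simp only [hc] at h5
  linarith

inductive RChain {E : Type*} [NormedAddCommGroup E] [InnerProductSpace ℝ E]
    (Γ : Set (E × E)) (p₀ : E × E) : E × E → ℝ → Prop
  | base : RChain Γ p₀ p₀ 0
  | step (p q : E × E) (v : ℝ) : RChain Γ p₀ p v → q ∈ Γ →
      RChain Γ p₀ q (v + inner ℝ p.2 (q.1 - p.1))

theorem RChain.exists_seq {E : Type*} [NormedAddCommGroup E] [InnerProductSpace ℝ E]
    {Γ : Set (E × E)} {p₀ : E × E} (h₀ : p₀ ∈ Γ) {p : E × E} {v : ℝ} (h : RChain Γ p₀ p v) :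
    ∃ (n : ℕ) (s : ℕ → E × E), (∀ i, s i ∈ Γ) ∧ s 0 = p₀ ∧ s n = p ∧
      v = ∑ i ∈ Finset.range n, inner ℝ (s i).2 ((s (i+1)).1 - (s i).1) := by
  induction h with
  | base => exact ⟨0, fun _ => p₀, fun _ => h₀, rfl, rfl, by simp⟩
  | step p q v _ hq ih =>
    obtain ⟨n, s, h1, h2, h3, h4⟩ := ih
    refine ⟨n + 1, fun i => if i ≤ n then s i else q, ?_, by simp [h2], by simp, ?_⟩
    · intro i
      dsimp only
      split_ifs
      · exact h1 i
      · exact hq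
    · rw [Finset.sum_range_succ, h4]
      congr 1
      · refine Finset.sum_congr rfl fun i hi => ?_
        have := Finset.mem_range.1 hi
        dsimp only
        rw [if_pos (by omega), if_pos (by omega)]
      · simp [h3]

theorem rockafellar {E : Type*} [NormedAddCommGroup E] [InnerProductSpace ℝ E]
    (Γ : Set (E × E)) (hne : Γ.Nonempty) (M : ℝ) (hM : ∀ p ∈ Γ, ‖p.2‖ ≤ M)
    (hcyc : ∀ (n : ℕ) (p : Fin n → E × E), (∀ i, p i ∈ Γ) → ∀ σ : Equiv.Perm (Fin n),
      ∑ i, dist (p i).1 (p i).2 ^ 2 ≤ ∑ i, dist (p i).1 (p (σ i)).2 ^ 2) :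
    ∃ φ : E → ℝ, (∀ x y, φ x - φ y ≤ M * ‖x - y‖) ∧
      (∀ x y s, 0 ≤ s → s ≤ 1 → φ ((1 - s) • x + s • y) ≤ (1 - s) * φ x + s * φ y) ∧
      ∀ p ∈ Γ, ∀ z, φ p.1 + inner ℝ p.2 (z - p.1) ≤ φ z := by
  obtain ⟨p₀, h₀⟩ := hne
  have hmem : ∀ p v, RChain Γ p₀ p v → p ∈ Γ := by
    intro p v h
    cases h with
    | base => exact h₀
    | step _ _ _ _ hq => exact hq
  have hneg : ∀ p v, RChain Γ p₀ p v → v + inner ℝ p.2 (p₀.1 - p.1) ≤ 0 := by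
    intro p v h
    obtain ⟨n, s, h1, h2, h3, h4⟩ := h.exists_seq h₀
    have := hcyc (n + 1) (fun i => s i) (fun i => h1 _) (Equiv.addRight 1).symm
    rw [← Equiv.sum_comp (Equiv.addRight (1 : Fin (n+1)))
      (fun i => dist (s i).1 (s ((Equiv.addRight (1 : Fin (n+1))).symm i : Fin (n+1))).2 ^ 2)] at this
    simp only [Equiv.symm_apply_apply] at this
    have e1 : ∑ i : Fin (n+1), ‖(s ((Equiv.addRight (1 : Fin (n+1)) i : Fin (n+1)) : ℕ)).1‖ ^ 2
        = ∑ i : Fin (n+1), ‖(s (i : ℕ)).1‖ ^ 2 :=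
      Equiv.sum_comp (Equiv.addRight (1 : Fin (n+1))) (fun i => ‖(s (i : ℕ)).1‖ ^ 2)
    have e2 : ∑ i : Fin (n+1), (inner ℝ (s i).2
        ((s ((Equiv.addRight (1 : Fin (n+1)) i : Fin (n+1)) : ℕ)).1 - (s i).1) : ℝ) ≤ 0 := by
      simp only [dist_eq_norm, @norm_sub_sq_real E] at this
      simp only [Finset.sum_add_distrib, Finset.sum_sub_distrib, ← Finset.mul_sum] at this
      simp only [inner_sub_right, Finset.sum_sub_distrib]
      simp only [real_inner_comm (s _).2] at *
      simp only [real_inner_comm _ (s _).2] at *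
      linarith
    rw [Fin.sum_univ_castSucc] at e2
    simp only [Equiv.coe_addRight, Fin.coeSucc_eq_succ, Fin.val_succ, Fin.val_castSucc,
      Fin.last_add_one, Fin.val_last, Fin.val_zero] at e2
    rw [Fin.sum_univ_eq_sum_range (fun i => (inner ℝ (s i).2 ((s (i+1)).1 - (s i).1) : ℝ)),
      ← h4, h2, h3] at e2
    exact e2
  let I := {q : (E × E) × ℝ // RChain Γ p₀ q.1 q.2}
  have : Nonempty I := ⟨⟨(p₀, 0), RChain.base⟩⟩
  let F : I → E → ℝ := fun i z => i.1.2 + inner ℝ i.1.1.2 (z - i.1.1.1)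
  have hFl : ∀ i x y, F i x ≤ F i y + M * ‖x - y‖ := by
    intro i x y
    have h1 : F i x = F i y + inner ℝ i.1.1.2 (x - y) := by
      simp only [F, inner_sub_right]; ring
    have h2 : (inner ℝ i.1.1.2 (x - y) : ℝ) ≤ M * ‖x - y‖ :=
      (real_inner_le_norm _ _).trans
        (mul_le_mul_of_nonneg_right (hM _ (hmem _ _ i.2)) (norm_nonneg _))
    linarith
  have hbdd : ∀ z, BddAbove (Set.range fun i => F i z) := by
    intro z
    refine ⟨M * ‖z - p₀.1‖, ?_⟩
    rintro _ ⟨i, rfl⟩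
    have h1 := hFl i z p₀.1
    have h2 : F i p₀.1 ≤ 0 := hneg _ _ i.2
    dsimp only
    linarith
  refine ⟨fun z => ⨆ i, F i z, ?_, ?_, ?_⟩
  · intro x y
    have : (⨆ i, F i x) ≤ (⨆ i, F i y) + M * ‖x - y‖ :=
      ciSup_le fun i => (hFl i x y).trans (by gcongr; exact le_ciSup (hbdd y) i)
    linarith
  · intro x y s hs0 hs1
    refine ciSup_le fun i => ?_
    have h1 : F i ((1 - s) • x + s • y) = (1 - s) * F i x + s * F i y := by
      simp only [F, inner_sub_right, inner_add_right, inner_smul_right]; ring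
    rw [h1]
    have := le_ciSup (hbdd x) i
    have := le_ciSup (hbdd y) i
    have : 0 ≤ 1 - s := by linarith
    gcongr
  · intro p hp z
    have : (⨆ i, F i p.1) ≤ (⨆ i, F i z) - inner ℝ p.2 (z - p.1) := by
      refine ciSup_le fun i => ?_
      have := le_ciSup (hbdd z) ⟨(p, _), RChain.step i.1.1 p i.1.2 i.2 hp⟩
      have h2 : F ⟨(p, _), RChain.step i.1.1 p i.1.2 i.2 hp⟩ z
        = F i p.1 + inner ℝ p.2 (z - p.1) := rfl
      linarith
    dsimp only
    linarith

theorem prox_exists {E : Type*} [NormedAddCommGroup E] [InnerProductSpace ℝ E]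
    [FiniteDimensional ℝ E] (φ : E → ℝ) (M : ℝ) (hL : ∀ x y, φ x - φ y ≤ M * ‖x - y‖)
    (hC : ∀ x y s, 0 ≤ s → s ≤ 1 → φ ((1 - s) • x + s • y) ≤ (1 - s) * φ x + s * φ y)
    (t : ℝ) (h0 : 0 < t) (h1 : t < 1) (y : E) :
    ∃ x : E, (∀ z, (1 - t) / 2 * ‖x‖ ^ 2 + t * φ x - inner ℝ x y ≤
        (1 - t) / 2 * ‖z‖ ^ 2 + t * φ z - inner ℝ z y) ∧
      ∀ z, t * φ x + inner ℝ (y - (1 - t) • x) (z - x) ≤ t * φ z := by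
  have hcont : Continuous φ := by
    refine (LipschitzWith.of_dist_le_mul (K := Real.toNNReal M) fun x y => ?_).continuous
    rw [Real.dist_eq, dist_eq_norm]
    have hm : M * ‖x - y‖ ≤ (Real.toNNReal M : ℝ) * ‖x - y‖ :=
      mul_le_mul_of_nonneg_right (Real.le_coe_toNNReal M) (norm_nonneg _)
    have a := hL x y
    have b := hL y x
    rw [norm_sub_rev y x] at b
    exact abs_le.2 ⟨by linarith, by linarith⟩
  have hco : Filter.Tendsto (fun z : E => (1 - t) / 2 * ‖z‖ ^ 2 + t * φ z - inner ℝ z y)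
      (Filter.cocompact E) Filter.atTop := by
    have hn := tendsto_norm_cocompact_atTop (E := E)
    have h2 : Filter.Tendsto (fun z : E =>
        ‖z‖ * ((1 - t) / 2 * ‖z‖ + (- (t * M) - ‖y‖)) + t * φ 0)
        (Filter.cocompact E) Filter.atTop := by
      apply Filter.tendsto_atTop_add_const_right
      apply hn.atTop_mul_atTop₀
      apply Filter.tendsto_atTop_add_const_right
      exact hn.const_mul_atTop (by linarith)
    refine Filter.tendsto_atTop_mono (fun z => ?_) h2
    have a := hL 0 z
    rw [zero_sub, norm_neg] at a
    have b := real_inner_le_norm z y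
    nlinarith [mul_le_mul_of_nonneg_left a h0.le]
  obtain ⟨x, hx⟩ := Continuous.exists_forall_le (by fun_prop) hco
  refine ⟨x, hx, fun z => ?_⟩
  have hs : ∀ s ∈ Set.Ioc (0:ℝ) 1, 0 ≤ ((1 - t) * inner ℝ x (z - x) + t * (φ z - φ x)
      - inner ℝ (z - x) y) + s * ((1 - t) / 2 * ‖z - x‖ ^ 2) := by
    intro s hs
    have a := hx ((1 - s) • x + s • z)
    have b := hC x z s hs.1.le hs.2
    have e : (1 - s) • x + s • z = x + s • (z - x) := by module
    rw [e] at a b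
    rw [norm_add_sq_real, inner_add_left, inner_smul_right, inner_smul_left, norm_smul,
      mul_pow, Real.norm_eq_abs, sq_abs] at a
    simp only [conj_trivial] at a
    have b' := mul_le_mul_of_nonneg_left b h0.le
    by_contra! hneg
    have := mul_neg_of_pos_of_neg hs.1 hneg
    nlinarith
  have hlim : 0 ≤ (1 - t) * inner ℝ x (z - x) + t * (φ z - φ x) - inner ℝ (z - x) y := by
    have ht : Filter.Tendsto (fun s : ℝ => ((1 - t) * inner ℝ x (z - x) + t * (φ z - φ x)
      - inner ℝ (z - x) y) + s * ((1 - t) / 2 * ‖z - x‖ ^ 2)) (𝓝[>] 0)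
      (𝓝 (((1 - t) * inner ℝ x (z - x) + t * (φ z - φ x)
      - inner ℝ (z - x) y) + 0 * ((1 - t) / 2 * ‖z - x‖ ^ 2))) := by
      apply Filter.Tendsto.mono_left _ nhdsWithin_le_nhds
      apply Continuous.tendsto
      fun_prop
    rw [zero_mul, add_zero] at ht
    refine ge_of_tendsto ht ?_
    filter_upwards [Ioc_mem_nhdsGT (zero_lt_one' ℝ)] with s h using hs s h
  rw [inner_sub_left, inner_smul_left, real_inner_comm]
  simp only [conj_trivial]
  linarith

theorem det_of_eigenbasis {E ι : Type*} [AddCommGroup E] [Module ℝ E] [Fintype ι] [DecidableEq ι]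
    (b : Module.Basis ι ℝ E) (f : E →ₗ[ℝ] E) (c : ι → ℝ) (h : ∀ i, f (b i) = c i • b i) :
    LinearMap.det f = ∏ i, c i := by
  rw [← LinearMap.det_toMatrix b, ← Matrix.det_diagonal]
  congr 1
  ext i j
  rw [LinearMap.toMatrix_apply, h, Matrix.diagonal_apply]
  simp only [map_smul, Module.Basis.repr_self, Finsupp.smul_apply, Finsupp.single_apply, smul_eq_mul]
  by_cases hij : i = j
  · simp [hij]
  · simp [hij, Ne.symm hij]

theorem det_min_le {E : Type*} [NormedAddCommGroup E] [InnerProductSpace ℝ E]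
    [FiniteDimensional ℝ E] (P Q : E →ₗ[ℝ] E) (hs : P.IsSymmetric)
    (hP : ∀ v, 0 ≤ inner ℝ (P v) v) (hQ : ∀ v, 0 ≤ inner ℝ (Q v) v)
    (t : ℝ) (h0 : 0 < t) (h1 : t < 1) (hPQ : ∀ v, (1 - t) • P v + t • Q v = v) :
    |LinearMap.det P| ≤ 1 ∨ |LinearMap.det Q| ≤ 1 := by
  classical
  let b := hs.eigenvectorBasis rfl
  let p : Fin (Module.finrank ℝ E) → ℝ := hs.eigenvalues rfl
  have hb : ∀ i, P (b i) = p i • b i := fun i => hs.apply_eigenvectorBasis rfl i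
  let q : Fin (Module.finrank ℝ E) → ℝ := fun i => t⁻¹ * (1 - (1 - t) * p i)
  have hq : ∀ i, Q (b i) = q i • b i := by
    intro i
    have h := hPQ (b i)
    rw [hb] at h
    have h2 : t • Q (b i) = (1 - (1 - t) * p i) • b i := by
      rw [← eq_sub_iff_add_eq'] at h
      rw [h]; module
    calc Q (b i) = t⁻¹ • (t • Q (b i)) := by rw [smul_smul, inv_mul_cancel₀ h0.ne', one_smul]
      _ = _ := by rw [h2, smul_smul]
  have hp0 : ∀ i, 0 ≤ p i := by
    intro i
    have := hP (b i)
    rw [hb, inner_smul_left, real_inner_self_eq_norm_sq, b.orthonormal.1 i] at this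
    simpa using this
  have hq0 : ∀ i, 0 ≤ q i := by
    intro i
    have := hQ (b i)
    rw [hq, inner_smul_left, real_inner_self_eq_norm_sq, b.orthonormal.1 i] at this
    simpa using this
  have d1 : LinearMap.det P = ∏ i, p i :=
    det_of_eigenbasis b.toBasis P p (by simpa using hb)
  have d2 : LinearMap.det Q = ∏ i, q i :=
    det_of_eigenbasis b.toBasis Q q (by simpa using hq)
  have n1 : 0 ≤ ∏ i, p i := Finset.prod_nonneg fun i _ => hp0 i
  have n2 : 0 ≤ ∏ i, q i := Finset.prod_nonneg fun i _ => hq0 i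
  rw [d1, d2, abs_of_nonneg n1, abs_of_nonneg n2]
  by_contra! hcon
  have h3 : (∏ i, p i) ^ (1 - t) * (∏ i, q i) ^ t ≤ 1 := by
    rw [← Real.finsetProd_rpow _ _ (fun i _ => hp0 i), ← Real.finsetProd_rpow _ _ (fun i _ => hq0 i),
      ← Finset.prod_mul_distrib]
    refine Finset.prod_le_one (fun i _ => by
      have := hp0 i; have := hq0 i; positivity) fun i _ => ?_
    have := Real.geom_mean_le_arith_mean2_weighted (by linarith : 0 ≤ 1 - t) h0.le (hp0 i) (hq0 i)
      (by ring)
    refine this.trans (le_of_eq ?_)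
    simp only [q]; field_simp; ring
  have h4 := Real.one_lt_rpow hcon.1 (by linarith : 0 < 1 - t)
  have h5 := Real.one_lt_rpow hcon.2 h0
  nlinarith

theorem fderiv_nonneg_of_monotone {E : Type*} [NormedAddCommGroup E] [InnerProductSpace ℝ E]
    (S : E → E) (hS : ∀ y y', 0 ≤ inner ℝ (S y - S y') (y - y')) (P : E →L[ℝ] E) (y : E)
    (hP : HasFDerivAt S P y) (v : E) : 0 ≤ inner ℝ (P v) v := by
  have h := (hP.hasLineDerivAt v).tendsto_slope_zero_right
  have h2 := h.inner (tendsto_const_nhds (x := v)) (𝕜 := ℝ)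
  refine ge_of_tendsto h2 ?_
  filter_upwards [self_mem_nhdsWithin] with s hs
  replace hs : 0 < s := hs
  have h3 := hS (y + s • v) y
  rw [add_sub_cancel_left, inner_smul_right] at h3
  rw [inner_smul_left]
  have := nonneg_of_mul_nonneg_right h3 hs
  simp only [conj_trivial]
  positivity

theorem symm_of_gradient {E : Type*} [NormedAddCommGroup E] [InnerProductSpace ℝ E]
    (S : E → E) (ψ : E → ℝ) (hψ : ∀ y, HasFDerivAt ψ (innerSL ℝ (S y)) y) (P : E →L[ℝ] E) (y : E)
    (hP : HasFDerivAt S P y) : (P : E →ₗ[ℝ] E).IsSymmetric := by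
  let B : E →L[ℝ] E →L[ℝ] ℝ := isBoundedBilinearMap_inner (𝕜 := ℝ) (E := E) |>.toContinuousLinearMap
  have h1 : ∀ y, HasFDerivAt ψ (B (S y)) y := fun y => hψ y
  have h2 : HasFDerivAt (fun y => B (S y)) (B.comp P) y := B.hasFDerivAt.comp y hP
  intro v w
  have := second_derivative_symmetric h1 h2 v w
  change inner ℝ (P v) w = inner ℝ (P w) v at this
  change inner ℝ (P v) w = inner ℝ v (P w)
  rw [this, real_inner_comm]

theorem null_image {E : Type*} [NormedAddCommGroup E] [NormedSpace ℝ E]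
    [FiniteDimensional ℝ E] [MeasurableSpace E] [BorelSpace E] (μ : Measure E)
    [μ.IsAddHaarMeasure] (S : E → E) (K : ℝ≥0) (hS : LipschitzWith K S) (s : Set E)
    (hs : μ s = 0) : μ (S '' s) = 0 := by
  have a := Measure.absolutelyContinuous_isAddHaarMeasure
    μ (Measure.hausdorffMeasure (X := E) (Module.finrank ℝ E))
  have b := Measure.absolutelyContinuous_isAddHaarMeasure
    (Measure.hausdorffMeasure (X := E) (Module.finrank ℝ E)) μ
  apply a
  have := hS.hausdorffMeasure_image_le (d := Module.finrank ℝ E) (by positivity) s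
  rw [b hs, mul_zero] at this
  exact le_antisymm this zero_le

theorem prox_full {E : Type*} [NormedAddCommGroup E] [InnerProductSpace ℝ E]
    [FiniteDimensional ℝ E] (φ : E → ℝ) (M : ℝ) (hL : ∀ x y, φ x - φ y ≤ M * ‖x - y‖)
    (hC : ∀ x y s, 0 ≤ s → s ≤ 1 → φ ((1 - s) • x + s • y) ≤ (1 - s) * φ x + s * φ y)
    (t : ℝ) (h0 : 0 < t) (h1 : t < 1) :
    ∃ (S : E → E) (K : ℝ≥0) (ψ : E → ℝ), LipschitzWith K S ∧
      (∀ y, HasFDerivAt ψ (innerSL ℝ (S y)) y) ∧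
      (∀ y y', 0 ≤ inner ℝ (S y - S y') (y - y')) ∧
      (∀ y y', 0 ≤ inner ℝ (t⁻¹ • (y - (1 - t) • S y) - t⁻¹ • (y' - (1 - t) • S y')) (y - y')) ∧
      ∀ x p, (∀ z, φ x + inner ℝ p (z - x) ≤ φ z) → S ((1 - t) • x + t • p) = x := by
  choose S hmin hsub using prox_exists φ M hL hC t h0 h1
  have ht : 0 < 1 - t := by linarith
  -- basic monotonicity inequality
  have mono : ∀ y y', (1 - t) * ‖S y - S y'‖ ^ 2 ≤ inner ℝ (S y - S y') (y - y') := by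
    intro y y'
    have a := hsub y (S y')
    have b := hsub y' (S y)
    rw [← real_inner_self_eq_norm_sq]
    simp only [inner_sub_left, inner_sub_right, inner_smul_left, conj_trivial] at a b ⊢
    simp only [real_inner_comm y, real_inner_comm y', real_inner_comm (S y') (S y)] at a b ⊢
    linarith
  have lip : ∀ y y', ‖S y - S y'‖ ≤ (1 - t)⁻¹ * ‖y - y'‖ := by
    intro y y'
    have a := (mono y y').trans (real_inner_le_norm _ _)
    rcases (norm_nonneg (S y - S y')).eq_or_lt with h | h
    · rw [← h]; positivity
    · rw [inv_mul_eq_div, le_div_iff₀ ht]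
      nlinarith
  refine ⟨S, ⟨(1 - t)⁻¹, by positivity⟩,
    fun y => inner ℝ (S y) y - ((1 - t) / 2 * ‖S y‖ ^ 2 + t * φ (S y)), ?_, ?_, ?_, ?_, ?_⟩
  · refine LipschitzWith.of_dist_le_mul fun y y' => ?_
    rw [dist_eq_norm, dist_eq_norm]
    exact lip y y'
  · intro y
    rw [hasFDerivAt_iff_isLittleO_nhds_zero]
    refine Asymptotics.IsBigO.trans_isLittleO (g := fun h : E => ‖h‖ ^ 2) ?_ ?_
    · refine Asymptotics.IsBigO.of_bound (1 - t)⁻¹ (Filter.Eventually.of_forall fun h => ?_)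
      have a := hmin y (S (y + h))
      have b := hmin (y + h) (S y)
      have c : (inner ℝ (S (y + h) - S y) h : ℝ) ≤ (1 - t)⁻¹ * ‖h‖ ^ 2 := by
        refine (real_inner_le_norm _ _).trans ?_
        have := lip (y + h) y
        rw [add_sub_cancel_left] at this
        rw [sq, ← mul_assoc]
        gcongr
      rw [Real.norm_eq_abs, Real.norm_eq_abs, abs_of_nonneg (sq_nonneg ‖h‖)]
      simp only [innerSL_apply_apply, inner_add_right, inner_sub_left] at a b c ⊢
      refine abs_le.2 ⟨?_, ?_⟩
      · have : 0 ≤ (1 - t)⁻¹ * ‖h‖ ^ 2 := by positivity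
        linarith
      · linarith
    · have := (Asymptotics.isLittleO_pow_id (𝕜 := ℝ) one_lt_two).comp_tendsto
        (tendsto_norm_zero (E := E))
      exact this.of_norm_right
  · intro y y'
    exact le_trans (by positivity) (mono y y')
  · intro y y'
    have a := mono y y'
    have l : (inner ℝ (S y - S y') (y - y') : ℝ) * (1 - t) ≤ ‖y - y'‖ ^ 2 := by
      have h2 := mul_le_mul_of_nonneg_right
        ((real_inner_le_norm (S y - S y') (y - y')).trans
          (mul_le_mul_of_nonneg_right (lip y y') (norm_nonneg _))) ht.le
      refine h2.trans (le_of_eq ?_)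
      field_simp
    have e : t⁻¹ • (y - (1 - t) • S y) - t⁻¹ • (y' - (1 - t) • S y')
        = t⁻¹ • ((y - y') - (1 - t) • (S y - S y')) := by module
    rw [e, inner_smul_left, inner_sub_left, inner_smul_left, real_inner_self_eq_norm_sq]
    simp only [conj_trivial]
    have : 0 < t⁻¹ := by positivity
    apply mul_nonneg this.le
    linarith
  · intro x p hp
    set y := (1 - t) • x + t • p with hy
    have a := hsub y x
    have b := mul_le_mul_of_nonneg_left (hp (S y)) h0.le
    have e : y - (1 - t) • S y = (1 - t) • (x - S y) + t • p := by rw [hy]; module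
    rw [e, inner_add_left, inner_smul_left, inner_smul_left, real_inner_self_eq_norm_sq] at a
    simp only [conj_trivial] at a
    have c : (inner ℝ p (S y - x) : ℝ) = - inner ℝ p (x - S y) := by
      rw [← inner_neg_right, neg_sub]
    rw [c] at b
    have : ‖x - S y‖ ^ 2 ≤ 0 := by nlinarith
    have : ‖x - S y‖ = 0 := by nlinarith [norm_nonneg (x - S y)]
    rw [norm_eq_zero, sub_eq_zero] at this
    exact this.symm

theorem image_le_of_det {E : Type*} [NormedAddCommGroup E] [NormedSpace ℝ E]
    [FiniteDimensional ℝ E] [MeasurableSpace E] [BorelSpace E] (μ : Measure E)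
    [μ.IsAddHaarMeasure] (S : E → E) (s : Set E) (hs : MeasurableSet s)
    (hd : ∀ y ∈ s, DifferentiableAt ℝ S y) (hdet : ∀ y ∈ s, |(fderiv ℝ S y).det| ≤ 1) :
    μ (S '' s) ≤ μ s := by
  refine (addHaar_image_le_lintegral_abs_det_fderiv μ hs
    (fun y hy => (hd y hy).hasFDerivAt.hasFDerivWithinAt)).trans ?_
  calc _ ≤ ∫⁻ _ in s, 1 ∂μ := by
        refine setLIntegral_mono measurable_const fun y hy => ?_
        exact ENNReal.ofReal_le_one.2 (hdet y hy)
    _ = μ s := by simp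

/-- Core estimate: the interpolated measure is at most Lebesgue. -/
theorem core_le {d : ℕ} (μ₀ μ₁ : Measure (EuclideanSpace ℝ (Fin d)))
    (h₀ : μ₀ ≤ volume) (h₁ : μ₁ ≤ volume)
    (T : EuclideanSpace ℝ (Fin d) → EuclideanSpace ℝ (Fin d))
    (hTm : Measurable T) (hpush : μ₀.map T = μ₁)
    (φ : EuclideanSpace ℝ (Fin d) → ℝ) (M : ℝ) (hL : ∀ x y, φ x - φ y ≤ M * ‖x - y‖)
    (hC : ∀ x y s, 0 ≤ s → s ≤ 1 → φ ((1 - s) • x + s • y) ≤ (1 - s) * φ x + s * φ y)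
    (hφ : ∀ᵐ x ∂μ₀, ∀ z, φ x + inner ℝ (T x) (z - x) ≤ φ z)
    (t : ℝ) (h0 : 0 < t) (h1 : t < 1) :
    μ₀.map (fun x => (1 - t) • x + t • T x) ≤ volume := by
  obtain ⟨S, K, ψ, hS, hψ, hSm, hRm, hinv⟩ := prox_full φ M hL hC t h0 h1
  set R : EuclideanSpace ℝ (Fin d) → EuclideanSpace ℝ (Fin d) :=
    fun y => t⁻¹ • (y - (1 - t) • S y) with hR
  set G : EuclideanSpace ℝ (Fin d) → EuclideanSpace ℝ (Fin d) :=
    fun x => (1 - t) • x + t • T x with hG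
  have hGm : Measurable G := by fun_prop
  have hSG : ∀ᵐ x ∂μ₀, S (G x) = x := by
    filter_upwards [hφ] with x hx using hinv x (T x) hx
  have b1 : ∀ B : Set (EuclideanSpace ℝ (Fin d)), μ₀ (G ⁻¹' B) ≤ volume (S '' B) := by
    intro B
    refine le_trans (measure_mono_ae ?_) (h₀ _)
    filter_upwards [hSG] with x hx hB
    exact ⟨G x, hB, hx⟩
  have b2 : ∀ B : Set (EuclideanSpace ℝ (Fin d)), μ₀ (G ⁻¹' B) ≤ volume (R '' B) := by
    intro B
    refine le_trans ?_ (h₁ _)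
    rw [← hpush]
    refine le_trans (measure_mono_ae ?_) (Measure.le_map_apply hTm.aemeasurable _)
    filter_upwards [hSG] with x hx hB
    refine ⟨G x, hB, ?_⟩
    simp only [hR, hx]
    simp only [hG, add_sub_cancel_left]
    rw [smul_smul, inv_mul_cancel₀ h0.ne', one_smul]
  set D := {y | DifferentiableAt ℝ S y} with hD
  have hDm : MeasurableSet D := measurableSet_of_differentiableAt ℝ S
  have hD0 : volume Dᶜ = 0 := hS.ae_differentiableAt
  set C := {y | |(fderiv ℝ S y).det| ≤ 1} with hCC
  have hCm : MeasurableSet C := by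
    have : Measurable fun y => |(fderiv ℝ S y).det| :=
      (ContinuousLinearMap.continuous_det.measurable.comp (measurable_fderiv ℝ S)).abs
    exact this measurableSet_Iic
  have hRd : ∀ y ∈ D, HasFDerivAt R (t⁻¹ • (ContinuousLinearMap.id ℝ _ - (1 - t) • fderiv ℝ S y)) y := by
    intro y hy
    have h : HasFDerivAt S (fderiv ℝ S y) y := DifferentiableAt.hasFDerivAt hy
    exact ((hasFDerivAt_id y).sub (h.const_smul (1 - t))).const_smul t⁻¹
  have hdetR : ∀ y ∈ D, y ∉ C → |(fderiv ℝ R y).det| ≤ 1 := by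
    intro y hy hyC
    have hSd : HasFDerivAt S (fderiv ℝ S y) y := DifferentiableAt.hasFDerivAt hy
    have hRd' := hRd y hy
    rw [hRd'.fderiv]
    have := det_min_le (fderiv ℝ S y).toLinearMap
      (t⁻¹ • (ContinuousLinearMap.id ℝ (EuclideanSpace ℝ (Fin d)) -
        (1 - t) • fderiv ℝ S y)).toLinearMap
      (symm_of_gradient S ψ hψ _ y hSd)
      (fderiv_nonneg_of_monotone S hSm _ y hSd)
      (fderiv_nonneg_of_monotone R hRm _ y hRd') t h0 h1 (by
        intro v
        change (1 - t) • (fderiv ℝ S y) v + t • (t⁻¹ • (v - (1 - t) • (fderiv ℝ S y) v)) = v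
        rw [smul_smul, mul_inv_cancel₀ h0.ne', one_smul]
        abel)
    exact this.resolve_left hyC
  refine Measure.le_iff.2 fun B hB => ?_
  rw [Measure.map_apply hGm hB]
  have hnull : μ₀ (G ⁻¹' (B \ D)) = 0 := by
    refine le_antisymm ((b1 _).trans (le_of_eq ?_)) zero_le
    exact null_image volume S K hS _ (measure_mono_null (fun y hy => hy.2) hD0)
  have p1 : μ₀ (G ⁻¹' (B ∩ D ∩ C)) ≤ volume (B ∩ D ∩ C) :=
    (b1 _).trans (image_le_of_det volume S _ ((hB.inter hDm).inter hCm)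
      (fun y hy => hy.1.2) (fun y hy => hy.2))
  have p2 : μ₀ (G ⁻¹' ((B ∩ D) \ C)) ≤ volume ((B ∩ D) \ C) :=
    (b2 _).trans (image_le_of_det volume R _ ((hB.inter hDm).diff hCm)
      (fun y hy => (hRd y hy.1.2).differentiableAt) (fun y hy => hdetR y hy.1.2 hy.2))
  have hcover : G ⁻¹' B ⊆ G ⁻¹' (B \ D) ∪ (G ⁻¹' (B ∩ D ∩ C) ∪ G ⁻¹' ((B ∩ D) \ C)) := by
    intro x hx
    by_cases hxD : G x ∈ D
    · by_cases hxC : G x ∈ C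
      · exact Or.inr (Or.inl ⟨⟨hx, hxD⟩, hxC⟩)
      · exact Or.inr (Or.inr ⟨⟨hx, hxD⟩, hxC⟩)
    · exact Or.inl ⟨hx, hxD⟩
  calc μ₀ (G ⁻¹' B) ≤ μ₀ (G ⁻¹' (B \ D)) + (μ₀ (G ⁻¹' (B ∩ D ∩ C)) + μ₀ (G ⁻¹' ((B ∩ D) \ C))) :=
        (measure_mono hcover).trans ((measure_union_le _ _).trans (by
          gcongr; exact measure_union_le _ _))
    _ ≤ 0 + (volume (B ∩ D ∩ C) + volume ((B ∩ D) \ C)) := by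
        rw [hnull]; gcongr
    _ = volume (B ∩ D) := by rw [zero_add, measure_inter_add_sdiff _ hCm]
    _ ≤ volume B := measure_mono Set.inter_subset_left

/-- The set `K = {ρ ∈ 𝒫(Ω) : ρ ≤ Leb}` is geodesically convex in `(𝒫(Ω), W₂)`:
along the geodesic `μ_t = ((1-t)id + tT)_# μ₀`, where `T` is the optimal transport
map from `μ₀` to `μ₁`, the constraint is preserved. -/
theorem densK_geodesically_convex {d : ℕ} (Ω : Set (EuclideanSpace ℝ (Fin d)))
    (hconv : Convex ℝ Ω) (hcomp : IsCompact Ω)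
    (μ₀ μ₁ : Measure (EuclideanSpace ℝ (Fin d)))
    (h₀ : μ₀ ∈ densK Ω) (h₁ : μ₁ ∈ densK Ω)
    (T : EuclideanSpace ℝ (Fin d) → EuclideanSpace ℝ (Fin d))
    (hTm : Measurable T) (hpush : μ₀.map T = μ₁)
    (hopt : ∫⁻ x, ENNReal.ofReal (dist x (T x) ^ 2) ∂μ₀ = W2sq μ₀ μ₁) :
    ∀ t ∈ Set.Icc (0 : ℝ) 1,
      μ₀.map (fun x => (1 - t) • x + t • T x) ∈ densK Ω := by
  obtain ⟨hp0, hv0, ho0⟩ := h₀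
  obtain ⟨hp1, hv1, ho1⟩ := h₁
  have hΩm : MeasurableSet Ω := hcomp.measurableSet
  have hx : ∀ᵐ x ∂μ₀, x ∈ Ω := ho0
  have hTx : ∀ᵐ x ∂μ₀, T x ∈ Ω := by
    rw [← hpush, Measure.map_apply hTm hΩm.compl] at ho1
    exact ho1
  intro t ht
  have hGm : Measurable (fun x => (1 - t) • x + t • T x) := by fun_prop
  refine ⟨Measure.isProbabilityMeasure_map hGm.aemeasurable, ?_, ?_⟩
  swap
  · rw [Measure.map_apply hGm hΩm.compl]
    have : ∀ᵐ x ∂μ₀, (1 - t) • x + t • T x ∈ Ω := by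
      filter_upwards [hx, hTx] with x a b
      exact hconv a b (by linarith [ht.2]) ht.1 (by ring)
    exact this
  rcases ht.1.eq_or_lt with h | h0
  · subst h
    simpa using hv0
  rcases ht.2.eq_or_lt with h | h1
  · subst h
    simpa [hpush] using hv1
  -- the optimal plan
  have hid : Measurable (fun x => (x, T x)) := by fun_prop
  set γ := μ₀.map (fun x => (x, T x)) with hγ
  have hγp : IsProbabilityMeasure γ := Measure.isProbabilityMeasure_map hid.aemeasurable
  have hγf : γ.map Prod.fst = μ₀ := by
    rw [hγ, Measure.map_map measurable_fst hid]; exact Measure.map_id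
  have hγs : γ.map Prod.snd = μ₁ := by
    rw [hγ, Measure.map_map measurable_snd hid]; exact hpush
  have hcm : Measurable fun p : EuclideanSpace ℝ (Fin d) × EuclideanSpace ℝ (Fin d) =>
      ENNReal.ofReal (dist p.1 p.2 ^ 2) := by fun_prop
  have hγc : ∫⁻ p, ENNReal.ofReal (dist p.1 p.2 ^ 2) ∂γ = W2sq μ₀ μ₁ := by
    rw [hγ, lintegral_map hcm hid]; exact hopt
  obtain ⟨M, hM⟩ := hcomp.isBounded.exists_norm_le
  have hfin : ∫⁻ p, ENNReal.ofReal (dist p.1 p.2 ^ 2) ∂γ ≠ ⊤ := by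
    rw [hγ, lintegral_map hcm hid]
    refine ne_top_of_le_ne_top (b := ∫⁻ _, ENNReal.ofReal ((M + M) ^ 2) ∂μ₀) (by simp) ?_
    refine lintegral_mono_ae ?_
    filter_upwards [hx, hTx] with x a b
    apply ENNReal.ofReal_le_ofReal
    have : dist x (T x) ≤ M + M := by
      rw [dist_eq_norm]
      exact (norm_sub_le _ _).trans (add_le_add (hM _ a) (hM _ b))
    gcongr
  have hmin : ∀ γ' : Measure (EuclideanSpace ℝ (Fin d) × EuclideanSpace ℝ (Fin d)),
      γ'.map Prod.fst = γ.map Prod.fst → γ'.map Prod.snd = γ.map Prod.snd →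
      ∫⁻ p, ENNReal.ofReal (dist p.1 p.2 ^ 2) ∂γ ≤
        ∫⁻ p, ENNReal.ofReal (dist p.1 p.2 ^ 2) ∂γ' := by
    intro γ' a b
    rw [hγc]
    exact sInf_le ⟨γ', a.trans hγf, b.trans hγs, rfl⟩
  set Γ : Set (EuclideanSpace ℝ (Fin d) × EuclideanSpace ℝ (Fin d)) :=
    γ.support ∩ {p | p.2 ∈ Ω} with hΓ
  have hΓae : ∀ᵐ x ∂μ₀, (x, T x) ∈ Γ := by
    have h2 : ∀ᵐ p ∂γ, p ∈ γ.support := Measure.support_mem_ae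
    filter_upwards [ae_of_ae_map hid.aemeasurable h2, hTx] with x a b
    exact ⟨a, b⟩
  obtain ⟨x₀, hx₀⟩ := hΓae.exists
  obtain ⟨φ, hL, hC, hsub⟩ := rockafellar Γ ⟨_, hx₀⟩ M (fun p hp => hM _ hp.2)
    (fun n p hp σ => cyc_mon γ hfin hmin p (fun i => (hp i).1) σ)
  refine core_le μ₀ μ₁ hv0 hv1 T hTm hpush φ M hL hC ?_ t h0 h1
  filter_upwards [hΓae] with x a z
  exact hsub _ a z
end
end

section
/- Let ρ ∈ L¹(ℝ) with 0 ≤ ρ ≤ 1 and ∫ρ = 1, and let ω = ∪_n (a_n, b_n) be the (countable, disjoint) union of maximal open intervals on which ρ = 1 a.e., with lengths α_n = b_n − a_n. Then for every probability measure μ on ℝ with P_K(μ) = ρ (projection in W₂ onto K = {0 ≤ ρ' ≤ 1}), one has W₂(μ, ρ)² ≤ (1/12) Σ_n α_n³, with equality when μ = Σ_n α_n δ_{(a_n + b_n)/2} (provided this sums to a probability measure compatible with the mass outside ω being zero). -/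
noncomputable section
open MeasureTheory

/-- Probability measures on `ℝ` with density bounded by `1`. -/
def densLEone : Set (Measure ℝ) := {ν | IsProbabilityMeasure ν ∧ ν ≤ volume}


namespace PD
open Set Filter Topology ProbabilityTheory

lemma sq_eq (y x : ℝ) : ENNReal.ofReal (dist y x ^ 2) =
    ((volume : Measure ℝ).prod volume) (Ico y x ×ˢ Ico y x) +
    ((volume : Measure ℝ).prod volume) (Ico x y ×ˢ Ico x y) := by
  rw [Measure.prod_prod, Measure.prod_prod, Real.volume_Ico, Real.volume_Ico, Real.dist_eq, sq_abs]
  rcases le_total y x with h | h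
  · rw [ENNReal.ofReal_of_nonpos (show y - x ≤ 0 by linarith),
      ← ENNReal.ofReal_mul (by linarith)]
    simp only [mul_zero, add_zero]; congr 1; ring
  · rw [ENNReal.ofReal_of_nonpos (show x - y ≤ 0 by linarith),
      ← ENNReal.ofReal_mul (by linarith)]
    simp only [mul_zero, zero_add]; congr 1; ring

lemma cost_eq (γ : Measure (ℝ × ℝ)) [IsFiniteMeasure γ] :
    ∫⁻ p, ENNReal.ofReal (dist p.1 p.2 ^ 2) ∂γ =
    ∫⁻ z, γ (Iic (min z.1 z.2) ×ˢ Ioi (max z.1 z.2)) ∂((volume : Measure ℝ).prod volume) +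
    ∫⁻ z, γ (Ioi (max z.1 z.2) ×ˢ Iic (min z.1 z.2)) ∂((volume : Measure ℝ).prod volume) := by
  have key : ∀ E : Set ((ℝ × ℝ) × (ℝ × ℝ)), MeasurableSet E →
      ∫⁻ p, ((volume : Measure ℝ).prod volume) (Prod.mk p ⁻¹' E) ∂γ =
      ∫⁻ z, γ ((fun p => (p, z)) ⁻¹' E) ∂((volume : Measure ℝ).prod volume) := by
    intro E hE
    rw [← Measure.prod_apply hE, Measure.prod_apply_symm hE]
  have E1 : MeasurableSet {q : (ℝ × ℝ) × (ℝ × ℝ) | q.1.1 ≤ q.2.1 ∧ q.2.1 < q.1.2 ∧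
      q.1.1 ≤ q.2.2 ∧ q.2.2 < q.1.2} := by
    simp only [ofPred_and]
    refine (measurableSet_le (by fun_prop) (by fun_prop)).inter
      ((measurableSet_lt (by fun_prop) (by fun_prop)).inter
      ((measurableSet_le (by fun_prop) (by fun_prop)).inter
      (measurableSet_lt (by fun_prop) (by fun_prop))))
  have E2 : MeasurableSet {q : (ℝ × ℝ) × (ℝ × ℝ) | q.1.2 ≤ q.2.1 ∧ q.2.1 < q.1.1 ∧
      q.1.2 ≤ q.2.2 ∧ q.2.2 < q.1.1} := by
    simp only [ofPred_and]
    refine (measurableSet_le (by fun_prop) (by fun_prop)).inter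
      ((measurableSet_lt (by fun_prop) (by fun_prop)).inter
      ((measurableSet_le (by fun_prop) (by fun_prop)).inter
      (measurableSet_lt (by fun_prop) (by fun_prop))))
  have k1 := key _ E1
  have k2 := key _ E2
  have m1 := measurable_measure_prodMk_left (ν := (volume : Measure ℝ).prod volume) E1
  calc _ = ∫⁻ p, (((volume : Measure ℝ).prod volume) (Prod.mk p ⁻¹' _) +
        ((volume : Measure ℝ).prod volume) (Prod.mk p ⁻¹' _)) ∂γ := by
        refine lintegral_congr fun p => ?_
        rw [sq_eq]
        congr 2
        · ext z; 
          show _ ↔ z ∈ (Prod.mk p ⁻¹' {q : (ℝ × ℝ) × (ℝ × ℝ) | q.1.1 ≤ q.2.1 ∧ q.2.1 < q.1.2 ∧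
              q.1.1 ≤ q.2.2 ∧ q.2.2 < q.1.2})
          simp [and_assoc]
        · ext z; 
          show _ ↔ z ∈ (Prod.mk p ⁻¹' {q : (ℝ × ℝ) × (ℝ × ℝ) | q.1.2 ≤ q.2.1 ∧ q.2.1 < q.1.1 ∧
              q.1.2 ≤ q.2.2 ∧ q.2.2 < q.1.1})
          simp [and_assoc]
    _ = _ := by
        rw [lintegral_add_left m1, k1, k2]
        congr 1
        · refine lintegral_congr fun z => ?_
          congr 1; ext p; simp; tauto
        · refine lintegral_congr fun z => ?_
          congr 1; ext p; simp; tauto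

lemma diff_lower (ν : Measure ℝ) [IsFiniteMeasure ν] {L M : Set ℝ} (hL : IsLowerSet L)
    (hM : IsLowerSet M) (mM : MeasurableSet M) : ν (L \ M) ≤ ν L - ν M := by
  rcases hL.total hM with h | h
  · simp [sdiff_eq_empty.2 h]
  · rw [measure_sdiff h mM.nullMeasurableSet (measure_ne_top _ _)]

/-- optimality criterion -/
lemma cost_le (μ ν : Measure ℝ) [IsProbabilityMeasure μ] [IsProbabilityMeasure ν]
    (γ₀ : Measure (ℝ × ℝ)) [IsFiniteMeasure γ₀]
    (h1 : ∀ m M, γ₀ (Iic m ×ˢ Ioi M) ≤ μ (Iic m) - ν (Iic M))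
    (h2 : ∀ m M, γ₀ (Ioi M ×ˢ Iic m) ≤ ν (Iic m) - μ (Iic M)) :
    ∫⁻ p, ENNReal.ofReal (dist p.1 p.2 ^ 2) ∂γ₀ ≤ W2sq μ ν := by
  refine le_sInf ?_
  rintro c ⟨γ, g1, g2, rfl⟩
  have : IsFiniteMeasure γ := by
    constructor
    have := measure_lt_top μ univ
    rwa [← g1, Measure.map_apply measurable_fst MeasurableSet.univ, preimage_univ] at this
  rw [cost_eq, cost_eq]
  refine add_le_add (lintegral_mono fun z => ?_) (lintegral_mono fun z => ?_)
  · refine (h1 _ _).trans ?_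
    rw [tsub_le_iff_right, ← g1, ← g2, Measure.map_apply measurable_fst measurableSet_Iic,
      Measure.map_apply measurable_snd measurableSet_Iic]
    refine le_trans (measure_mono ?_) (measure_union_le _ _)
    intro p hp
    by_cases h : p.2 ≤ max z.1 z.2
    · right; exact h
    · left; exact ⟨hp, not_le.1 h⟩
  · refine (h2 _ _).trans ?_
    rw [tsub_le_iff_right, ← g1, ← g2, Measure.map_apply measurable_fst measurableSet_Iic,
      Measure.map_apply measurable_snd measurableSet_Iic]
    refine le_trans (measure_mono ?_) (measure_union_le _ _)
    intro p hp
    by_cases h : p.1 ≤ max z.1 z.2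
    · right; exact h
    · left; exact ⟨not_le.1 h, hp⟩

/-- cdf of a measure with density at most one -/
lemma cdf_lip (ν : Measure ℝ) [IsProbabilityMeasure ν] (hle : ν ≤ volume) {x y : ℝ} (h : x ≤ y) :
    cdf ν y - cdf ν x ≤ y - x := by
  have : ν (Ioc x y) = ENNReal.ofReal (cdf ν y - cdf ν x) := by
    conv_lhs => rw [← measure_cdf ν]
    rw [StieltjesFunction.measure_Ioc]
  have h2 := hle (Ioc x y)
  rw [this, Real.volume_Ioc, ENNReal.ofReal_le_ofReal_iff (by linarith)] at h2
  exact h2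

lemma cdf_cont (ν : Measure ℝ) [IsProbabilityMeasure ν] (hle : ν ≤ volume) :
    Continuous (cdf ν) := by
  have : LipschitzWith 1 (cdf ν) := by
    refine LipschitzWith.of_le_add fun x y => ?_
    rcases le_total x y with h | h
    · have := monotone_cdf ν h
      have := dist_nonneg (x := x) (y := y); linarith
    · have := cdf_lip ν hle h
      rw [Real.dist_eq, abs_of_nonneg (by linarith)]; linarith
  exact this.continuous

lemma measure_cdf_le (ν : Measure ℝ) [IsProbabilityMeasure ν] (hle : ν ≤ volume) {u : ℝ}
    (h0 : 0 ≤ u) (h1 : u ≤ 1) : ν {x | cdf ν x ≤ u} = ENNReal.ofReal u := by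
  have main : ∀ u : ℝ, 0 < u → u < 1 → ν {x | cdf ν x ≤ u} = ENNReal.ofReal u := by
    intro u h0 h1
    obtain ⟨p, hp⟩ := ((tendsto_cdf_atBot ν).eventually (gt_mem_nhds h0)).exists
    obtain ⟨q, hq⟩ := ((tendsto_cdf_atTop ν).eventually (lt_mem_nhds h1)).exists
    have hcl : IsClosed {x | cdf ν x ≤ u} := isClosed_le (cdf_cont ν hle) continuous_const
    have hbd : BddAbove {x | cdf ν x ≤ u} := by
      refine ⟨q, fun x hx => ?_⟩
      by_contra hc
      have := monotone_cdf ν (not_le.1 hc).le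
      simp only [mem_ofPred_eq] at hx
      linarith
    have hne : {x | cdf ν x ≤ u}.Nonempty := ⟨p, hp.le⟩
    have hmem := hcl.csSup_mem hne hbd
    set s := sSup {x | cdf ν x ≤ u} with hs
    have hset : {x | cdf ν x ≤ u} = Iic s := by
      ext x
      constructor
      · intro hx; exact le_csSup hbd hx
      · intro hx; exact (monotone_cdf ν hx).trans hmem
    rw [hset, ← ofReal_cdf]
    congr 1
    refine le_antisymm hmem ?_
    have : Tendsto (cdf ν) (𝓝[>] s) (𝓝 (cdf ν s)) :=
      ((cdf_cont ν hle).tendsto s).mono_left nhdsWithin_le_nhds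
    refine ge_of_tendsto this ?_
    filter_upwards [self_mem_nhdsWithin] with x hx
    by_contra hc
    exact absurd (le_csSup hbd (show x ∈ {x | cdf ν x ≤ u} from (not_le.1 hc).le)) (not_le.2 hx)
  rcases h1.lt_or_eq with h1 | rfl
  · rcases h0.lt_or_eq with h0 | rfl
    · exact main u h0 h1
    · rw [ENNReal.ofReal_zero]
      refine le_antisymm (ENNReal.le_of_forall_pos_le_add ?_) zero_le
      intro ε hε _
      have hm : (0:ℝ) < min (ε:ℝ) (1/2) := lt_min hε (by norm_num)
      have := main _ hm (lt_of_le_of_lt (min_le_right _ _) (by norm_num))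
      rw [zero_add]
      calc ν {x | cdf ν x ≤ 0} ≤ ν {x | cdf ν x ≤ min (ε:ℝ) (1/2)} :=
            measure_mono fun x hx => le_trans hx hm.le
        _ ≤ ENNReal.ofReal (ε : ℝ) := by
            rw [this]; exact ENNReal.ofReal_le_ofReal (min_le_left _ _)
        _ = ε := ENNReal.ofReal_coe_nnreal
  · have : {x | cdf ν x ≤ 1} = univ := by ext x; simp [cdf_le_one]
    simp [this]

lemma map_cdf (ν : Measure ℝ) [IsProbabilityMeasure ν] (hle : ν ≤ volume) :
    ν.map (cdf ν) = volume.restrict (Icc 0 1) := by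
  have hm : Measurable (cdf ν) := (cdf_cont ν hle).measurable
  have : IsProbabilityMeasure (ν.map (cdf ν)) := Measure.isProbabilityMeasure_map hm.aemeasurable
  refine Measure.ext_of_Iic _ _ fun u => ?_
  rw [Measure.map_apply hm measurableSet_Iic, Measure.restrict_apply measurableSet_Iic]
  show ν {x | cdf ν x ≤ u} = _
  rcases lt_or_ge u 0 with h0 | h0
  · have e1 : {x | cdf ν x ≤ u} = ∅ := by
      ext x; have := cdf_nonneg ν x; simp; linarith
    have e2 : Iic u ∩ Icc (0:ℝ) 1 = ∅ := by
      ext x; simp; intros; linarith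
    simp [e1, e2]
  rcases le_or_gt u 1 with h1 | h1
  · rw [measure_cdf_le ν hle h0 h1]
    have e2 : Iic u ∩ Icc (0:ℝ) 1 = Icc 0 u := by
      ext x; simp only [mem_inter_iff, mem_Iic, mem_Icc]; constructor
      · rintro ⟨h, h', _⟩; exact ⟨h', h⟩
      · rintro ⟨h, h'⟩; exact ⟨h', h, h'.trans h1⟩
    rw [e2]; simp
  · have e1 : {x | cdf ν x ≤ u} = univ := by
      ext x; have := cdf_le_one ν x; simp; linarith
    have e2 : Iic u ∩ Icc (0:ℝ) 1 = Icc 0 1 := by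
      rw [inter_eq_right]; intro x hx; exact hx.2.trans h1.le
    simp [e1, e2]

/-- the essential interval of `ν` -/
def J (ν : Measure ℝ) : Set ℝ := {x | 0 < cdf ν x ∧ cdf ν x < 1}

lemma measurableSet_J (ν : Measure ℝ) : MeasurableSet (J ν) :=
  have hm : Measurable (cdf ν) := (monotone_cdf ν).measurable
  (measurableSet_lt measurable_const hm).inter (measurableSet_lt hm measurable_const)

lemma ae_J (ν : Measure ℝ) [IsProbabilityMeasure ν] (hle : ν ≤ volume) : ∀ᵐ x ∂ν, x ∈ J ν := by
  have hm : Measurable (cdf ν) := (cdf_cont ν hle).measurable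
  have : ∀ᵐ y ∂(ν.map (cdf ν)), y ∈ Ioo (0:ℝ) 1 := by
    rw [map_cdf ν hle, ← restrict_Ioo_eq_restrict_Icc]
    exact ae_restrict_mem measurableSet_Ioo
  exact ae_of_ae_map hm.aemeasurable this

/-- measure with expanding map has density at most one -/
lemma map_le (ν : Measure ℝ) [IsProbabilityMeasure ν] (hle : ν ≤ volume) (S : ℝ → ℝ)
    (mS : Measurable S)
    (hS : ∀ x ∈ J ν, ∀ y ∈ J ν, x < y → cdf ν y - cdf ν x ≤ S y - S x) :
    ν.map S ∈ densLEone := by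
  refine ⟨Measure.isProbabilityMeasure_map mS.aemeasurable, ?_⟩
  have hm : Measurable (cdf ν) := (cdf_cont ν hle).measurable
  refine Measure.le_iff.2 fun B hB => ?_
  rw [Measure.map_apply mS hB]
  set A := S ⁻¹' B ∩ J ν with hA
  have e1 : ν (S ⁻¹' B) = ν A := by
    refine measure_congr ?_
    filter_upwards [ae_J ν hle] with x hx
    have : (x ∈ S ⁻¹' B) = (x ∈ A) := by simp [hA, hx]
    exact this
  have e2 : ν A ≤ volume (cdf ν '' A) := by
    calc ν A ≤ ν (cdf ν ⁻¹' (toMeasurable volume (cdf ν '' A))) :=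
          measure_mono fun x hx => subset_toMeasurable _ _ (mem_image_of_mem _ hx)
      _ = ν.map (cdf ν) (toMeasurable volume (cdf ν '' A)) := by
          rw [Measure.map_apply hm (measurableSet_toMeasurable _ _)]
      _ ≤ volume (toMeasurable volume (cdf ν '' A)) := by
          rw [map_cdf ν hle]; exact Measure.restrict_apply_le _ _
      _ = _ := measure_toMeasurable _
  have key : ∀ x ∈ A, ∀ y ∈ A, |cdf ν x - cdf ν y| ≤ |S x - S y| := by
    intro x hx y hy
    rcases lt_trichotomy x y with h | rfl | h
    · rw [abs_sub_comm, abs_sub_comm (S x)]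
      rw [abs_of_nonneg (by linarith [monotone_cdf ν h.le])]
      exact (hS x hx.2 y hy.2 h).trans (le_abs_self _)
    · simp
    · rw [abs_of_nonneg (by linarith [monotone_cdf ν h.le])]
      exact (hS y hy.2 x hx.2 h).trans (le_abs_self _)
  choose! g hg using fun (z : ℝ) (hz : z ∈ S '' A) => hz
  have hl : LipschitzOnWith 1 (fun z => cdf ν (g z)) (S '' A) := by
    refine LipschitzOnWith.of_dist_le_mul fun z hz w hw => ?_
    have := key _ (hg z hz).1 _ (hg w hw).1
    rw [(hg z hz).2, (hg w hw).2] at this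
    simpa [Real.dist_eq] using this
  have e3 : cdf ν '' A = (fun z => cdf ν (g z)) '' (S '' A) := by
    rw [image_image]
    refine image_congr fun x hx => ?_
    have hx' := mem_image_of_mem S hx
    have := key _ (hg _ hx').1 x hx
    rw [(hg _ hx').2] at this
    simp only [sub_self, abs_zero, abs_nonpos_iff] at this
    linarith
  have e4 := hl.hausdorffMeasure_image_le (d := 1) zero_le_one
  rw [hausdorffMeasure_real] at e4
  simp only [ENNReal.coe_one, ENNReal.one_rpow, one_mul] at e4
  rw [e1]
  refine e2.trans ?_
  rw [e3]
  refine e4.trans (measure_mono ?_)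
  rintro _ ⟨x, hx, rfl⟩
  exact hx.1

open Classical in
/-- monotone rearrangement of `ν` onto `μ` -/
def T (μ ν : Measure ℝ) (x : ℝ) : ℝ := if x ∈ J ν then sInf {y | cdf ν x ≤ cdf μ y} else 0

lemma T_le_iff (μ ν : Measure ℝ) {x : ℝ} (hx : x ∈ J ν) (y : ℝ) :
    T μ ν x ≤ y ↔ cdf ν x ≤ cdf μ y := by
  rw [T, if_pos hx]
  obtain ⟨p, hp⟩ := ((tendsto_cdf_atBot μ).eventually (gt_mem_nhds hx.1)).exists
  obtain ⟨q, hq⟩ := ((tendsto_cdf_atTop μ).eventually (lt_mem_nhds hx.2)).exists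
  have hbd : BddBelow {y | cdf ν x ≤ cdf μ y} := by
    refine ⟨p, fun z hz => ?_⟩
    by_contra hc
    have := monotone_cdf μ (not_le.1 hc).le
    simp only [mem_ofPred_eq] at hz
    linarith
  have hne : {y | cdf ν x ≤ cdf μ y}.Nonempty := ⟨q, hq.le⟩
  constructor
  · intro h
    have hr : Tendsto (cdf μ) (𝓝[>] y) (𝓝 (cdf μ y)) :=
      ((cdf μ).right_continuous y).mono_left (nhdsWithin_mono _ Ioi_subset_Ici_self)
    refine ge_of_tendsto hr ?_
    filter_upwards [self_mem_nhdsWithin] with z hz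
    obtain ⟨w, hw, hwz⟩ := exists_lt_of_csInf_lt hne (lt_of_le_of_lt h hz)
    exact le_trans hw (monotone_cdf μ hwz.le)
  · intro h; exact csInf_le hbd h

lemma T_mono (μ ν : Measure ℝ) : MonotoneOn (T μ ν) (J ν) := by
  intro x hx y hy hxy
  rw [T_le_iff μ ν hx]
  exact (monotone_cdf ν hxy).trans ((T_le_iff μ ν hy _).1 le_rfl)

lemma T_meas (μ ν : Measure ℝ) : Measurable (T μ ν) := by
  refine measurable_of_Iic fun y => ?_
  have hm : Measurable (cdf ν) := (monotone_cdf ν).measurable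
  have : T μ ν ⁻¹' Iic y = (J ν ∩ {x | cdf ν x ≤ cdf μ y}) ∪ ((J ν)ᶜ ∩ {_x | 0 ≤ y}) := by
    ext x
    by_cases hx : x ∈ J ν
    · simp [hx, T_le_iff]
    · simp [hx, T]
  rw [this]
  exact ((measurableSet_J ν).inter (measurableSet_le hm measurable_const)).union
    ((measurableSet_J ν).compl.inter (MeasurableSet.const _))

section
variable (μ ν : Measure ℝ) [IsProbabilityMeasure μ] [IsProbabilityMeasure ν]

lemma T_map (hle : ν ≤ volume) : ν.map (T μ ν) = μ := by
  have : IsProbabilityMeasure (ν.map (T μ ν)) :=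
    Measure.isProbabilityMeasure_map (T_meas μ ν).aemeasurable
  refine Measure.ext_of_Iic _ _ fun y => ?_
  rw [Measure.map_apply (T_meas μ ν) measurableSet_Iic, ← ofReal_cdf,
    ← measure_cdf_le ν hle (cdf_nonneg μ y) (cdf_le_one μ y)]
  refine measure_congr ?_
  filter_upwards [ae_J ν hle] with x hx
  exact propext (T_le_iff μ ν hx y)

lemma T_opt (hle : ν ≤ volume) : ∫⁻ x, ENNReal.ofReal ((x - T μ ν x) ^ 2) ∂ν ≤ W2sq μ ν := by
  have mT := T_meas μ ν
  have hm : Measurable (cdf ν) := (monotone_cdf ν).measurable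
  have mp : Measurable fun x => (T μ ν x, x) := mT.prodMk measurable_id
  have : IsProbabilityMeasure (ν.map fun x => (T μ ν x, x)) :=
    Measure.isProbabilityMeasure_map mp.aemeasurable
  have hlow : ∀ u, IsLowerSet {x | cdf ν x ≤ u} := fun u x y hxy hx =>
    le_trans (monotone_cdf ν hxy) hx
  have hme : ∀ u, MeasurableSet {x | cdf ν x ≤ u} := fun u => measurableSet_le hm measurable_const
  have hE : ∀ m, ν {x | cdf ν x ≤ cdf μ m} = μ (Iic m) := fun m => by
    rw [← ofReal_cdf, measure_cdf_le ν hle (cdf_nonneg μ m) (cdf_le_one μ m)]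
  have := cost_le μ ν (ν.map fun x => (T μ ν x, x)) ?_ ?_
  · rw [lintegral_map (by fun_prop) mp] at this
    refine le_trans (le_of_eq ?_) this
    refine lintegral_congr fun x => ?_
    rw [Real.dist_eq, sq_abs]; congr 1; ring
  · intro m M
    rw [Measure.map_apply mp (measurableSet_Iic.prod measurableSet_Ioi)]
    rw [← hE]
    refine le_trans (le_of_eq ?_) (diff_lower ν (hlow (cdf μ m)) (isLowerSet_Iic M)
      measurableSet_Iic)
    refine measure_congr ?_
    filter_upwards [ae_J ν hle] with x hx
    refine propext ?_
    show T μ ν x ≤ m ∧ M < x ↔ cdf ν x ≤ cdf μ m ∧ ¬ x ≤ M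
    rw [T_le_iff μ ν hx, not_le]
  · intro m M
    rw [Measure.map_apply mp (measurableSet_Ioi.prod measurableSet_Iic)]
    rw [← hE]
    refine le_trans (le_of_eq ?_) (diff_lower ν (isLowerSet_Iic m) (hlow (cdf μ M)) (hme _))
    refine measure_congr ?_
    filter_upwards [ae_J ν hle] with x hx
    refine propext ?_
    show M < T μ ν x ∧ x ≤ m ↔ x ≤ m ∧ ¬ cdf ν x ≤ cdf μ M
    rw [← T_le_iff μ ν hx, not_le, and_comm]

lemma W_le (hle : ν ≤ volume) (S : ℝ → ℝ) (mS : Measurable S) :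
    W2sq μ (ν.map S) ≤ ∫⁻ x, ENNReal.ofReal ((S x - T μ ν x) ^ 2) ∂ν := by
  have mT := T_meas μ ν
  have mp : Measurable fun x => (T μ ν x, S x) := mT.prodMk mS
  refine sInf_le ⟨ν.map fun x => (T μ ν x, S x), ?_, ?_, ?_⟩
  · rw [Measure.map_map measurable_fst mp]; exact T_map μ ν hle
  · rw [Measure.map_map measurable_snd mp]; rfl
  · rw [lintegral_map (by fun_prop) mp]
    refine lintegral_congr fun x => ?_
    rw [Real.dist_eq, sq_abs]; congr 1; ring

lemma opt_S (hle : ν ≤ volume)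
    (hproj : ∀ σ ∈ densLEone, W2sq μ ν ≤ W2sq μ σ)
    (S : ℝ → ℝ) (mS : Measurable S)
    (hS : ∀ x ∈ J ν, ∀ y ∈ J ν, x < y → cdf ν y - cdf ν x ≤ S y - S x) :
    ∫⁻ x, ENNReal.ofReal ((x - T μ ν x) ^ 2) ∂ν ≤
      ∫⁻ x, ENNReal.ofReal ((S x - T μ ν x) ^ 2) ∂ν :=
  (T_opt μ ν hle).trans ((hproj _ (map_le ν hle S mS hS)).trans (W_le μ ν hle S mS))

lemma memLp_f (hle : ν ≤ volume)
    (hproj : ∀ σ ∈ densLEone, W2sq μ ν ≤ W2sq μ σ)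
    : MemLp (fun x => x - T μ ν x) 2 ν := by
  have mT := T_meas μ ν
  have hm : Measurable (cdf ν) := (monotone_cdf ν).measurable
  have h1 := opt_S μ ν hle hproj (fun x => T μ ν x + cdf ν x) (by fun_prop) (by
    intro x hx y hy hxy
    have := T_mono μ ν hx hy hxy.le
    linarith)
  have h2 : ∫⁻ x, ENNReal.ofReal ((x - T μ ν x) ^ 2) ∂ν < ⊤ := by
    refine lt_of_le_of_lt h1 ?_
    refine lt_of_le_of_lt (lintegral_mono (g := fun _ => 1) fun x => ?_) (by simp)
    rw [← ENNReal.ofReal_one]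
    refine ENNReal.ofReal_le_ofReal ?_
    have := cdf_nonneg ν x
    have := cdf_le_one ν x
    nlinarith
  rw [memLp_two_iff_integrable_sq (by fun_prop)]
  refine ⟨by fun_prop, ?_⟩
  rw [hasFiniteIntegral_iff_ofReal (ae_of_all _ fun x => sq_nonneg _)]
  exact h2

/-- first order condition -/
lemma first_order (hle : ν ≤ volume)
    (hproj : ∀ σ ∈ densLEone, W2sq μ ν ≤ W2sq μ σ)
    (ψ : ℝ → ℝ) (mψ : Measurable ψ) (C : ℝ) (hC : ∀ x, |ψ x| ≤ C)
    (hS : ∀ x ∈ J ν, ∀ y ∈ J ν, x < y → cdf ν y - cdf ν x ≤ (y + ψ y) - (x + ψ x)) :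
    0 ≤ ∫ x, ψ x * (x - T μ ν x) ∂ν := by
  have mT := T_meas μ ν
  have hf := memLp_f μ ν hle hproj
  have hψ : MemLp ψ 2 ν := MemLp.of_bound mψ.aestronglyMeasurable C (ae_of_all _ hC)
  have i1 := hf.integrable_sq
  have i2 : Integrable (fun x => ψ x * (x - T μ ν x)) ν := hψ.integrable_mul hf
  have i3 := hψ.integrable_sq
  by_contra hneg
  push Not at hneg
  set A := ∫ x, ψ x * (x - T μ ν x) ∂ν with hA
  set B := ∫ x, ψ x ^ 2 ∂ν with hB
  have hB0 : 0 ≤ B := integral_nonneg fun x => sq_nonneg _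
  have key : ∀ t : ℝ, 0 < t → t ≤ 1 → 0 ≤ t * (2 * A + t * B) := by
    intro t t0 t1
    have h := opt_S μ ν hle hproj (fun x => x + t * ψ x) (by fun_prop) (by
      intro x hx y hy hxy
      have h1 := hS x hx y hy hxy
      have h2 := cdf_lip ν hle hxy.le
      nlinarith)
    have e : (fun x => (x + t * ψ x - T μ ν x) ^ 2) = fun x => (x - T μ ν x) ^ 2 +
        ((2 * t) * (ψ x * (x - T μ ν x)) + t ^ 2 * ψ x ^ 2) := by
      ext x; ring
    have i4 : Integrable (fun x => (2 * t) * (ψ x * (x - T μ ν x)) + t ^ 2 * ψ x ^ 2) ν :=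
      (i2.const_mul _).add (i3.const_mul _)
    have i5 : Integrable (fun x => (x + t * ψ x - T μ ν x) ^ 2) ν := by
      rw [e]; exact i1.add i4
    rw [← ofReal_integral_eq_lintegral_ofReal i1 (ae_of_all _ fun x => sq_nonneg _),
      ← ofReal_integral_eq_lintegral_ofReal i5 (ae_of_all _ fun x => sq_nonneg _),
      ENNReal.ofReal_le_ofReal_iff (integral_nonneg fun x => sq_nonneg _), e,
      integral_add i1 i4, integral_add (i2.const_mul _) (i3.const_mul _),
      integral_const_mul, integral_const_mul] at h
    nlinarith
  have t0 : 0 < min 1 (-A / (B + 1)) := lt_min one_pos (div_pos (by linarith) (by linarith))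
  have := key _ t0 (min_le_left _ _)
  have h3 : min 1 (-A / (B + 1)) * (B + 1) ≤ -A := by
    rw [← le_div_iff₀ (by linarith)]; exact min_le_right _ _
  have h4 := nonneg_of_mul_nonneg_right this t0
  nlinarith

lemma fo_mono (hle : ν ≤ volume)
    (hproj : ∀ σ ∈ densLEone, W2sq μ ν ≤ W2sq μ σ)
    (ψ : ℝ → ℝ) (mψ : Monotone ψ) (C : ℝ) (hC : ∀ x, |ψ x| ≤ C) :
    0 ≤ ∫ x, ψ x * (x - T μ ν x) ∂ν :=
  first_order μ ν hle hproj ψ mψ.measurable C hC fun x _ y _ hxy => by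
    have := cdf_lip ν hle hxy.le
    have := mψ hxy.le
    linarith

lemma int_zero (hle : ν ≤ volume)
    (hproj : ∀ σ ∈ densLEone, W2sq μ ν ≤ W2sq μ σ)
    : ∫ x, (x - T μ ν x) ∂ν = 0 := by
  have h1 := fo_mono μ ν hle hproj (fun _ => 1) monotone_const 1 (by simp)
  have h2 := fo_mono μ ν hle hproj (fun _ => -1) monotone_const 1 (by simp)
  simp only [one_mul, neg_mul, integral_neg] at h1 h2
  linarith

/-- at a non saturated point -/
lemma tail_zero (hle : ν ≤ volume)
    (hproj : ∀ σ ∈ densLEone, W2sq μ ν ≤ W2sq μ σ)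
    (s : ℝ) (hs : ∀ l u, l < s → s < u → u - l ≠ cdf ν u - cdf ν l) :
    ∫ x in Ioi s, (x - T μ ν x) ∂ν = 0 := by
  have mT := T_meas μ ν
  have hf := memLp_f μ ν hle hproj
  have if1 : Integrable (fun x => x - T μ ν x) ν := hf.integrable one_le_two
  have ind : ∫ x in Ioi s, (x - T μ ν x) ∂ν =
      ∫ x, (Ioi s).indicator (fun _ => (1:ℝ)) x * (x - T μ ν x) ∂ν := by
    rw [← integral_indicator measurableSet_Ioi]
    congr 1; ext x; by_cases h : x ∈ Ioi s <;> simp [h]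
  refine le_antisymm ?_ ?_
  · let l : ℕ → ℝ := fun n => s - 1 / (n + 1)
    let u : ℕ → ℝ := fun n => s + 1 / (n + 1)
    have hpos : ∀ n : ℕ, (0:ℝ) < 1 / (n + 1) := fun n => by positivity
    let H : ℝ → ℝ := fun x => x - cdf ν x
    have hH : Monotone H := fun x y hxy => by
      have := cdf_lip ν hle hxy
      simp only [H]; linarith
    let η : ℕ → ℝ := fun n => H (u n) - H (l n)
    have hη : ∀ n, 0 < η n := by
      intro n
      have h1 := hs (l n) (u n) (by simp only [l]; linarith [hpos n])
        (by simp only [u]; linarith [hpos n])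
      have h2 : H (l n) ≤ H (u n) := hH (by simp only [l, u]; linarith [hpos n])
      refine lt_of_le_of_ne (by simp only [η]; linarith) ?_
      intro h3; apply h1; simp only [η, H] at h3; linarith
    let c : ℕ → ℝ → ℝ := fun n x => max (l n) (min x (u n))
    have hlu : ∀ n, l n < u n := fun n => by simp only [l, u]; linarith [hpos n]
    have hc1 : ∀ n x, H (l n) ≤ H (c n x) := fun n x => hH (le_max_left _ _)
    have hc2 : ∀ n x, H (c n x) ≤ H (u n) := fun n x => hH (max_le (hlu n).le (min_le_right _ _))
    let ψ : ℕ → ℝ → ℝ := fun n x => -(H (c n x) - H (l n))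
    have mc : ∀ n, Monotone (c n) := fun n x y hxy => by
      simp only [c]; gcongr
    have fo : ∀ n, 0 ≤ ∫ x, ψ n x * (x - T μ ν x) ∂ν := by
      intro n
      refine first_order μ ν hle hproj (ψ n) ?_ (η n) ?_ ?_
      · have : Measurable fun x => H (c n x) := (hH.comp (mc n)).measurable
        exact (this.sub_const _).neg
      · intro x
        simp only [ψ, abs_neg, η]
        rw [abs_of_nonneg (by linarith [hc1 n x])]
        linarith [hc2 n x]
      · intro x _ y _ hxy
        suffices h : H (c n y) - H (c n x) ≤ H y - H x by
          simp only [ψ]; simp only [H] at h ⊢; linarith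
        have h3 := hH hxy.le
        rcases le_total y (l n) with h | h
        · have e1 : c n y = l n := max_eq_left ((min_le_left _ _).trans h)
          have e2 : c n x = l n := max_eq_left ((min_le_left _ _).trans (hxy.le.trans h))
          rw [e1, e2]; linarith
        rcases le_total (u n) x with h' | h'
        · have e1 : c n x = u n := by
            simp only [c]; rw [min_eq_right h', max_eq_right (hlu n).le]
          have e2 : c n y = u n := by
            simp only [c]; rw [min_eq_right (h'.trans hxy.le), max_eq_right (hlu n).le]
          rw [e1, e2]; linarith
        have a1 : c n y ≤ y := max_le h (min_le_left _ _)
        have a2 : x ≤ c n x := le_trans (le_min le_rfl h') (le_max_right _ _)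
        have := hH a1
        have := hH a2
        linarith
    have lim : Tendsto (fun n => ∫ x, (ψ n x / η n) * (x - T μ ν x) ∂ν) atTop
        (𝓝 (∫ x, -((Ioi s).indicator (fun _ => (1:ℝ)) x * (x - T μ ν x)) ∂ν)) := by
      refine tendsto_integral_of_dominated_convergence (fun x => |x - T μ ν x|) ?_ if1.abs ?_ ?_
      · intro n
        have : Measurable fun x => H (c n x) := (hH.comp (mc n)).measurable
        have : Measurable (ψ n) := (this.sub_const _).neg
        fun_prop
      · intro n
        refine ae_of_all _ fun x => ?_
        rw [norm_mul, Real.norm_eq_abs, Real.norm_eq_abs]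
        refine mul_le_of_le_one_left (abs_nonneg _) ?_
        rw [abs_div, abs_of_pos (hη n), div_le_one (hη n)]
        simp only [ψ, abs_neg, η]
        rw [abs_of_nonneg (by linarith [hc1 n x])]
        linarith [hc2 n x]
      · have hns : ∀ᵐ x ∂ν, x ≠ s := by
          have h0 : ν {s} ≤ 0 := (hle {s}).trans (by simp)
          rw [ae_iff]; simpa using h0
        filter_upwards [hns] with x hx
        refine tendsto_const_nhds.congr' ?_
        have small : ∀ ε > (0:ℝ), ∀ᶠ n : ℕ in atTop, 1 / ((n:ℝ) + 1) < ε := fun ε hε =>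
          tendsto_one_div_add_atTop_nhds_zero_nat.eventually (gt_mem_nhds hε)
        rcases lt_or_gt_of_ne hx with h | h
        · filter_upwards [small (s - x) (by linarith)] with n hn
          have e1 : c n x = l n := max_eq_left ((min_le_left _ _).trans
            (by simp only [l]; linarith))
          have e2 : x ∉ Ioi s := by simp [h.le]
          simp [ψ, e1, e2]
        · filter_upwards [small (x - s) (by linarith)] with n hn
          have e1 : c n x = u n := by
            simp only [c]
            rw [min_eq_right (by simp only [u]; linarith), max_eq_right (hlu n).le]
          have e2 : x ∈ Ioi s := h
          have e3 : ψ n x / η n = -1 := by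
            simp only [ψ, e1, η]
            rw [neg_div, div_self]
            exact (hη n).ne'
          simp [e2, e3]
    have h0 : 0 ≤ ∫ x, -((Ioi s).indicator (fun _ => (1:ℝ)) x * (x - T μ ν x)) ∂ν := by
      refine ge_of_tendsto' lim fun n => ?_
      have : (fun x => (ψ n x / η n) * (x - T μ ν x)) =
          fun x => (η n)⁻¹ * (ψ n x * (x - T μ ν x)) := by
        ext x; ring
      rw [this, integral_const_mul]
      exact mul_nonneg (inv_nonneg.2 (hη n).le) (fo n)
    rw [integral_neg] at h0
    rw [ind]; linarith
  · rw [ind]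
    refine fo_mono μ ν hle hproj _ ?_ 1 ?_
    · intro x y hxy
      by_cases h : x ∈ Ioi s
      · have h' : y ∈ Ioi s := lt_of_lt_of_le h hxy
        simp [h, h']
      · rw [indicator_of_notMem h]
        exact indicator_nonneg (fun _ _ => zero_le_one) _
    · intro x; by_cases h : x ∈ Ioi s <;> simp [h]

end

section
variable (μ ν : Measure ℝ) [IsProbabilityMeasure μ] [IsProbabilityMeasure ν]

lemma Tf_nonneg (hle : ν ≤ volume)
    (hproj : ∀ σ ∈ densLEone, W2sq μ ν ≤ W2sq μ σ)
    {a b : ℝ} (hab : a < b) (hb : ∫ x in Ioi b, (x - T μ ν x) ∂ν = 0)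
    (hI : ∫ x in Ioc a b, (x - T μ ν x) ∂ν = 0) :
    0 ≤ ∫ x in Ioc a b, T μ ν x * (x - T μ ν x) ∂ν := by
  have mT := T_meas μ ν
  have hf := memLp_f μ ν hle hproj
  have if1 : Integrable (fun x => x - T μ ν x) ν := hf.integrable one_le_two
  have if2 := hf.integrable_sq
  have hz := int_zero μ ν hle hproj
  let cl : ℕ → ℝ → ℝ := fun M y => max (-(M:ℝ)) (min y M)
  have clb : ∀ M y, |cl M y| ≤ M := fun M y => by
    have h0 : (0:ℝ) ≤ M := Nat.cast_nonneg M
    exact abs_le.2 ⟨le_max_left _ _, max_le (by linarith) (min_le_right _ _)⟩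
  have clm : ∀ M, Monotone (cl M) := fun M x y hxy => by simp only [cl]; gcongr
  have clle : ∀ M y, |cl M y| ≤ |y| := fun M y => by
    have h0 : (0:ℝ) ≤ M := Nat.cast_nonneg M
    simp only [cl]
    rcases le_total y M with h | h
    · rw [min_eq_left h]
      rcases le_total (-(M:ℝ)) y with h' | h'
      · rw [max_eq_right h']
      · rw [max_eq_left h', abs_neg, abs_of_nonneg h0, abs_of_nonpos (by linarith)]; linarith
    · rw [min_eq_right h, max_eq_right (by linarith), abs_of_nonneg h0]
      exact h.trans (le_abs_self _)
  have step : ∀ M, 0 ≤ ∫ x in Ioc a b, cl M (T μ ν x) * (x - T μ ν x) ∂ν := by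
    intro M
    have hmon : MonotoneOn (fun x => cl M (T μ ν x)) (J ν) := fun x hx y hy hxy =>
      clm M (T_mono μ ν hx hy hxy)
    obtain ⟨g, hg, hgeq⟩ := hmon.exists_monotone_extension
      ⟨-M, by rintro _ ⟨x, _, rfl⟩; exact (abs_le.1 (clb M _)).1⟩
      ⟨M, by rintro _ ⟨x, _, rfl⟩; exact (abs_le.1 (clb M _)).2⟩
    let ψ : ℝ → ℝ := fun x => g (max a (min x b))
    have hψ : Monotone ψ := fun x y hxy => hg (by gcongr)
    have h := fo_mono μ ν hle hproj ψ hψ (max |g a| |g b|) (fun x => by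
      refine abs_le_max_abs_abs (hg (le_max_left _ _)) (hg (max_le hab.le (min_le_right _ _))))
    have e : (fun x => ψ x * (x - T μ ν x)) = fun x => g a * (x - T μ ν x) +
        ((Ioc a b).indicator (fun x => g x * (x - T μ ν x) - g a * (x - T μ ν x)) x +
        (Ioi b).indicator (fun x => (g b - g a) * (x - T μ ν x)) x) := by
      ext x
      simp only [ψ]
      rcases le_or_gt x a with h1 | h1
      · have n1 : x ∉ Ioc a b := fun h => absurd h.1 (not_lt.2 h1)
        have n2 : x ∉ Ioi b := fun h => by have : b < x := h; linarith
        rw [max_eq_left ((min_le_left _ _).trans h1)]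
        simp [n1, n2]
      rcases le_or_gt x b with h2 | h2
      · have n1 : x ∈ Ioc a b := ⟨h1, h2⟩
        have n2 : x ∉ Ioi b := fun h => by have : b < x := h; linarith
        rw [min_eq_left h2, max_eq_right h1.le]
        simp [n1, n2]
      · have n1 : x ∉ Ioc a b := fun h => absurd h.2 (not_le.2 h2)
        have n2 : x ∈ Ioi b := h2
        rw [min_eq_right h2.le, max_eq_right hab.le]
        simp only [n1, n2, not_false_eq_true, indicator_of_notMem, indicator_of_mem]
        ring
    have ig : IntegrableOn (fun x => g x * (x - T μ ν x)) (Ioc a b) ν := by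
      refine Integrable.bdd_mul (c := max |g a| |g b|) if1.integrableOn
        hg.measurable.aestronglyMeasurable ?_
      filter_upwards [ae_restrict_mem measurableSet_Ioc] with x hx
      exact abs_le_max_abs_abs (hg hx.1.le) (hg hx.2)
    have ia : IntegrableOn (fun x => g a * (x - T μ ν x)) (Ioc a b) ν :=
      (if1.const_mul _).integrableOn
    have ib : IntegrableOn (fun x => (g b - g a) * (x - T μ ν x)) (Ioi b) ν :=
      (if1.const_mul _).integrableOn
    have ig' : IntegrableOn (fun x => g x * (x - T μ ν x) - g a * (x - T μ ν x)) (Ioc a b) ν :=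
      Integrable.sub ig ia
    have isum : Integrable (fun x =>
        (Ioc a b).indicator (fun x => g x * (x - T μ ν x) - g a * (x - T μ ν x)) x +
        (Ioi b).indicator (fun x => (g b - g a) * (x - T μ ν x)) x) ν :=
      (ig'.integrable_indicator measurableSet_Ioc).add (ib.integrable_indicator measurableSet_Ioi)
    rw [e, integral_add (if1.const_mul _) isum, integral_add
      (ig'.integrable_indicator measurableSet_Ioc) (ib.integrable_indicator measurableSet_Ioi),
      integral_indicator measurableSet_Ioc, integral_indicator measurableSet_Ioi,
      integral_sub ig ia, integral_const_mul, integral_const_mul, integral_const_mul, hz, hb, hI]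
      at h
    simp only [mul_zero, sub_zero, zero_add, add_zero] at h
    refine le_of_le_of_eq h ?_
    refine integral_congr_ae ?_
    filter_upwards [ae_restrict_of_ae (ae_J ν hle)] with x hx
    rw [← hgeq hx]
  have lim : Tendsto (fun M => ∫ x in Ioc a b, cl M (T μ ν x) * (x - T μ ν x) ∂ν) atTop
      (𝓝 (∫ x in Ioc a b, T μ ν x * (x - T μ ν x) ∂ν)) := by
    refine tendsto_integral_of_dominated_convergence
      (fun x => (|a| + |b|) * |x - T μ ν x| + (x - T μ ν x) ^ 2) ?_ ?_ ?_ ?_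
    · intro M
      have : Measurable (cl M) := (clm M).measurable
      fun_prop
    · exact ((if1.abs.const_mul _).add if2).integrableOn
    · intro M
      filter_upwards [ae_restrict_mem measurableSet_Ioc] with x hx
      rw [norm_mul, Real.norm_eq_abs, Real.norm_eq_abs]
      have h1 := clle M (T μ ν x)
      have h2 : |T μ ν x| ≤ |a| + |b| + |x - T μ ν x| := by
        have h3 : |x| ≤ |a| + |b| := by
          refine (abs_le_max_abs_abs hx.1.le hx.2).trans ?_
          exact max_le (by linarith [abs_nonneg b]) (by linarith [abs_nonneg a])
        have h4 : |T μ ν x| ≤ |x| + |x - T μ ν x| := by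
          have := abs_sub x (x - T μ ν x)
          rwa [sub_sub_cancel] at this
        linarith
      rw [← sq_abs (x - T μ ν x)]
      nlinarith [abs_nonneg (x - T μ ν x)]
    · refine ae_of_all _ fun x => ?_
      refine tendsto_const_nhds.congr' ?_
      obtain ⟨N, hN⟩ := exists_nat_ge |T μ ν x|
      filter_upwards [eventually_ge_atTop N] with M hM
      have hM' : |T μ ν x| ≤ M := hN.trans (by exact_mod_cast hM)
      obtain ⟨h1, h2⟩ := abs_le.1 hM'
      simp only [cl]
      rw [min_eq_left h2, max_eq_right h1]
  exact ge_of_tendsto' lim step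

lemma local_bound (hle : ν ≤ volume)
    (hproj : ∀ σ ∈ densLEone, W2sq μ ν ≤ W2sq μ σ)
    {a b : ℝ} (hab : a < b) (hb : ∫ x in Ioi b, (x - T μ ν x) ∂ν = 0)
    (hI : ∫ x in Ioc a b, (x - T μ ν x) ∂ν = 0) :
    ∫ x in Ioc a b, (x - T μ ν x) ^ 2 ∂ν ≤ ∫ x in Ioc a b, (x - (a + b) / 2) ^ 2 ∂ν := by
  have mT := T_meas μ ν
  have hf := memLp_f μ ν hle hproj
  have if1 : Integrable (fun x => x - T μ ν x) ν := hf.integrable one_le_two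
  have if2 := hf.integrable_sq
  have h := Tf_nonneg μ ν hle hproj hab hb hI
  set m := (a + b) / 2 with hm
  have ix : IntegrableOn (fun x => (x - m) ^ 2) (Ioc a b) ν :=
    ((by fun_prop : Continuous fun x : ℝ => (x - m) ^ 2).integrableOn_Icc).mono_set
      Ioc_subset_Icc_self
  have iTf : IntegrableOn (fun x => T μ ν x * (x - T μ ν x)) (Ioc a b) ν := by
    have hx : MemLp (fun x : ℝ => x) 2 (ν.restrict (Ioc a b)) := by
      refine MemLp.of_bound (by fun_prop) (max |a| |b|) ?_
      filter_upwards [ae_restrict_mem measurableSet_Ioc] with x hx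
      exact abs_le_max_abs_abs hx.1.le hx.2
    have := (hx.sub (hf.restrict _)).integrable_mul (hf.restrict (Ioc a b))
    refine this.congr (ae_of_all _ fun x => ?_)
    simp
  have e : ∫ x in Ioc a b, ((x - T μ ν x) ^ 2 + (2 * (T μ ν x * (x - T μ ν x)) -
      (2 * m) * (x - T μ ν x))) ∂ν ≤ ∫ x in Ioc a b, (x - m) ^ 2 ∂ν := by
    refine integral_mono (if2.integrableOn.add ((iTf.const_mul _).sub
      (if1.integrableOn.const_mul _))) ix fun x => ?_
    have := sq_nonneg (T μ ν x - m)
    simp only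
    nlinarith
  have isum : IntegrableOn (fun x => 2 * (T μ ν x * (x - T μ ν x)) -
      (2 * m) * (x - T μ ν x)) (Ioc a b) ν :=
    Integrable.sub (iTf.const_mul _) (if1.integrableOn.const_mul _)
  rw [integral_add if2.integrableOn isum,
    integral_sub (iTf.const_mul _) (if1.integrableOn.const_mul _), integral_const_mul,
    integral_const_mul, hI] at e
  linarith

end

lemma int_mid {a b : ℝ} (hab : a ≤ b) :
    ∫⁻ x in Ioo a b, ENNReal.ofReal ((x - (a + b) / 2) ^ 2) =
      ENNReal.ofReal ((b - a) ^ 3 / 12) := by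
  have ic : IntegrableOn (fun x : ℝ => (x - (a + b) / 2) ^ 2) (Ioo a b) volume :=
    ((by fun_prop : Continuous fun x : ℝ => (x - (a + b) / 2) ^ 2).integrableOn_Icc).mono_set
      Ioo_subset_Icc_self
  rw [← ofReal_integral_eq_lintegral_ofReal ic (ae_of_all _ fun x => sq_nonneg _),
    ← integral_Ioc_eq_integral_Ioo, ← intervalIntegral.integral_of_le hab]
  congr 1
  rw [intervalIntegral.integral_comp_sub_right (fun x => x ^ 2), integral_pow]
  norm_num
  ring

section
variable (ν : Measure ℝ) [IsProbabilityMeasure ν] (a b : ℕ → ℝ)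

lemma endpt (hdisj : Pairwise (Function.onFun Disjoint fun n => Set.Ioo (a n) (b n)))
    {n : ℕ} (hn : a n < b n) :
    a n ∉ (⋃ n, Ioo (a n) (b n)) ∧ b n ∉ (⋃ n, Ioo (a n) (b n)) := by
  constructor
  · intro h
    obtain ⟨k, hk⟩ := mem_iUnion.1 h
    have hkn : k ≠ n := by rintro rfl; exact lt_irrefl _ hk.1
    obtain ⟨z, hz1, hz2⟩ := exists_between (lt_min hn hk.2)
    have := (hdisj hkn).le_bot (show z ∈ _ from
      ⟨⟨hk.1.trans hz1, hz2.trans_le (min_le_right _ _)⟩, ⟨hz1, hz2.trans_le (min_le_left _ _)⟩⟩)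
    exact this
  · intro h
    obtain ⟨k, hk⟩ := mem_iUnion.1 h
    have hkn : k ≠ n := by rintro rfl; exact lt_irrefl _ hk.2
    obtain ⟨z, hz1, hz2⟩ := exists_between (max_lt hn hk.1)
    have := (hdisj hkn).le_bot (show z ∈ _ from
      ⟨⟨(le_max_right _ _).trans_lt hz1, hz2.trans hk.2⟩, ⟨(le_max_left _ _).trans_lt hz1, hz2⟩⟩)
    exact this

lemma summ (hab : ∀ n, a n ≤ b n)
    (hdisj : Pairwise (Function.onFun Disjoint fun n => Set.Ioo (a n) (b n)))
    (hsat : ∀ n, ν.restrict (Set.Ioo (a n) (b n)) = volume.restrict (Set.Ioo (a n) (b n)))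
    : Summable (fun n => (b n - a n) ^ 3) := by
  have h0 : ∀ n, ν (Ioo (a n) (b n)) = ENNReal.ofReal (b n - a n) := fun n => by
    have := congrArg (fun m => m univ) (hsat n)
    simpa using this
  have h1 : ∑' n, ENNReal.ofReal (b n - a n) ≠ ⊤ := by
    simp_rw [← h0]
    rw [← measure_iUnion hdisj fun n => measurableSet_Ioo]
    exact measure_ne_top _ _
  have h2 : Summable fun n => (b n - a n) := by
    have := ENNReal.summable_toReal h1
    refine this.congr fun n => ENNReal.toReal_ofReal (by linarith [hab n])
  refine h2.of_nonneg_of_le (fun n => pow_nonneg (by linarith [hab n]) 3) fun n => ?_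
  have h3 : b n - a n ≤ 1 := by
    have : ν (Ioo (a n) (b n)) ≤ 1 := prob_le_one
    rw [h0] at this
    exact ENNReal.ofReal_le_one.1 this
  exact pow_le_of_le_one (by linarith [hab n]) h3 (by norm_num)

lemma tsum_eq (hab : ∀ n, a n ≤ b n)
    (hdisj : Pairwise (Function.onFun Disjoint fun n => Set.Ioo (a n) (b n)))
    (hsat : ∀ n, ν.restrict (Set.Ioo (a n) (b n)) = volume.restrict (Set.Ioo (a n) (b n)))
    : ∑' n, ENNReal.ofReal ((b n - a n) ^ 3 / 12) =
    ENNReal.ofReal ((∑' n, (b n - a n) ^ 3) / 12) := by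
  rw [← tsum_div_const, ENNReal.ofReal_tsum_of_nonneg
    (fun n => div_nonneg (pow_nonneg (by linarith [hab n]) 3) (by norm_num))
    ((summ ν a b hab hdisj hsat).div_const _)]

end

lemma part1 (ν : Measure ℝ) (hν : ν ∈ densLEone)
    (a b : ℕ → ℝ) (hab : ∀ n, a n ≤ b n)
    (hdisj : Pairwise (Function.onFun Disjoint fun n => Set.Ioo (a n) (b n)))
    (hsat : ∀ n, ν.restrict (Set.Ioo (a n) (b n)) = volume.restrict (Set.Ioo (a n) (b n)))
    (hmax : ∀ c d : ℝ, c < d →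
      ν.restrict (Set.Ioo c d) = volume.restrict (Set.Ioo c d) →
      ∃ n, Set.Ioo c d ⊆ Set.Ioo (a n) (b n))
    (μ : Measure ℝ) (hμ : IsProbabilityMeasure μ)
    (hproj : ∀ σ ∈ densLEone, W2sq μ ν ≤ W2sq μ σ) :
    W2sq μ ν ≤ ENNReal.ofReal ((∑' n, (b n - a n) ^ 3) / 12) := by
  obtain ⟨hp, hle⟩ := hν
  have : NullSingletonClass ν := ⟨fun x => le_antisymm ((hle {x}).trans (by simp)) zero_le⟩
  have mT := T_meas μ ν
  have hf := memLp_f μ ν hle hproj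
  have if1 : Integrable (fun x => x - T μ ν x) ν := hf.integrable one_le_two
  have if2 := hf.integrable_sq
  set ω := ⋃ n, Ioo (a n) (b n) with hω
  have mω : MeasurableSet ω := MeasurableSet.iUnion fun n => measurableSet_Ioo
  have hW : W2sq μ ν ≤ ∫⁻ x, ENNReal.ofReal ((x - T μ ν x) ^ 2) ∂ν := by
    have := W_le μ ν hle (fun x => x) measurable_id
    rwa [show ν.map (fun x => x) = ν from Measure.map_id] at this
  have tail : ∀ s, s ∉ ω → ∫ x in Ioi s, (x - T μ ν x) ∂ν = 0 := by
    intro s hs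
    refine tail_zero μ ν hle hproj s ?_
    intro l u hl hu heq
    apply hs
    have hr : ν.restrict (Ioo l u) = volume.restrict (Ioo l u) := by
      refine Measure.eq_of_le_of_measure_univ_eq (Measure.restrict_mono le_rfl hle) ?_
      rw [Measure.restrict_apply_univ, Measure.restrict_apply_univ, Real.volume_Ioo,
        measure_congr Ioo_ae_eq_Ioc, heq]
      conv_lhs => rw [← measure_cdf ν]
      rw [StieltjesFunction.measure_Ioc]
    obtain ⟨n, hn⟩ := hmax l u (hl.trans hu) hr
    exact mem_iUnion.2 ⟨n, hn ⟨hl, hu⟩⟩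
  have hIoc : ∀ n, a n < b n → ∫ x in Ioc (a n) (b n), (x - T μ ν x) ∂ν = 0 := by
    intro n hn
    obtain ⟨h1, h2⟩ := endpt a b hdisj hn
    have h3 := tail _ h1
    rw [← Ioc_union_Ioi_eq_Ioi hn.le, setIntegral_union Ioc_disjoint_Ioi_same measurableSet_Ioi
      if1.integrableOn if1.integrableOn, tail _ h2, add_zero] at h3
    exact h3
  have hIoo : ∀ n, ∫ x in Ioo (a n) (b n), (x - T μ ν x) ∂ν = 0 := by
    intro n
    rcases (hab n).lt_or_eq with h | h
    · rw [← integral_Ioc_eq_integral_Ioo]; exact hIoc n h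
    · simp [h]
  have hloc : ∀ n, ∫⁻ x in Ioo (a n) (b n), ENNReal.ofReal ((x - T μ ν x) ^ 2) ∂ν ≤
      ENNReal.ofReal ((b n - a n) ^ 3 / 12) := by
    intro n
    rcases (hab n).lt_or_eq with h | h
    · have h1 := local_bound μ ν hle hproj h (tail _ (endpt a b hdisj h).2) (hIoc n h)
      rw [integral_Ioc_eq_integral_Ioo, integral_Ioc_eq_integral_Ioo] at h1
      rw [← int_mid h.le, ← hsat n]
      have ic : IntegrableOn (fun x : ℝ => (x - (a n + b n) / 2) ^ 2) (Ioo (a n) (b n)) ν :=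
        ((by fun_prop : Continuous fun x : ℝ =>
          (x - (a n + b n) / 2) ^ 2).integrableOn_Icc).mono_set Ioo_subset_Icc_self
      rw [← ofReal_integral_eq_lintegral_ofReal ic (ae_of_all _ fun x => sq_nonneg _),
        ← ofReal_integral_eq_lintegral_ofReal if2.integrableOn (ae_of_all _ fun x => sq_nonneg _)]
      exact ENNReal.ofReal_le_ofReal h1
    · simp [h]
  -- integral over pieces of the saturated zone
  have hpiece : ∀ s, s ∉ ω → ∫ x in Ioi s ∩ ω, (x - T μ ν x) ∂ν = 0 := by
    intro s hs
    rw [hω, inter_iUnion, integral_iUnion (fun n => measurableSet_Ioi.inter measurableSet_Ioo)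
      (fun i j hij => (hdisj hij).mono inter_subset_right inter_subset_right) if1.integrableOn]
    refine (tsum_congr fun n => ?_).trans tsum_zero
    have hsn : s ∉ Ioo (a n) (b n) := fun h => hs (mem_iUnion.2 ⟨n, h⟩)
    rcases le_or_gt s (a n) with h | h
    · have hsub : Ioo (a n) (b n) ⊆ Ioi s := fun x hx => lt_of_le_of_lt h hx.1
      rw [inter_eq_right.2 hsub]
      exact hIoo n
    · have h2 : b n ≤ s := by
        by_contra hc; exact hsn ⟨h, not_le.1 hc⟩
      have : Ioi s ∩ Ioo (a n) (b n) = ∅ := by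
        ext x; simp only [mem_inter_iff, mem_Ioi, mem_Ioo, mem_empty_iff_false, iff_false]
        rintro ⟨h3, _, h4⟩; linarith
      simp [this]
  have hc0 : ∀ s, s ∉ ω → ∫ x in Ioi s ∩ ωᶜ, (x - T μ ν x) ∂ν = 0 := by
    intro s hs
    have h := integral_inter_add_sdiff (s := Ioi s) mω if1.integrableOn
    rw [hpiece s hs, tail s hs, zero_add] at h
    rwa [Set.sdiff_eq] at h
  have hc1 : ∀ s, ∫ x in Ioi s ∩ ωᶜ, (x - T μ ν x) ∂ν = 0 := by
    intro s
    by_cases hs : s ∈ ω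
    · obtain ⟨n, hn⟩ := mem_iUnion.1 hs
      have hlt := hn.1.trans hn.2
      have : Ioi s ∩ ωᶜ = Ioi (a n) ∩ ωᶜ := by
        ext x
        constructor
        · rintro ⟨h1, h2⟩; exact ⟨hn.1.trans h1, h2⟩
        · rintro ⟨h1, h2⟩
          refine ⟨?_, h2⟩
          by_contra hc
          exact h2 (mem_iUnion.2 ⟨n, h1, lt_of_le_of_lt (not_lt.1 hc) hn.2⟩)
      rw [this]
      exact hc0 _ (endpt a b hdisj hlt).1
    · exact hc0 s hs
  have hcu : ∫ x in ωᶜ, (x - T μ ν x) ∂ν = 0 := by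
    have h := integral_add_compl mω if1
    rw [int_zero μ ν hle hproj, hω, integral_iUnion (fun n => measurableSet_Ioo) hdisj
      if1.integrableOn] at h
    rwa [(tsum_congr hIoo).trans tsum_zero, zero_add] at h
  have hae : (fun x => x - T μ ν x) =ᵐ[ν.restrict ωᶜ] 0 := by
    have if1' := if1.restrict (s := ωᶜ)
    refine if1'.ae_eq_zero_of_forall_setIntegral_eq_zero ?_
    intro t ht _
    induction t, ht using MeasurableSpace.induction_on_inter
      (borel_eq_generateFrom_Ioi ℝ ▸ BorelSpace.measurable_eq (α := ℝ)) isPiSystem_Ioi with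
    | empty => simp
    | basic t ht =>
      obtain ⟨s, rfl⟩ := ht
      rw [Measure.restrict_restrict measurableSet_Ioi]; exact hc1 s
    | compl t ht ih =>
      have h := integral_add_compl ht if1'
      rw [ih (measure_lt_top _ _), hcu, zero_add] at h
      exact h
    | iUnion g hg mg ih =>
      rw [integral_iUnion mg hg if1'.integrableOn]
      exact (tsum_congr fun n => ih n (measure_lt_top _ _)).trans tsum_zero
  refine hW.trans ?_
  rw [← lintegral_add_compl _ mω, hω, lintegral_iUnion (fun n => measurableSet_Ioo) hdisj]
  have hz : ∫⁻ x in ωᶜ, ENNReal.ofReal ((x - T μ ν x) ^ 2) ∂ν = 0 := by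
    rw [lintegral_congr_ae (g := fun _ => 0), lintegral_zero]
    filter_upwards [hae] with x hx
    rw [hx]; simp
  rw [hz, add_zero, ← tsum_eq ν a b hab hdisj hsat]
  exact ENNReal.tsum_le_tsum hloc

lemma int_cap (m r : ℝ) (hr : 0 ≤ r) :
    ∫⁻ x, ENNReal.ofReal (r ^ 2 - (x - m) ^ 2) = ENNReal.ofReal (4 * r ^ 3 / 3) := by
  have h1 : ∫⁻ x, ENNReal.ofReal (r ^ 2 - (x - m) ^ 2) =
      ∫⁻ x in Ioc (m - r) (m + r), ENNReal.ofReal (r ^ 2 - (x - m) ^ 2) := by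
    rw [← lintegral_indicator measurableSet_Ioc]
    refine lintegral_congr fun x => ?_
    by_cases h : x ∈ Ioc (m - r) (m + r)
    · simp [h]
    · rw [indicator_of_notMem h, ENNReal.ofReal_of_nonpos]
      rw [mem_Ioc, not_and_or, not_lt, not_le] at h
      rcases h with h | h <;> nlinarith
  have hc : Continuous fun x : ℝ => r ^ 2 - (x - m) ^ 2 := by fun_prop
  have ic : IntegrableOn (fun x : ℝ => r ^ 2 - (x - m) ^ 2) (Ioc (m - r) (m + r)) volume :=
    hc.integrableOn_Icc.mono_set Ioc_subset_Icc_self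
  rw [h1, ← ofReal_integral_eq_lintegral_ofReal ic, ← intervalIntegral.integral_of_le (by linarith)]
  · congr 1
    rw [intervalIntegral.integral_comp_sub_right (fun x => r ^ 2 - x ^ 2),
      intervalIntegral.integral_sub (by simp) (Continuous.intervalIntegrable (by fun_prop) _ _),
      integral_pow]
    simp
    ring
  · filter_upwards [ae_restrict_mem measurableSet_Ioc] with x hx
    obtain ⟨h1, h2⟩ := hx
    show 0 ≤ _
    nlinarith

lemma bathtub (τ : Measure ℝ) (hτ : τ ≤ volume) (m α : ℝ) (hα : 0 ≤ α)
    (h : ENNReal.ofReal α ≤ τ univ) :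
    ENNReal.ofReal (α ^ 3 / 12) ≤ ∫⁻ x, ENNReal.ofReal ((m - x) ^ 2) ∂τ := by
  have h1 : ENNReal.ofReal ((α / 2) ^ 2) * τ univ ≤
      ∫⁻ x, ENNReal.ofReal ((m - x) ^ 2) ∂τ +
      ∫⁻ x, ENNReal.ofReal ((α / 2) ^ 2 - (x - m) ^ 2) ∂τ := by
    rw [← lintegral_add_left (by fun_prop), ← lintegral_const]
    refine lintegral_mono fun x => ?_
    refine le_trans (ENNReal.ofReal_le_ofReal ?_) ENNReal.ofReal_add_le
    linarith
  have h2 : ∫⁻ x, ENNReal.ofReal ((α / 2) ^ 2 - (x - m) ^ 2) ∂τ ≤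
      ENNReal.ofReal (4 * (α / 2) ^ 3 / 3) := by
    rw [← int_cap m (α / 2) (by linarith)]
    exact lintegral_mono' hτ le_rfl
  have h3 : ENNReal.ofReal (α ^ 3 / 12) + ENNReal.ofReal (4 * (α / 2) ^ 3 / 3) ≤
      ∫⁻ x, ENNReal.ofReal ((m - x) ^ 2) ∂τ + ENNReal.ofReal (4 * (α / 2) ^ 3 / 3) := by
    refine le_trans ?_ (h1.trans (add_le_add le_rfl h2))
    rw [← ENNReal.ofReal_add (by positivity) (by positivity)]
    refine le_trans ?_ (mul_le_mul_right h _)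
    rw [← ENNReal.ofReal_mul (by positivity)]
    refine ENNReal.ofReal_le_ofReal (le_of_eq ?_)
    ring
  exact (ENNReal.add_le_add_iff_right ENNReal.ofReal_ne_top).1 h3

lemma lower (a b : ℕ → ℝ) (hab : ∀ n, a n ≤ b n)
    (hdisj : Pairwise (Function.onFun Disjoint fun n => Set.Ioo (a n) (b n)))
    (σ : Measure ℝ) (hσ : σ ∈ densLEone) :
    ∑' n, ENNReal.ofReal ((b n - a n) ^ 3 / 12) ≤ W2sq (Measure.sum fun n =>
          ENNReal.ofReal (b n - a n) • Measure.dirac ((a n + b n) / 2)) σ := by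
  refine le_sInf ?_
  rintro c ⟨γ, g1, g2, rfl⟩
  let E : ℕ → Set (ℝ × ℝ) := fun n => {p | a n < b n ∧ p.1 = (a n + b n) / 2}
  have mE : ∀ n, MeasurableSet (E n) := fun n => by
    have : E n = {p | a n < b n} ∩ Prod.fst ⁻¹' {(a n + b n) / 2} := by ext p; simp [E]
    rw [this]
    exact (MeasurableSet.const _).inter (measurable_fst (measurableSet_singleton _))
  have dE : Pairwise (Function.onFun Disjoint E) := by
    intro i j hij
    refine Set.disjoint_left.2 ?_
    rintro p ⟨h1, h2⟩ ⟨h3, h4⟩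
    have hd : ∀ z, z ∈ Ioo (a i) (b i) → z ∉ Ioo (a j) (b j) :=
      fun z hz => Set.disjoint_left.1 (hdisj hij) hz
    refine hd p.1 ?_ ?_
    · rw [h2]; constructor <;> linarith
    · rw [h4]; constructor <;> linarith
  refine le_trans ?_ (setLIntegral_le_lintegral (⋃ n, E n) _)
  rw [lintegral_iUnion mE dE]
  refine ENNReal.tsum_le_tsum fun n => ?_
  rcases (hab n).lt_or_eq with h | h
  · have e : E n = Prod.fst ⁻¹' {(a n + b n) / 2} := by ext p; simp [E, h]
    have hτ : (γ.restrict (E n)).map Prod.snd ≤ volume :=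
      (Measure.map_mono Measure.restrict_le_self measurable_snd).trans (g2.le.trans hσ.2)
    have := bathtub _ hτ ((a n + b n) / 2) (b n - a n) (by linarith) (by
      rw [Measure.map_apply measurable_snd MeasurableSet.univ, preimage_univ,
        Measure.restrict_apply_univ, e, ← Measure.map_apply measurable_fst
        (measurableSet_singleton _), g1]
      refine le_trans ?_ (Measure.le_sum (fun n =>
          ENNReal.ofReal (b n - a n) • Measure.dirac ((a n + b n) / 2)) n _)
      simp)
    refine this.trans ?_
    rw [lintegral_map (by fun_prop) measurable_snd]
    refine le_of_eq (setLIntegral_congr_fun (mE n) ?_)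
    intro p hp
    have : p.1 = (a n + b n) / 2 := hp.2
    simp only [Real.dist_eq, sq_abs, this]
  · simp [h]

lemma upper (ν : Measure ℝ) (a b : ℕ → ℝ) (hab : ∀ n, a n ≤ b n)
    (hdisj : Pairwise (Function.onFun Disjoint fun n => Set.Ioo (a n) (b n)))
    (hsat : ∀ n, ν.restrict (Set.Ioo (a n) (b n)) = volume.restrict (Set.Ioo (a n) (b n)))
    (h0 : ν ((⋃ n, Set.Ioo (a n) (b n))ᶜ) = 0) :
    W2sq (Measure.sum fun n =>
          ENNReal.ofReal (b n - a n) • Measure.dirac ((a n + b n) / 2)) ν ≤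
    ∑' n, ENNReal.ofReal ((b n - a n) ^ 3 / 12) := by
  have mp : ∀ n, Measurable fun x : ℝ => ((a n + b n) / 2, x) := fun n => by fun_prop
  refine sInf_le ⟨Measure.sum fun n => (volume.restrict (Ioo (a n) (b n))).map
    fun x => ((a n + b n) / 2, x), ?_, ?_, ?_⟩
  · rw [Measure.map_sum measurable_fst.aemeasurable]
    congr 1; ext1 n
    rw [Measure.map_map measurable_fst (mp n)]
    show Measure.map (fun _ => (a n + b n) / 2) _ = _
    rw [Measure.map_const]; simp
  · rw [Measure.map_sum measurable_snd.aemeasurable]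
    have : ∀ n, Measure.map Prod.snd ((volume.restrict (Ioo (a n) (b n))).map
        fun x => ((a n + b n) / 2, x)) = ν.restrict (Ioo (a n) (b n)) := fun n => by
      rw [Measure.map_map measurable_snd (mp n), hsat]
      exact Measure.map_id
    simp_rw [this]
    rw [← Measure.restrict_iUnion hdisj fun n => measurableSet_Ioo]
    exact Measure.restrict_eq_self_of_ae_mem (by rw [ae_iff]; exact h0)
  · rw [lintegral_sum_measure]
    refine tsum_congr fun n => ?_
    rw [lintegral_map (by fun_prop) (mp n), ← int_mid (hab n)]
    refine lintegral_congr fun x => ?_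
    rw [Real.dist_eq, sq_abs]; congr 1; ring

end PD

/-- Any measure `μ` projecting (in `W₂`) onto a density `ν` whose saturated zone is
the disjoint union of the maximal intervals `(aₙ, bₙ)` satisfies
`W₂(μ,ν)² ≤ (1/12) Σ (bₙ - aₙ)³`, with equality for the corresponding combination of
Dirac masses at the midpoints (when the mass outside the saturated zone vanishes). -/
theorem projection_distance_bound (ν : Measure ℝ) (hν : ν ∈ densLEone)
    (a b : ℕ → ℝ) (hab : ∀ n, a n ≤ b n)
    (hdisj : Pairwise (Function.onFun Disjoint fun n => Set.Ioo (a n) (b n)))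
    (hsat : ∀ n, ν.restrict (Set.Ioo (a n) (b n)) = volume.restrict (Set.Ioo (a n) (b n)))
    (hmax : ∀ c d : ℝ, c < d →
      ν.restrict (Set.Ioo c d) = volume.restrict (Set.Ioo c d) →
      ∃ n, Set.Ioo c d ⊆ Set.Ioo (a n) (b n)) :
    (∀ μ : Measure ℝ, IsProbabilityMeasure μ →
      (∀ σ ∈ densLEone, W2sq μ ν ≤ W2sq μ σ) →
      W2sq μ ν ≤ ENNReal.ofReal ((∑' n, (b n - a n) ^ 3) / 12)) ∧
    (ν ((⋃ n, Set.Ioo (a n) (b n))ᶜ) = 0 →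
      (∀ σ ∈ densLEone,
        W2sq (Measure.sum fun n =>
          ENNReal.ofReal (b n - a n) • Measure.dirac ((a n + b n) / 2)) ν ≤
        W2sq (Measure.sum fun n =>
          ENNReal.ofReal (b n - a n) • Measure.dirac ((a n + b n) / 2)) σ) ∧
      W2sq (Measure.sum fun n =>
          ENNReal.ofReal (b n - a n) • Measure.dirac ((a n + b n) / 2)) ν =
        ENNReal.ofReal ((∑' n, (b n - a n) ^ 3) / 12)) := by

  refine ⟨fun μ hμ hproj => PD.part1 ν hν a b hab hdisj hsat hmax μ hμ hproj, fun h0 => ?_⟩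
  have hp : IsProbabilityMeasure ν := hν.1
  have hu := PD.upper ν a b hab hdisj hsat h0
  refine ⟨fun σ hσ => hu.trans (PD.lower a b hab hdisj σ hσ), ?_⟩
  rw [← PD.tsum_eq ν a b hab hdisj hsat]
  exact le_antisymm hu (PD.lower a b hab hdisj ν hν)
end
end

section
/- Let Ω ⊆ ℝ^d be compact convex and let ρ_k → ρ weakly in 𝒫(Ω). Then the Wasserstein projections converge: P_K(ρ_k) → P_K(ρ) weakly, where K = {μ ∈ 𝒫(Ω) : dμ/dLeb ≤ 1} and P_K is the (unique) W₂-projection onto K. In particular P_K : (𝒫(Ω), W₂) → (𝒫(Ω), W₂) is continuous. -/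
noncomputable section
open MeasureTheory Filter

/-- Transport cost of a plan. -/
def tcost {E : Type*} [MeasurableSpace E] [PseudoMetricSpace E] (γ : Measure (E × E)) : ENNReal :=
  ∫⁻ p, ENNReal.ofReal (dist p.1 p.2 ^ 2) ∂γ

lemma meas_smul_mono {X : Type*} [MeasurableSpace X] {a b : Measure X} (h : a ≤ b) (c : ENNReal) :
    c • a ≤ c • b := by gcongr

/-- One-step optimality: moving mass to available room cannot decrease the cost. -/
lemma perturb {d : ℕ} {Ω : Set (EuclideanSpace ℝ (Fin d))} (hcomp : IsCompact Ω)
    (ρ σ : Measure (EuclideanSpace ℝ (Fin d)))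
    (γ : Measure (EuclideanSpace ℝ (Fin d) × EuclideanSpace ℝ (Fin d)))
    [IsProbabilityMeasure ρ] (h1 : γ.map Prod.fst = ρ) (h2 : γ.map Prod.snd = σ)
    (hσ : σ ≤ volume.restrict Ω) (hfin : tcost γ ≠ ⊤)
    (hmin : ∀ γ' : Measure (EuclideanSpace ℝ (Fin d) × EuclideanSpace ℝ (Fin d)),
      γ'.map Prod.fst = ρ → γ'.map Prod.snd ∈ densK Ω → tcost γ ≤ tcost γ') :
    ∀ᵐ p ∂γ, (volume.restrict Ω - σ) (Metric.ball p.1 (dist p.1 p.2)) = 0 := by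
  have hγp : IsProbabilityMeasure γ := by
    constructor
    have : ρ Set.univ = 1 := measure_univ
    rwa [← h1, Measure.map_apply measurable_fst MeasurableSet.univ, Set.preimage_univ] at this
  have hσp : IsProbabilityMeasure σ := by
    rw [← h2]; exact Measure.isProbabilityMeasure_map measurable_snd.aemeasurable
  have : IsFiniteMeasure (volume.restrict Ω) :=
    ⟨by simpa using hcomp.measure_lt_top⟩
  set τ := volume.restrict Ω - σ with hτ
  have hτσ : τ + σ = volume.restrict Ω := Measure.sub_add_cancel_of_le hσ
  have hτf : IsFiniteMeasure τ := isFiniteMeasure_of_le (volume.restrict Ω) Measure.sub_le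
  set D : Set ((EuclideanSpace ℝ (Fin d) × EuclideanSpace ℝ (Fin d)) × EuclideanSpace ℝ (Fin d)) :=
    {q | dist q.1.1 q.2 < dist q.1.1 q.1.2} with hD
  have hDm : MeasurableSet D := by
    apply IsOpen.measurableSet
    exact isOpen_lt (by fun_prop) (by fun_prop)
  have key : (γ.prod τ) D = 0 := by
    by_contra hne
    set π := (γ.prod τ).restrict D with hπ
    set c : ENNReal := (1 + τ Set.univ)⁻¹ with hc
    have hc0 : c ≠ 0 := ENNReal.inv_ne_zero.2 (by simp)
    have hc1 : c ≤ 1 := ENNReal.inv_le_one.2 (by simp)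
    have hctop : c ≠ ⊤ := ne_top_of_le_ne_top ENNReal.one_ne_top hc1
    have hcτ : c * τ Set.univ ≤ 1 := by
      calc c * τ Set.univ ≤ c * (1 + τ Set.univ) := by gcongr; exact le_add_self
        _ ≤ 1 := ENNReal.inv_mul_le_one _
    have hm13 : Measurable (fun q : (EuclideanSpace ℝ (Fin d) × EuclideanSpace ℝ (Fin d)) × EuclideanSpace ℝ (Fin d) => (q.1.1, q.2)) := by fun_prop
    set A := c • π.map Prod.fst with hA
    set B := c • π.map (fun q => (q.1.1, q.2)) with hB
    have hAγ : A ≤ γ := by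
      calc A ≤ c • (γ.prod τ).map Prod.fst := by
              rw [hA]
              have := Measure.map_mono (Measure.restrict_le_self (μ := γ.prod τ) (s := D)) measurable_fst
              exact meas_smul_mono this c
        _ = (c * τ Set.univ) • γ := by rw [Measure.map_fst_prod, smul_smul]
        _ ≤ (1 : ENNReal) • γ := by gcongr
        _ = γ := one_smul _ _
    have hAf : IsFiniteMeasure A := isFiniteMeasure_of_le γ hAγ
    have hsub : γ - A + A = γ := Measure.sub_add_cancel_of_le hAγ
    have hAB : A.map Prod.fst = B.map Prod.fst := by
      rw [hA, hB, Measure.map_smul, Measure.map_smul, Measure.map_map measurable_fst measurable_fst,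
        Measure.map_map measurable_fst hm13]
      rfl
    have hfst : (γ - A + B).map Prod.fst = ρ := by
      rw [Measure.map_add _ _ measurable_fst, ← hAB, ← Measure.map_add _ _ measurable_fst, hsub, h1]
    have hsnd : (γ - A + B).map Prod.snd ≤ volume.restrict Ω := by
      rw [Measure.map_add _ _ measurable_snd, ← hτσ, add_comm τ σ]
      refine add_le_add ?_ ?_
      · rw [← h2]; exact Measure.map_mono Measure.sub_le measurable_snd
      · rw [hB, Measure.map_smul, Measure.map_map measurable_snd hm13]
        calc c • π.map (Prod.snd ∘ fun q => (q.1.1, q.2)) 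
            ≤ c • (γ.prod τ).map Prod.snd := by
              gcongr
              exact Measure.map_mono Measure.restrict_le_self measurable_snd
          _ = c • τ := by rw [Measure.map_snd_prod]; simp
          _ ≤ (1 : ENNReal) • τ := by gcongr
          _ = τ := one_smul _ _
    have hK : (γ - A + B).map Prod.snd ∈ densK Ω := by
      refine ⟨?_, hsnd.trans Measure.restrict_le_self, ?_⟩
      · have : IsProbabilityMeasure (γ - A + B) := by
          constructor
          have : ρ Set.univ = 1 := measure_univ
          rwa [← hfst, Measure.map_apply measurable_fst MeasurableSet.univ, Set.preimage_univ] at this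
        exact Measure.isProbabilityMeasure_map measurable_snd.aemeasurable
      · refine le_antisymm ((hsnd _).trans ?_) zero_le
        rw [Measure.restrict_apply hcomp.measurableSet.compl]; simp
    have hle := hmin _ hfst hK
    have hadd : ∀ a b : Measure (EuclideanSpace ℝ (Fin d) × EuclideanSpace ℝ (Fin d)),
      tcost (a + b) = tcost a + tcost b := fun a b => by simp [tcost, lintegral_add_measure]
    have hfin' : tcost (γ - A) ≠ ⊤ := by
      refine ne_top_of_le_ne_top hfin ?_
      exact lintegral_mono' Measure.sub_le le_rfl
    have hcm : Measurable (fun p : EuclideanSpace ℝ (Fin d) × EuclideanSpace ℝ (Fin d) => ENNReal.ofReal (dist p.1 p.2 ^ 2)) := by fun_prop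
    have hAle : tcost A ≤ tcost B := by
      have h3 : tcost (γ - A) + tcost A ≤ tcost (γ - A) + tcost B := by
        rw [← hadd, ← hadd, hsub]; exact hle
      exact (ENNReal.add_le_add_iff_left hfin').1 h3
    have hAfin : tcost A ≠ ⊤ := ne_top_of_le_ne_top hfin (lintegral_mono' hAγ le_rfl)
    have eA : tcost A = c * ∫⁻ q, ENNReal.ofReal (dist q.1.1 q.1.2 ^ 2) ∂π := by
      simp only [tcost, hA, lintegral_smul_measure, smul_eq_mul]
      rw [lintegral_map hcm measurable_fst]
    have eB : tcost B = c * ∫⁻ q, ENNReal.ofReal (dist q.1.1 q.2 ^ 2) ∂π := by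
      simp only [tcost, hB, lintegral_smul_measure, smul_eq_mul]
      rw [lintegral_map hcm hm13]
    have hIle : ∫⁻ q, ENNReal.ofReal (dist q.1.1 q.1.2 ^ 2) ∂π ≤ ∫⁻ q, ENNReal.ofReal (dist q.1.1 q.2 ^ 2) ∂π := by
      rw [eA, eB] at hAle
      exact (ENNReal.mul_le_mul_iff_right hc0 hctop).1 hAle
    have hIfin : ∫⁻ q, ENNReal.ofReal (dist q.1.1 q.1.2 ^ 2) ∂π ≠ ⊤ := by
      intro h
      rw [eA, h, ENNReal.mul_top hc0] at hAfin
      exact hAfin rfl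
    have hpt : ∀ᵐ q ∂π, ENNReal.ofReal (dist q.1.1 q.2 ^ 2) < ENNReal.ofReal (dist q.1.1 q.1.2 ^ 2) := by
      refine (ae_restrict_iff' hDm).2 (Eventually.of_forall fun q hq => ?_)
      have hq' : dist q.1.1 q.2 < dist q.1.1 q.1.2 := hq
      have h0 : 0 ≤ dist q.1.1 q.2 := dist_nonneg
      refine (ENNReal.ofReal_lt_ofReal_iff (by nlinarith)).2 (by nlinarith)
    have hπ0 : π ≠ 0 := by
      rw [hπ, Ne, Measure.restrict_eq_zero]; exact hne
    have hIfin2 : ∫⁻ q, ENNReal.ofReal (dist q.1.1 q.2 ^ 2) ∂π ≠ ⊤ :=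
      ne_top_of_le_ne_top hIfin (lintegral_mono_ae (hpt.mono fun _ h => h.le))
    exact absurd hIle (not_le.2 (lintegral_strict_mono hπ0 (by fun_prop) hIfin2 hpt))
  have := (Measure.measure_prod_null hDm).1 key
  filter_upwards [this] with p hp
  have hp' : τ (Prod.mk p ⁻¹' D) = 0 := hp
  convert hp' using 2
  ext x
  simp [hD, dist_comm]

lemma densK_le {d : ℕ} {Ω : Set (EuclideanSpace ℝ (Fin d))} 
    {σ : Measure (EuclideanSpace ℝ (Fin d))} (h : σ ∈ densK Ω) : σ ≤ volume.restrict Ω := by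
  obtain ⟨_, h2, h3⟩ := h
  have : σ.restrict Ω = σ := Measure.restrict_eq_self_of_ae_mem (by rwa [ae_iff])
  rw [← this]
  exact Measure.restrict_mono le_rfl h2

/-- Almost every point of `S` sees positive `S`-mass in every ball touching it. -/
lemma density_ball {d : ℕ} (S : Set (EuclideanSpace ℝ (Fin d))) (hS : MeasurableSet S) :
    ∀ᵐ x ∂(volume : Measure (EuclideanSpace ℝ (Fin d))), x ∈ S → 
      ∀ y, volume (S ∩ Metric.ball y (dist y x)) = 0 → y = x := by
  rw [← ae_restrict_iff' hS]
  filter_upwards [IsUnifLocDoublingMeasure.ae_tendsto_measure_inter_div 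
    (volume : Measure (EuclideanSpace ℝ (Fin d))) S 2] with x hx y hy
  by_contra hne
  have hR : 0 < dist y x := dist_pos.2 hne
  set R := dist y x with hRdef
  have hδ : Tendsto (fun n : ℕ => R / 4 * (1 / ((n : ℝ) + 1))) atTop (nhdsWithin 0 (Set.Ioi 0)) := by
    refine tendsto_nhdsWithin_iff.2 ⟨?_, Eventually.of_forall fun n => ?_⟩
    · simpa using (tendsto_one_div_add_atTop_nhds_zero_nat (𝕜 := ℝ)).const_mul (R / 4)
    · rw [Set.mem_Ioi]
      positivity
  have hδ4 : ∀ n : ℕ, R / 4 * (1 / ((n : ℝ) + 1)) ≤ R / 4 := fun n => by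
    have : (1 / ((n : ℝ) + 1)) ≤ 1 := by
      rw [div_le_one (by positivity)]; linarith [Nat.cast_nonneg (α := ℝ) n]
    nlinarith
  have hδ0 : ∀ n : ℕ, 0 < R / 4 * (1 / ((n : ℝ) + 1)) := fun n => by positivity
  have h := hx (fun n : ℕ => x + ((2 * (R / 4 * (1 / ((n : ℝ) + 1)))) / R) • (y - x))
    (fun n : ℕ => R / 4 * (1 / ((n : ℝ) + 1))) hδ (Eventually.of_forall fun n => ?_)
  · have h0 : ∀ n : ℕ, volume (S ∩ Metric.closedBall 
        (x + ((2 * (R / 4 * (1 / ((n : ℝ) + 1)))) / R) • (y - x)) (R / 4 * (1 / ((n : ℝ) + 1)))) = 0 := by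
      intro n
      refine measure_mono_null (Set.inter_subset_inter_right _ ?_) hy
      have hd4 := hδ4 n
      have hd0 := hδ0 n
      set δ := R / 4 * (1 / ((n : ℝ) + 1))
      intro z hz
      have h1 : dist (x + ((2 * δ) / R) • (y - x)) y = R - 2 * δ := by
        have e : x + ((2 * δ) / R) • (y - x) - y = (-(1 - (2 * δ) / R)) • (y - x) := by module
        have h2 : (2 * δ) / R ≤ 1 := by
          rw [div_le_one hR]; linarith
        rw [dist_eq_norm, e, norm_smul, ← dist_eq_norm, ← hRdef, Real.norm_eq_abs, abs_neg, 
          abs_of_nonneg (by linarith)]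
        field_simp
      have h3 := Metric.mem_closedBall.1 hz
      rw [Metric.mem_ball]
      have := dist_triangle z (x + ((2 * δ) / R) • (y - x)) y
      linarith
    simp only [h0, ENNReal.zero_div] at h
    exact zero_ne_one (tendsto_nhds_unique tendsto_const_nhds h)
  · set δ := R / 4 * (1 / ((n : ℝ) + 1))
    rw [Metric.mem_closedBall, dist_eq_norm]
    have e : x - (x + ((2 * δ) / R) • (y - x)) = (-((2 * δ) / R)) • (y - x) := by module
    have : 0 < δ := hδ0 n
    rw [e, norm_smul, ← dist_eq_norm, ← hRdef, Real.norm_eq_abs, abs_neg, abs_of_nonneg (by positivity)]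
    apply le_of_eq
    field_simp

/-- Uniqueness of the projection. -/
lemma proj_unique {d : ℕ} {Ω : Set (EuclideanSpace ℝ (Fin d))} (hcomp : IsCompact Ω)
    (ρ : Measure (EuclideanSpace ℝ (Fin d))) [IsProbabilityMeasure ρ] 
    (σ : Fin 2 → Measure (EuclideanSpace ℝ (Fin d)))
    (γ : Fin 2 → Measure (EuclideanSpace ℝ (Fin d) × EuclideanSpace ℝ (Fin d)))
    (h1 : ∀ i, (γ i).map Prod.fst = ρ) (h2 : ∀ i, (γ i).map Prod.snd = σ i)
    (hσ : ∀ i, σ i ∈ densK Ω) (W : ENNReal) (hW : W ≠ ⊤) (hγ : ∀ i, tcost (γ i) = W)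
    (hmin : ∀ γ' : Measure (EuclideanSpace ℝ (Fin d) × EuclideanSpace ℝ (Fin d)),
      γ'.map Prod.fst = ρ → γ'.map Prod.snd ∈ densK Ω → W ≤ tcost γ') :
    σ 0 = σ 1 := by
  have hf : IsFiniteMeasure (volume.restrict Ω) :=
    ⟨by simpa using hcomp.measure_lt_top⟩
  have hle : ∀ i, σ i ≤ volume.restrict Ω := fun i => densK_le (hσ i)
  set G := (2⁻¹ : ENNReal) • (γ 0 + γ 1) with hG
  have hhalf : ∀ a : Measure (EuclideanSpace ℝ (Fin d)), (2⁻¹ : ENNReal) • (a + a) = a := fun a => by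
    rw [← two_smul ENNReal a, smul_smul, ENNReal.inv_mul_cancel (by simp) (by simp), one_smul]
  have hG1 : G.map Prod.fst = ρ := by
    rw [hG, Measure.map_smul, Measure.map_add _ _ measurable_fst, h1, h1, hhalf]
  set s := (2⁻¹ : ENNReal) • (σ 0 + σ 1) with hs
  have hG2 : G.map Prod.snd = s := by
    rw [hG, Measure.map_smul, Measure.map_add _ _ measurable_snd, h2, h2]
  have hsle : s ≤ volume.restrict Ω := by
    rw [← hhalf (volume.restrict Ω), hs]
    exact meas_smul_mono (add_le_add (hle 0) (hle 1)) _
  have hGc : tcost G = W := by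
    have : tcost G = 2⁻¹ * (tcost (γ 0) + tcost (γ 1)) := by
      simp [tcost, hG, lintegral_add_measure, mul_add]
    rw [this, hγ, hγ, ← two_mul, ← mul_assoc, ENNReal.inv_mul_cancel (by simp) (by simp), one_mul]
  have hP := perturb hcomp ρ s G hG1 hG2 hsle (by rwa [hGc]) (by rwa [hGc])
  set τ := volume.restrict Ω - s with hτ
  have hsf : IsFiniteMeasure s := isFiniteMeasure_of_le _ hsle
  have hτσ : τ + s = volume.restrict Ω := Measure.sub_add_cancel_of_le hsle
  have hτf : IsFiniteMeasure τ := isFiniteMeasure_of_le (volume.restrict Ω) Measure.sub_le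
  have hτac : τ ≪ volume :=
    (Measure.absolutelyContinuous_of_le (Measure.sub_le.trans Measure.restrict_le_self))
  have hwd : volume.withDensity (τ.rnDeriv volume) = τ := Measure.withDensity_rnDeriv_eq _ _ hτac
  have hmr : Measurable (τ.rnDeriv volume) := Measure.measurable_rnDeriv _ _
  set S := {x | τ.rnDeriv volume x ≠ 0} with hS
  have hSm : MeasurableSet S := hmr (measurableSet_singleton 0).compl
  have hnull : ∀ B, τ B = 0 ↔ volume (S ∩ B) = 0 := by
    intro B
    conv_lhs => rw [← hwd]
    rw [withDensity_apply_eq_zero' hmr.aemeasurable]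
  have hPi : ∀ i, ∀ᵐ p ∂(γ i), τ (Metric.ball p.1 (dist p.1 p.2)) = 0 := by
    rw [hG, Measure.ae_ennreal_smul_measure_iff (by simp), ae_add_measure_iff] at hP
    intro i; fin_cases i
    exacts [hP.1, hP.2]
  have hb : ∀ i, ∀ᵐ p ∂(γ i), p.2 ∈ S → p.1 = p.2 := by
    intro i
    have h3 : ∀ᵐ x ∂(σ i), x ∈ S → ∀ y, volume (S ∩ Metric.ball y (dist y x)) = 0 → y = x :=
      (Measure.absolutelyContinuous_of_le (hσ i).2.1).ae_le (density_ball S hSm)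
    rw [← h2 i] at h3
    filter_upwards [ae_of_ae_map measurable_snd.aemeasurable h3, hPi i] with p hp hq hpS
    exact hp hpS _ ((hnull _).1 hq)
  have ha : ∀ i, ∀ᵐ p ∂(γ i), p.1 ∈ τ.support → p.1 = p.2 := by
    intro i
    filter_upwards [hPi i] with p hp hps
    by_contra hne
    have := (Measure.mem_support_iff_forall p.1).1 hps _ (Metric.ball_mem_nhds p.1 (dist_pos.2 hne))
    exact this.ne' hp
  have hsupm : MeasurableSet τ.support := Measure.isClosed_support.measurableSet
  have hsup0 : volume (S ∩ τ.supportᶜ) = 0 := (hnull _).1 Measure.measure_compl_support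
  -- value on good sets
  have hgood : ∀ i A, MeasurableSet A → A ⊆ S ∩ τ.support → σ i A = ρ A := by
    intro i A hA hAs
    rw [← h2 i, ← h1 i, Measure.map_apply measurable_snd hA, Measure.map_apply measurable_fst hA]
    apply measure_congr
    filter_upwards [ha i, hb i] with p hp hq
    apply propext
    constructor
    · intro h
      have h' : p.2 ∈ A := h
      show p.1 ∈ A
      rw [hq (hAs h').1]; exact h'
    · intro h
      have h' : p.1 ∈ A := h
      show p.2 ∈ A
      rw [← hp (hAs h').2]; exact h'
  have hoff : ∀ i A, MeasurableSet A → A ⊆ Sᶜ → σ i A = volume.restrict Ω A := by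
    have hboth : ∀ A, A ⊆ Sᶜ → σ 0 A + σ 1 A = volume.restrict Ω A + volume.restrict Ω A := by
      intro A hAs
      have h3 : τ A = 0 := by
        rw [hnull]
        have : S ∩ A = ∅ := by
          rw [Set.eq_empty_iff_forall_notMem]; rintro x ⟨hx, hx'⟩; exact hAs hx' hx
        rw [this]; simp
      have h4 : volume.restrict Ω A = 2⁻¹ * (σ 0 A + σ 1 A) := by
        rw [← hτσ, Measure.add_apply, h3, zero_add, hs]; simp [mul_add]
      rw [← two_mul, h4, ← mul_assoc, ENNReal.mul_inv_cancel (by simp) (by simp), one_mul]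
    intro i A _ hAs
    have hb := hboth A hAs
    have hfin : volume.restrict Ω A ≠ ⊤ := measure_ne_top _ _
    have := (hσ 0).1
    have := (hσ 1).1
    fin_cases i
    · refine le_antisymm (hle 0 A) (not_lt.1 fun hlt => ?_)
      exact (ENNReal.add_lt_add_of_lt_of_le (measure_ne_top _ _) hlt (hle 1 A)).ne hb
    · refine le_antisymm (hle 1 A) (not_lt.1 fun hlt => ?_)
      exact (ENNReal.add_lt_add_of_le_of_lt (measure_ne_top _ _) (hle 0 A) hlt).ne hb
  have hval : ∀ i A, MeasurableSet A → σ i A = ρ (A ∩ S ∩ τ.support) + volume.restrict Ω (A \ S) := by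
    intro i A hA
    rw [← measure_inter_add_sdiff A hSm, hoff i _ (hA.diff hSm) (fun x hx => hx.2),
      ← measure_inter_add_sdiff (A ∩ S) hsupm, 
      hgood i _ ((hA.inter hSm).inter hsupm) (fun x hx => ⟨hx.1.2, hx.2⟩)]
    have : σ i ((A ∩ S) \ τ.support) = 0 := 
      Measure.absolutelyContinuous_of_le (hσ i).2.1
        (measure_mono_null (t := S ∩ τ.supportᶜ) (fun x hx => ⟨hx.1.2, hx.2⟩) hsup0)
    rw [this, add_zero]
  exact Measure.ext fun A hA => by rw [hval 0 A hA, hval 1 A hA]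

lemma subseq_of_compact {X : Type*} [MetricSpace X] [MeasurableSpace X] [BorelSpace X]
    [SecondCountableTopology X] {S : Set X} (hS : IsCompact S) (μ : ℕ → ProbabilityMeasure X)
    (h : ∀ k, (μ k : Measure X) Sᶜ = 0) :
    ∃ (m : ProbabilityMeasure X) (φ : ℕ → ℕ), StrictMono φ ∧ Tendsto (μ ∘ φ) atTop (nhds m) := by
  have ht : IsTightMeasureSet {((m : ProbabilityMeasure X) : Measure X) | m ∈ Set.range μ} := by
    rw [isTightMeasureSet_iff_exists_isCompact_measure_compl_le]
    intro ε _
    refine ⟨S, hS, ?_⟩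
    rintro _ ⟨_, ⟨k, rfl⟩, rfl⟩
    rw [h k]; exact zero_le
  have hc := isCompact_closure_of_isTightMeasureSet ht
  obtain ⟨m, _, φ, hφ, hm⟩ := hc.tendsto_subseq (fun k => subset_closure (Set.mem_range_self k))
  exact ⟨m, φ, hφ, hm⟩

lemma prob_of_map_fst {X : Type*} [MeasurableSpace X] {γ : Measure (X × X)} {μ : Measure X}
    (hμ : IsProbabilityMeasure μ) (h : γ.map Prod.fst = μ) : IsProbabilityMeasure γ := by
  constructor
  have : μ Set.univ = 1 := measure_univ
  rwa [← h, Measure.map_apply measurable_fst MeasurableSet.univ, Set.preimage_univ] at this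

lemma plan_supp {X : Type*} [MeasurableSpace X] {γ : Measure (X × X)} {μ ν : Measure X} {S : Set X}
    (h1 : γ.map Prod.fst = μ) (h2 : γ.map Prod.snd = ν) 
    (hμ : μ Sᶜ = 0) (hν : ν Sᶜ = 0) : ∀ᵐ p ∂γ, p.1 ∈ S ∧ p.2 ∈ S := by
  have a : ∀ᵐ x ∂(γ.map Prod.fst), x ∈ S := by rw [h1, ae_iff]; exact hμ
  have b : ∀ᵐ x ∂(γ.map Prod.snd), x ∈ S := by rw [h2, ae_iff]; exact hν
  filter_upwards [ae_of_ae_map measurable_fst.aemeasurable a, 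
    ae_of_ae_map measurable_snd.aemeasurable b] with p h h' using ⟨h, h'⟩

/-- Limits of plans. -/
lemma plan_lim {X : Type*} [MetricSpace X] [MeasurableSpace X] [BorelSpace X]
    [SecondCountableTopology X] {S : Set X} (hS : IsCompact S) 
    (μ ν : ℕ → ProbabilityMeasure X) (μ' ν' : ProbabilityMeasure X)
    (hμ : ∀ k, (μ k : Measure X) Sᶜ = 0) (hν : ∀ k, (ν k : Measure X) Sᶜ = 0)
    (hμl : Tendsto μ atTop (nhds μ')) (hνl : Tendsto ν atTop (nhds ν'))
    (γ : ℕ → Measure (X × X)) (h1 : ∀ k, (γ k).map Prod.fst = μ k) 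
    (h2 : ∀ k, (γ k).map Prod.snd = ν k) (C : ENNReal) 
    (hC : ∀ C' > C, ∀ᶠ k in atTop, tcost (γ k) ≤ C') :
    ∃ g : Measure (X × X), g.map Prod.fst = μ' ∧ g.map Prod.snd = ν' ∧ tcost g ≤ C := by
  have hp : ∀ k, IsProbabilityMeasure (γ k) := fun k => prob_of_map_fst (μ k).2 (h1 k)
  let Γ : ℕ → ProbabilityMeasure (X × X) := fun k => ⟨γ k, hp k⟩
  have hΓ : ∀ k, (Γ k : Measure (X × X)) (S ×ˢ S)ᶜ = 0 := fun k => by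
    have := plan_supp (h1 k) (h2 k) (hμ k) (hν k)
    rw [ae_iff] at this
    exact this
  obtain ⟨g, φ, hφ, hg⟩ := subseq_of_compact (hS.prod hS) Γ hΓ
  refine ⟨g, ?_, ?_, ?_⟩
  · have t1 := ProbabilityMeasure.tendsto_map_of_tendsto_of_continuous _ _ hg 
      (continuous_fst : Continuous (Prod.fst : X × X → X))
    have t2 : Tendsto (fun i => ((Γ ∘ φ) i).map 
      (continuous_fst : Continuous (Prod.fst : X × X → X)).measurable.aemeasurable) atTop (nhds μ') := by
      convert hμl.comp hφ.tendsto_atTop using 2 with k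
      apply Subtype.ext
      exact h1 (φ k)
    have t3 := tendsto_nhds_unique t1 t2
    exact congrArg (fun m : ProbabilityMeasure X => (m : Measure X)) t3
  · have t1 := ProbabilityMeasure.tendsto_map_of_tendsto_of_continuous _ _ hg 
      (continuous_snd : Continuous (Prod.snd : X × X → X))
    have t2 : Tendsto (fun i => ((Γ ∘ φ) i).map 
      (continuous_snd : Continuous (Prod.snd : X × X → X)).measurable.aemeasurable) atTop (nhds ν') := by
      convert hνl.comp hφ.tendsto_atTop using 2 with k
      apply Subtype.ext
      exact h2 (φ k)
    have t3 := tendsto_nhds_unique t1 t2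
    exact congrArg (fun m : ProbabilityMeasure X => (m : Measure X)) t3
  · refine le_of_forall_gt_imp_ge_of_dense fun C' hC' => ?_
    have := lintegral_le_liminf_lintegral_of_forall_isOpen_measure_le_liminf_measure 
      (μ := (g : Measure (X × X))) (μs := fun i => γ (φ i))
      (f := fun p : X × X => dist p.1 p.2 ^ 2) (by fun_prop) (fun p => by positivity)
      (fun G hG => ProbabilityMeasure.le_liminf_measure_open_of_tendsto hg hG)
    refine this.trans ?_
    refine liminf_le_of_frequently_le' (Eventually.frequently ?_)
    exact hφ.tendsto_atTop.eventually (hC C' hC')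

lemma W2sq_le {X : Type*} [MeasurableSpace X] [PseudoMetricSpace X] {μ ν : Measure X} {γ : Measure (X × X)}
    (h1 : γ.map Prod.fst = μ) (h2 : γ.map Prod.snd = ν) : W2sq μ ν ≤ tcost γ :=
  sInf_le ⟨γ, h1, h2, rfl⟩

lemma exists_opt {X : Type*} [MetricSpace X] [MeasurableSpace X] [BorelSpace X]
    [SecondCountableTopology X] {S : Set X} (hS : IsCompact S) (μ ν : Measure X)
    (hμ : IsProbabilityMeasure μ) (hν : IsProbabilityMeasure ν) (hμS : μ Sᶜ = 0) (hνS : ν Sᶜ = 0) :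
    ∃ γ : Measure (X × X), γ.map Prod.fst = μ ∧ γ.map Prod.snd = ν ∧ tcost γ = W2sq μ ν := by
  have hne : { c | ∃ γ : Measure (X × X), γ.map Prod.fst = μ ∧ γ.map Prod.snd = ν ∧
    c = ∫⁻ p, ENNReal.ofReal (dist p.1 p.2 ^ 2) ∂γ }.Nonempty :=
    ⟨_, μ.prod ν, by simp [Measure.map_fst_prod], by simp [Measure.map_snd_prod], rfl⟩
  obtain ⟨u, -, hu, hmem⟩ := exists_seq_tendsto_sInf hne (OrderBot.bddBelow _)
  choose γ h1 h2 h3 using hmem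
  obtain ⟨g, g1, g2, g3⟩ := plan_lim hS (fun _ => ⟨μ, hμ⟩) (fun _ => ⟨ν, hν⟩) ⟨μ, hμ⟩ ⟨ν, hν⟩ 
    (fun _ => hμS) (fun _ => hνS) tendsto_const_nhds tendsto_const_nhds γ h1 h2 (W2sq μ ν) 
    (fun C' hC' => by
      filter_upwards [hu.eventually_lt_const hC'] with k hk
      rw [h3] at hk
      exact hk.le)
  exact ⟨g, g1, g2, le_antisymm g3 (W2sq_le g1 g2)⟩

/-- Gluing. -/
lemma glue {X : Type*} [MetricSpace X] [MeasurableSpace X] [BorelSpace X]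
    [SecondCountableTopology X] [CompleteSpace X] {S : Set X} (hS : IsCompact S) 
    (a b c : Measure X) (η γ : Measure (X × X)) (hb : IsProbabilityMeasure b)
    (haS : a Sᶜ = 0) (hbS : b Sᶜ = 0) (hcS : c Sᶜ = 0)
    (η1 : η.map Prod.fst = a) (η2 : η.map Prod.snd = b) (γ1 : γ.map Prod.fst = b) 
    (γ2 : γ.map Prod.snd = c) : 
    W2sq a c ≤ tcost γ + ENNReal.ofReal (2 * Metric.diam S) * ∫⁻ p, edist p.1 p.2 ∂η := by
  have hγp : IsProbabilityMeasure γ := prob_of_map_fst hb γ1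
  have hηp : IsProbabilityMeasure η := by
    constructor
    have : b Set.univ = 1 := measure_univ
    rwa [← η2, Measure.map_apply measurable_snd MeasurableSet.univ, Set.preimage_univ] at this
  have : Nonempty X := by
    by_contra h
    rw [not_nonempty_iff] at h
    have : b Set.univ = 1 := measure_univ
    rw [Set.eq_empty_of_isEmpty (Set.univ : Set X)] at this
    simp at this
  set κ := γ.condKernel with hκ
  have hdis : b.compProd κ = γ := by
    rw [← γ1]; exact γ.disintegrate _
  set θ : Measure ((X × X) × X) := η.compProd (κ.comap Prod.snd measurable_snd) with hθ
  have hm12 : Measurable (fun q : (X × X) × X => (q.1.2, q.2)) := by fun_prop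
  have hm02 : Measurable (fun q : (X × X) × X => (q.1.1, q.2)) := by fun_prop
  have hθ1 : θ.map Prod.fst = η := by
    have := Measure.fst_compProd η (κ.comap Prod.snd measurable_snd)
    exact this
  have hθ2 : θ.map (fun q => (q.1.2, q.2)) = γ := by
    rw [← hdis]
    ext A hA
    rw [Measure.map_apply hm12 hA, hθ, Measure.compProd_apply (hm12 hA), Measure.compProd_apply hA,
      ← η2, lintegral_map (ProbabilityTheory.Kernel.measurable_kernel_prodMk_left hA) measurable_snd]
    rfl
  have e1 : (θ.map (fun q => (q.1.1, q.2))).map Prod.fst = a := by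
    rw [Measure.map_map measurable_fst hm02, ← η1, ← hθ1, Measure.map_map measurable_fst measurable_fst]
    rfl
  have e2 : (θ.map (fun q => (q.1.1, q.2))).map Prod.snd = c := by
    rw [Measure.map_map measurable_snd hm02, ← γ2, ← hθ2, Measure.map_map measurable_snd hm12]
    rfl
  have s1 := plan_supp η1 η2 haS hbS
  have s2 := plan_supp γ1 γ2 hbS hcS
  rw [← hθ1] at s1
  rw [← hθ2] at s2
  have hcm : Measurable (fun p : X × X => ENNReal.ofReal (dist p.1 p.2 ^ 2)) := by fun_prop
  have hem : Measurable (fun p : X × X => edist p.1 p.2) := by fun_prop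
  calc W2sq a c ≤ tcost (θ.map (fun q => (q.1.1, q.2))) := W2sq_le e1 e2
    _ = ∫⁻ q, ENNReal.ofReal (dist q.1.1 q.2 ^ 2) ∂θ := by
        rw [tcost, lintegral_map hcm hm02]
    _ ≤ ∫⁻ q, (ENNReal.ofReal (dist q.1.2 q.2 ^ 2) + 
          ENNReal.ofReal (2 * Metric.diam S) * edist q.1.1 q.1.2) ∂θ := by
        apply lintegral_mono_ae
        filter_upwards [ae_of_ae_map measurable_fst.aemeasurable s1, 
          ae_of_ae_map hm12.aemeasurable s2] with q hq hq'
        rw [edist_dist, ← ENNReal.ofReal_mul (by have := Metric.diam_nonneg (s := S); positivity), 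
          ← ENNReal.ofReal_add (by positivity) (by have := Metric.diam_nonneg (s := S); positivity)]
        apply ENNReal.ofReal_le_ofReal
        have t := dist_triangle q.1.1 q.1.2 q.2
        have d1 := Metric.dist_le_diam_of_mem hS.isBounded hq.1 hq'.2
        have d2 := Metric.dist_le_diam_of_mem hS.isBounded hq'.1 hq'.2
        have n1 : 0 ≤ dist q.1.1 q.2 := dist_nonneg
        have n2 : 0 ≤ dist q.1.2 q.2 := dist_nonneg
        have n3 : 0 ≤ dist q.1.1 q.1.2 := dist_nonneg
        nlinarith
    _ = tcost γ + ENNReal.ofReal (2 * Metric.diam S) * ∫⁻ p, edist p.1 p.2 ∂η := by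
        rw [lintegral_add_left (by fun_prop), lintegral_const_mul _ (by fun_prop)]
        congr 1
        · rw [tcost, ← hθ2, lintegral_map hcm hm12]
        · rw [← hθ1, lintegral_map hem measurable_fst]

lemma couple_of_partition {X : Type*} [MetricSpace X] [MeasurableSpace X] [BorelSpace X]
    [SecondCountableTopology X] {S : Set X} (μ ν : Measure X)
    (hμ : IsProbabilityMeasure μ) (hν : IsProbabilityMeasure ν) (hμS : μ Sᶜ = 0) (hνS : ν Sᶜ = 0)
    (A : ℕ → Set X) (hA : ∀ i, MeasurableSet (A i)) (hdisj : Pairwise (Function.onFun Disjoint A)) 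
    (N : ℕ) (hcov : S ⊆ ⋃ i ∈ Finset.range N, A i) (r D t s : ENNReal) (hts : t + s = 1)
    (hr : ∀ i, ∀ x ∈ A i, ∀ y ∈ A i, edist x y ≤ r) (hD : ∀ x ∈ S, ∀ y ∈ S, edist x y ≤ D)
    (hmass : ∀ i ∈ Finset.range N, t * ν (A i) ≤ μ (A i)) :
    ∃ η : Measure (X × X), η.map Prod.fst = μ ∧ η.map Prod.snd = ν ∧ 
      ∫⁻ p, edist p.1 p.2 ∂η ≤ r + D * s := by
  have ht1 : t ≤ 1 := hts ▸ le_self_add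
  have httop : t ≠ ⊤ := ne_top_of_le_ne_top ENNReal.one_ne_top ht1
  have hsum : ∀ m : Measure X, m Sᶜ = 0 → ∀ B, MeasurableSet B → 
      ∑ i ∈ Finset.range N, m (B ∩ A i) = m B := by
    intro m hm B hB
    rw [← measure_biUnion_finset (fun i _ j _ hij => (hdisj hij).mono Set.inter_subset_right Set.inter_subset_right)
      (fun i _ => hB.inter (hA i)), ← Set.inter_iUnion₂]
    apply measure_congr
    have : ∀ᵐ x ∂m, x ∈ S := by rw [ae_iff]; exact hm
    filter_upwards [this] with x hx
    apply propext
    exact ⟨fun h => h.1, fun h => ⟨h, hcov hx⟩⟩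
  set η1 : Measure (X × X) := ∑ i ∈ Finset.range N, (t * (μ (A i))⁻¹) • 
    (μ.restrict (A i)).prod (ν.restrict (A i)) with hη1
  have f1 : ∀ B, MeasurableSet B → (η1.map Prod.fst) B = 
      ∑ i ∈ Finset.range N, (t * (μ (A i))⁻¹) * (μ (B ∩ A i) * ν (A i)) := by
    intro B hB
    rw [Measure.map_apply measurable_fst hB, hη1, Measure.finsetSum_apply]
    refine Finset.sum_congr rfl fun i _ => ?_
    rw [Measure.smul_apply, smul_eq_mul, ← Set.prod_univ, Measure.prod_prod, 
      Measure.restrict_apply hB, Measure.restrict_apply_univ]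
  have f2 : ∀ B, MeasurableSet B → (η1.map Prod.snd) B = 
      ∑ i ∈ Finset.range N, (t * (μ (A i))⁻¹) * (μ (A i) * ν (B ∩ A i)) := by
    intro B hB
    rw [Measure.map_apply measurable_snd hB, hη1, Measure.finsetSum_apply]
    refine Finset.sum_congr rfl fun i _ => ?_
    rw [Measure.smul_apply, smul_eq_mul, ← Set.univ_prod, Measure.prod_prod, 
      Measure.restrict_apply hB, Measure.restrict_apply_univ]
  have hle : η1.map Prod.fst ≤ μ := by
    refine Measure.le_iff.2 fun B hB => ?_
    rw [f1 B hB, ← hsum μ hμS B hB]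
    refine Finset.sum_le_sum fun i hi => ?_
    calc (t * (μ (A i))⁻¹) * (μ (B ∩ A i) * ν (A i)) 
        = ((t * ν (A i)) * (μ (A i))⁻¹) * μ (B ∩ A i) := by ring
      _ ≤ (μ (A i) * (μ (A i))⁻¹) * μ (B ∩ A i) := by gcongr; exact hmass i hi
      _ ≤ 1 * μ (B ∩ A i) := by gcongr; exact ENNReal.mul_inv_le_one _
      _ = _ := one_mul _
  have hsnd : ∀ B, MeasurableSet B → (η1.map Prod.snd) B = t * ν B := by
    intro B hB
    rw [f2 B hB, ← hsum ν hνS B hB, Finset.mul_sum]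
    refine Finset.sum_congr rfl fun i hi => ?_
    by_cases h0 : μ (A i) = 0
    · have h3 := hmass i hi
      rw [h0] at h3
      have h4 : t * ν (B ∩ A i) = 0 := by
        refine le_antisymm (le_trans ?_ h3) zero_le
        gcongr
        exact Set.inter_subset_right
      rw [h4, h0]; simp
    · calc (t * (μ (A i))⁻¹) * (μ (A i) * ν (B ∩ A i)) = 
            (μ (A i) * (μ (A i))⁻¹) * (t * ν (B ∩ A i)) := by ring
        _ = _ := by rw [ENNReal.mul_inv_cancel h0 (measure_ne_top _ _), one_mul]
  have hηmass : η1 Set.univ = t := by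
    have := hsnd Set.univ MeasurableSet.univ
    rwa [Measure.map_apply measurable_snd MeasurableSet.univ, Set.preimage_univ, 
      measure_univ (μ := ν), mul_one] at this
  have hfin1 : IsFiniteMeasure (η1.map Prod.fst) := isFiniteMeasure_of_le μ hle
  set m := μ - η1.map Prod.fst with hm
  have hmadd : m + η1.map Prod.fst = μ := Measure.sub_add_cancel_of_le hle
  have hmu : m Set.univ = s := by
    have : (m + η1.map Prod.fst) Set.univ = 1 := by rw [hmadd]; exact measure_univ
    rw [Measure.add_apply, Measure.map_apply measurable_fst MeasurableSet.univ, Set.preimage_univ, 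
      hηmass, ← hts, add_comm] at this
    exact (ENNReal.add_right_inj httop).1 this
  have hmf : IsFiniteMeasure m := isFiniteMeasure_of_le μ Measure.sub_le
  refine ⟨η1 + m.prod ν, ?_, ?_, ?_⟩
  · rw [Measure.map_add _ _ measurable_fst, Measure.map_fst_prod, measure_univ, one_smul, add_comm, hmadd]
  · rw [Measure.map_add _ _ measurable_snd, Measure.map_snd_prod, hmu]
    ext B hB
    rw [Measure.add_apply, hsnd B hB, Measure.smul_apply, smul_eq_mul, ← add_mul, hts, one_mul]
  · rw [lintegral_add_measure]
    refine add_le_add ?_ ?_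
    · have hlint : ∀ f : X × X → ENNReal, ∫⁻ p, f p ∂η1 = ∑ i ∈ Finset.range N, 
          (t * (μ (A i))⁻¹) * ∫⁻ p in (A i) ×ˢ (A i), f p ∂(μ.prod ν) := by
        intro f
        rw [hη1, lintegral_finsetSum_measure]
        refine Finset.sum_congr rfl fun i _ => ?_
        rw [lintegral_smul_measure, Measure.prod_restrict, smul_eq_mul]
      calc ∫⁻ p, edist p.1 p.2 ∂η1 ≤ ∫⁻ p, r ∂η1 := by
            rw [hlint, hlint]
            refine Finset.sum_le_sum fun i _ => ?_
            refine mul_le_mul' le_rfl ?_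
            refine setLIntegral_mono' ((hA i).prod (hA i)) fun p hp => ?_
            exact hr i _ hp.1 _ hp.2
        _ = r * t := by rw [lintegral_const, hηmass]
        _ ≤ r * 1 := by gcongr
        _ = r := mul_one r
    · have hs1 : ∀ᵐ p ∂(m.prod ν), p.1 ∈ S ∧ p.2 ∈ S := by
        refine plan_supp rfl rfl ?_ ?_
        · rw [Measure.map_fst_prod, measure_univ, one_smul]
          exact le_antisymm ((Measure.sub_le (μ := μ) _).trans hμS.le) zero_le
        · rw [Measure.map_snd_prod, Measure.smul_apply, hνS, smul_zero]
      calc ∫⁻ p, edist p.1 p.2 ∂(m.prod ν) ≤ ∫⁻ p, D ∂(m.prod ν) := 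
            lintegral_mono_ae (hs1.mono fun p hp => hD _ hp.1 _ hp.2)
        _ = D * s := by
          rw [lintegral_const, ← Set.univ_prod_univ, Measure.prod_prod, hmu, measure_univ, mul_one]

lemma weak_couple {X : Type*} [MetricSpace X] [MeasurableSpace X] [BorelSpace X]
    [SecondCountableTopology X] {S : Set X} (hS : IsCompact S) (μ : ℕ → ProbabilityMeasure X)
    (ν : ProbabilityMeasure X) (hμ : ∀ k, (μ k : Measure X) Sᶜ = 0) (hν : (ν : Measure X) Sᶜ = 0)
    (hlim : Tendsto μ atTop (nhds ν)) (ε : ℝ) (hε : 0 < ε) : 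
    ∀ᶠ k in atTop, ∃ η : Measure (X × X), η.map Prod.fst = μ k ∧ η.map Prod.snd = ν ∧ 
      ∫⁻ p, edist p.1 p.2 ∂η ≤ ENNReal.ofReal ε := by
  have hne : Nonempty X := by
    by_contra h
    rw [not_nonempty_iff] at h
    have : (ν : Measure X) Set.univ = 1 := measure_univ
    rw [Set.eq_empty_of_isEmpty (Set.univ : Set X)] at this
    simp at this
  have hex : ∀ i : ℕ, ∃ r ∈ Set.Ioo (ε / 8) (ε / 4), (ν : Measure X) 
      (frontier (Metric.thickening r {TopologicalSpace.denseSeq X i})) = 0 := fun i => 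
    exists_null_frontier_thickening _ _ (by linarith)
  choose R hR hRf using hex
  simp only [Metric.thickening_singleton] at hRf
  set f : ℕ → Set X := fun i => Metric.ball (TopologicalSpace.denseSeq X i) (R i) with hf
  have hfo : ∀ i, IsOpen (f i) := fun i => Metric.isOpen_ball
  have hcovf : S ⊆ ⋃ i, f i := by
    intro x _
    obtain ⟨y, hy, ⟨i, rfl⟩⟩ := 
      Metric.dense_iff.1 (TopologicalSpace.denseRange_denseSeq X) x (ε / 8) (by linarith)
    refine Set.mem_iUnion.2 ⟨i, ?_⟩
    exact Metric.mem_ball'.2 ((Metric.mem_ball.1 hy).trans (hR i).1)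
  obtain ⟨T, hT⟩ := hS.elim_finite_subcover f hfo hcovf
  set A := disjointed f with hAdef
  have hAm : ∀ i, MeasurableSet (A i) := fun i => 
    MeasurableSet.disjointed (fun j => (hfo j).measurableSet) i
  have hAf : ∀ i, (ν : Measure X) (frontier (A i)) = 0 := by
    intro i
    refine disjointedRec (p := fun s => (ν : Measure X) (frontier s) = 0) ?_ (hRf i)
    intro s j hs
    refine measure_mono_null (t := frontier s ∪ frontier (f j)) ?_ (measure_union_null hs (hRf j))
    rw [Set.sdiff_eq]
    refine (frontier_inter_subset _ _).trans ?_
    rw [frontier_compl]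
    exact Set.union_subset_union Set.inter_subset_left Set.inter_subset_right
  have hAsub : ∀ i, A i ⊆ f i := fun i => disjointed_subset f i
  have hcov : S ⊆ ⋃ i ∈ Finset.range (T.sup id + 1), A i := by
    rw [hAdef, biUnion_range_succ_disjointed]
    intro x hx
    obtain ⟨i, hi, hxi⟩ := Set.mem_iUnion₂.1 (hT hx)
    exact le_partialSups_of_le f (Finset.le_sup (f := id) hi) hxi
  set D := Metric.diam S with hDd
  have hD0 : 0 ≤ D := Metric.diam_nonneg
  set s : ℝ := min 1 (ε / (2 * (D + 1))) with hs
  have hs0 : 0 < s := lt_min one_pos (by positivity)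
  have hs1 : s ≤ 1 := min_le_left _ _
  have hDs : D * s ≤ ε / 2 := by
    have : s ≤ ε / (2 * (D + 1)) := min_le_right _ _
    rw [le_div_iff₀ (by positivity)] at this
    nlinarith
  have hev : ∀ᶠ k in atTop, ∀ i ∈ Finset.range (T.sup id + 1), 
      ENNReal.ofReal (1 - s) * (ν : Measure X) (A i) ≤ (μ k : Measure X) (A i) := by
    rw [eventually_all_finset]
    intro i _
    have ht := ProbabilityMeasure.tendsto_measure_of_null_frontier_of_tendsto' hlim (hAf i)
    by_cases h0 : (ν : Measure X) (A i) = 0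
    · simp [h0]
    · have : ENNReal.ofReal (1 - s) * (ν : Measure X) (A i) < (ν : Measure X) (A i) := by
        conv_rhs => rw [← one_mul ((ν : Measure X) (A i))]
        refine ENNReal.mul_lt_mul_left h0 (measure_ne_top _ _) ?_
        rw [← ENNReal.ofReal_one]
        exact (ENNReal.ofReal_lt_ofReal_iff one_pos).2 (by linarith)
      exact (ht.eventually_const_lt this).mono fun _ h => h.le
  filter_upwards [hev] with k hk
  obtain ⟨η, h1, h2, h3⟩ := couple_of_partition (S := S) (μ k : Measure X) ν inferInstance inferInstance (hμ k) hν A hAm 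
    (disjoint_disjointed f) _ hcov (ENNReal.ofReal (ε / 2)) (ENNReal.ofReal D) (ENNReal.ofReal (1 - s)) 
    (ENNReal.ofReal s) (by rw [← ENNReal.ofReal_add (by linarith) hs0.le]; simp) 
    (fun i x hx y hy => by
      rw [edist_dist]
      apply ENNReal.ofReal_le_ofReal
      have a1 := Metric.mem_ball.1 (hAsub i hx)
      have a2 := Metric.mem_ball'.1 (hAsub i hy)
      have := dist_triangle x (TopologicalSpace.denseSeq X i) y
      linarith [(hR i).2])
    (fun x hx y hy => by
      rw [edist_dist]
      exact ENNReal.ofReal_le_ofReal (Metric.dist_le_diam_of_mem hS.isBounded hx hy)) hk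
  refine ⟨η, h1, h2, h3.trans ?_⟩
  rw [← ENNReal.ofReal_mul hD0, ← ENNReal.ofReal_add (by positivity) (by positivity)]
  exact ENNReal.ofReal_le_ofReal (by linarith)

lemma W2sq_usc {X : Type*} [MetricSpace X] [MeasurableSpace X] [BorelSpace X]
    [SecondCountableTopology X] [CompleteSpace X] {S : Set X} (hS : IsCompact S)
    (μ : ℕ → ProbabilityMeasure X) (ν : ProbabilityMeasure X) (c : Measure X)
    (hμ : ∀ k, (μ k : Measure X) Sᶜ = 0) (hν : (ν : Measure X) Sᶜ = 0) (hc : c Sᶜ = 0)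
    (hlim : Tendsto μ atTop (nhds ν)) (γ : Measure (X × X)) (h1 : γ.map Prod.fst = ν)
    (h2 : γ.map Prod.snd = c) (C : ENNReal) (hC : tcost γ < C) :
    ∀ᶠ k in atTop, W2sq (μ k : Measure X) c ≤ C := by
  obtain ⟨δ, hδ, hlt⟩ := ENNReal.lt_iff_exists_add_pos_lt.1 hC
  have hD0 : 0 ≤ Metric.diam S := Metric.diam_nonneg
  have hδ' : (0 : ℝ) < δ := hδ
  filter_upwards [weak_couple hS μ ν hμ hν hlim (δ / (2 * Metric.diam S + 1)) (by positivity)]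
    with k hk
  obtain ⟨η, e1, e2, e3⟩ := hk
  refine (glue hS _ _ _ η γ inferInstance (hμ k) hν hc e1 e2 h1 h2).trans (le_trans ?_ hlt.le)
  refine add_le_add le_rfl ((mul_le_mul' le_rfl e3).trans ?_)
  rw [← ENNReal.ofReal_mul (by positivity), ← ENNReal.ofReal_coe_nnreal]
  apply ENNReal.ofReal_le_ofReal
  rw [mul_div_assoc', div_le_iff₀ (by positivity)]
  nlinarith

lemma densK_closed {d : ℕ} {Ω : Set (EuclideanSpace ℝ (Fin d))} (hcomp : IsCompact Ω)
    (μ : ℕ → ProbabilityMeasure (EuclideanSpace ℝ (Fin d)))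
    (m : ProbabilityMeasure (EuclideanSpace ℝ (Fin d)))
    (hμ : ∀ k, (μ k : Measure (EuclideanSpace ℝ (Fin d))) ∈ densK Ω)
    (hlim : Tendsto μ atTop (nhds m)) : (m : Measure (EuclideanSpace ℝ (Fin d))) ∈ densK Ω := by
  have hopen : ∀ G, IsOpen G → ∀ b : ENNReal,
      (∀ k, (μ k : Measure (EuclideanSpace ℝ (Fin d))) G ≤ b) →
      (m : Measure (EuclideanSpace ℝ (Fin d))) G ≤ b := by
    intro G hG b hb
    refine (ProbabilityMeasure.le_liminf_measure_open_of_tendsto hlim hG).trans ?_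
    exact (liminf_le_liminf (Eventually.of_forall hb)).trans (liminf_const b).le
  refine ⟨inferInstance, Measure.le_iff.2 fun B hB => ?_, ?_⟩
  · rw [B.measure_eq_iInf_isOpen volume]
    refine le_iInf₂ fun U hU => le_iInf fun hUo => ?_
    exact (measure_mono hU).trans (hopen U hUo _ fun k => (hμ k).2.1 U)
  · exact le_antisymm (hopen _ hcomp.isClosed.isOpen_compl 0 fun k => (hμ k).2.2.le) zero_le

/-- If `ρ_k → ρ` weakly in `𝒫(Ω)` (`Ω` compact convex), then the `W₂`-projections
onto `K = {dμ/dLeb ≤ 1}` converge weakly, and also in `W₂`; in particular the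
projection is continuous. -/
theorem projection_weakly_continuous {d : ℕ}
    (Ω : Set (EuclideanSpace ℝ (Fin d)))
    (hconv : Convex ℝ Ω) (hcomp : IsCompact Ω)
    (ρ : ℕ → Measure (EuclideanSpace ℝ (Fin d)))
    (ρlim : Measure (EuclideanSpace ℝ (Fin d)))
    (hρ : ∀ k, IsProbabilityMeasure (ρ k) ∧ (ρ k) Ωᶜ = 0)
    (hρlim : IsProbabilityMeasure ρlim ∧ ρlim Ωᶜ = 0)
    (hweak : ∀ f : BoundedContinuousFunction (EuclideanSpace ℝ (Fin d)) ℝ,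
      Tendsto (fun k => ∫ x, f x ∂(ρ k)) atTop (nhds (∫ x, f x ∂ρlim)))
    (ν : ℕ → Measure (EuclideanSpace ℝ (Fin d)))
    (νlim : Measure (EuclideanSpace ℝ (Fin d)))
    (hν : ∀ k, ν k ∈ densK Ω ∧ ∀ σ ∈ densK Ω, W2sq (ρ k) (ν k) ≤ W2sq (ρ k) σ)
    (hνlim : νlim ∈ densK Ω ∧ ∀ σ ∈ densK Ω, W2sq ρlim νlim ≤ W2sq ρlim σ) :
    (∀ f : BoundedContinuousFunction (EuclideanSpace ℝ (Fin d)) ℝ,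
      Tendsto (fun k => ∫ x, f x ∂(ν k)) atTop (nhds (∫ x, f x ∂νlim))) ∧
    Tendsto (fun k => W2sq (ν k) νlim) atTop (nhds 0) := by
  have hΩm : MeasurableSet Ω := hcomp.isClosed.measurableSet
  set ρP : ℕ → ProbabilityMeasure (EuclideanSpace ℝ (Fin d)) := fun k => ⟨ρ k, (hρ k).1⟩ with hρP
  set ρL : ProbabilityMeasure (EuclideanSpace ℝ (Fin d)) := ⟨ρlim, hρlim.1⟩ with hρL
  set νP : ℕ → ProbabilityMeasure (EuclideanSpace ℝ (Fin d)) := fun k => ⟨ν k, (hν k).1.1⟩ with hνP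
  set νL : ProbabilityMeasure (EuclideanSpace ℝ (Fin d)) := ⟨νlim, hνlim.1.1⟩ with hνL
  have hρt : Tendsto ρP atTop (nhds ρL) :=
    ProbabilityMeasure.tendsto_iff_forall_integral_tendsto.2 hweak
  have hlimP := hρlim.1
  obtain ⟨γs, gs1, gs2, gs3⟩ := exists_opt hcomp ρlim νlim hρlim.1 hνlim.1.1 hρlim.2 hνlim.1.2.2
  have hWtop : W2sq ρlim νlim ≠ ⊤ := by
    rw [← gs3]
    have hp : IsProbabilityMeasure γs := prob_of_map_fst hρlim.1 gs1
    have : tcost γs ≤ ∫⁻ _, ENNReal.ofReal (Metric.diam Ω ^ 2) ∂γs := by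
      refine lintegral_mono_ae ((plan_supp gs1 gs2 hρlim.2 hνlim.1.2.2).mono fun p hp => ?_)
      exact ENNReal.ofReal_le_ofReal (pow_le_pow_left₀ dist_nonneg
        (Metric.dist_le_diam_of_mem hcomp.isBounded hp.1 hp.2) 2)
    rw [lintegral_const, measure_univ, mul_one] at this
    exact ne_top_of_le_ne_top ENNReal.ofReal_ne_top this
  have hopt : ∀ k, ∃ γ : Measure (EuclideanSpace ℝ (Fin d) × EuclideanSpace ℝ (Fin d)),
      γ.map Prod.fst = ρ k ∧ γ.map Prod.snd = ν k ∧ tcost γ = W2sq (ρ k) (ν k) := fun k =>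
    exists_opt hcomp (ρ k) (ν k) (hρ k).1 (hν k).1.1 (hρ k).2 (hν k).1.2.2
  choose γ g1 g2 g3 using hopt
  have hC : ∀ C' > W2sq ρlim νlim, ∀ᶠ k in atTop, tcost (γ k) ≤ C' := by
    intro C' hC'
    filter_upwards [W2sq_usc hcomp ρP ρL νlim (fun k => (hρ k).2) hρlim.2 hνlim.1.2.2 hρt γs gs1 gs2
      C' (by rw [gs3]; exact hC')] with k hk
    rw [g3]
    exact ((hν k).2 _ hνlim.1).trans hk
  have key : Tendsto νP atTop (nhds νL) := by
    refine tendsto_of_subseq_tendsto fun ns hns => ?_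
    obtain ⟨m, φ, hφ, hm⟩ := subseq_of_compact hcomp (νP ∘ ns) (fun k => (hν (ns k)).1.2.2)
    refine ⟨φ, ?_⟩
    have hnφ : Tendsto (ns ∘ φ) atTop atTop := hns.comp hφ.tendsto_atTop
    have hmK : (m : Measure (EuclideanSpace ℝ (Fin d))) ∈ densK Ω :=
      densK_closed hcomp (fun k => νP (ns (φ k))) m (fun k => (hν (ns (φ k))).1) hm
    obtain ⟨g, e1, e2, e3⟩ := plan_lim hcomp (fun k => ρP (ns (φ k))) (fun k => νP (ns (φ k))) ρL m
      (fun k => (hρ _).2) (fun k => (hν _).1.2.2) (hρt.comp hnφ) hm (fun k => γ (ns (φ k)))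
      (fun k => g1 _) (fun k => g2 _) _ (fun C' h => hnφ.eventually (hC C' h))
    have hmin : ∀ γ' : Measure (EuclideanSpace ℝ (Fin d) × EuclideanSpace ℝ (Fin d)),
        γ'.map Prod.fst = ρlim → γ'.map Prod.snd ∈ densK Ω → W2sq ρlim νlim ≤ tcost γ' :=
      fun γ' h1 h2 => (hνlim.2 _ h2).trans (W2sq_le h1 rfl)
    have heq : νlim = (m : Measure (EuclideanSpace ℝ (Fin d))) := by
      have := proj_unique hcomp ρlim ![νlim, (m : Measure (EuclideanSpace ℝ (Fin d)))] ![γs, g]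
        (by intro i; fin_cases i; exacts [gs1, e1]) (by intro i; fin_cases i; exacts [gs2, e2])
        (by intro i; fin_cases i; exacts [hνlim.1, hmK]) _ hWtop
        (by
          intro i
          fin_cases i
          · exact gs3
          · exact le_antisymm e3 (hmin g e1 (by rw [e2]; exact hmK))) hmin
      exact this
    have : m = νL := Subtype.ext heq.symm
    rw [← this]
    exact hm
  refine ⟨ProbabilityMeasure.tendsto_iff_forall_integral_tendsto.1 key, ?_⟩
  rw [ENNReal.tendsto_nhds_zero]
  intro ε hε
  have hd : Measurable fun x : EuclideanSpace ℝ (Fin d) => (x, x) := by fun_prop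
  refine W2sq_usc hcomp νP νL νlim (fun k => (hν k).1.2.2) hνlim.1.2.2 hνlim.1.2.2 key
    (νlim.map fun x => (x, x)) ?_ ?_ ε ?_
  · rw [Measure.map_map measurable_fst hd]; exact Measure.map_id
  · rw [Measure.map_map measurable_snd hd]; exact Measure.map_id
  · refine lt_of_le_of_lt (le_of_eq ?_) hε
    unfold tcost
    rw [lintegral_map (by fun_prop) hd]
    simp
end
end
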